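/- Let R > 0 and let Ω = W_R = {x ∈ ℝ^N : H⁰(x) < R} be the Wulff ball of radius R. Let (u_p) be least energy solutions of the Finsler Lane-Emden problem -Q_N u = u^p in W_R, u > 0 in W_R, u = 0 on ∂W_R. Then the blow-up set S of v_p = u_p/(∫_{W_R} u_p^p dx)^{1/(N-1)} satisfies S ∩ W_R = {0}, and the measures with densities f_p = u_p^p / ∫_{W_R} u_p^p dx converge weak-* to the Dirac measure δ₀ at the origin, in the sense of Radon measures on W_R, as p → ∞ (along the full family, no subsequence needed). -/

import Mathlib

open MeasureTheory Filter Real Set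
open scoped RealInnerProductSpace Topology NNReal

noncomputable section

abbrev Euc (N : ℕ) := EuclideanSpace ℝ (Fin N)

/-- `H` is a norm on `ℝ^N`: convex, nonnegative, vanishing exactly at `0`,
and absolutely homogeneous. -/
def IsFinslerNorm (N : ℕ) (H : Euc N → ℝ) : Prop :=
  ConvexOn ℝ Set.univ H ∧
  (∀ ξ, 0 ≤ H ξ) ∧
  (∀ ξ, H ξ = 0 ↔ ξ = 0) ∧
  (∀ (t : ℝ) (ξ : Euc N), H (t • ξ) = |t| * H ξ)

/-- Regularity assumptions: `H ∈ C²(ℝ^N \ {0})`, `H^N ∈ C¹(ℝ^N)`, and the Hessian of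
`H^N` is positive definite away from the origin. -/
def FinslerRegular (N : ℕ) (H : Euc N → ℝ) : Prop :=
  ContDiffOn ℝ 2 H {(0 : Euc N)}ᶜ ∧
  ContDiff ℝ 1 (fun ξ => H ξ ^ N) ∧
  ∀ ξ : Euc N, ξ ≠ 0 → ∀ v : Euc N, v ≠ 0 →
    0 < iteratedFDeriv ℝ 2 (fun ξ => H ξ ^ N) ξ ![v, v]

/-- The dual norm `H⁰(x) = sup_{ξ ≠ 0} ⟪x, ξ⟫ / H(ξ)`. -/
def dualNorm {N : ℕ} (H : Euc N → ℝ) (x : Euc N) : ℝ :=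
  sSup {r : ℝ | ∃ ξ : Euc N, ξ ≠ 0 ∧ r = ⟪x, ξ⟫ / H ξ}

/-- `κ_N`, the volume of the Wulff ball `{H⁰ < 1}`. -/
def wulffVol (N : ℕ) (H : Euc N → ℝ) : ℝ :=
  (volume {x : Euc N | dualNorm H x < 1}).toReal

/-- `β_N = N (N κ_N)^{1/(N-1)}`. -/
def betaN (N : ℕ) (H : Euc N → ℝ) : ℝ :=
  N * (N * wulffVol N H) ^ ((1 : ℝ) / ((N : ℝ) - 1))

/-- `u` is a weak solution of `-Q_N u = g` on the open set `U`:
`∫_U H(∇u)^{N-1} ⟪∇H(∇u), ∇φ⟫ = ∫_U g φ` for all test functions `φ`. -/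
def IsWeakSolution (N : ℕ) (H : Euc N → ℝ) (U : Set (Euc N)) (u g : Euc N → ℝ) : Prop :=
  ∀ φ : Euc N → ℝ, ContDiff ℝ (⊤ : ℕ∞) φ → HasCompactSupport φ → tsupport φ ⊆ U →
    (∫ x in U, H (gradient u x) ^ (N - 1) * ⟪gradient H (gradient u x), gradient φ x⟫)
      = ∫ x in U, g x * φ x

/-- `C_p`, the infimum of `∫_Ω H(∇u)^N` over test functions normalized in `L^{p+1}`. -/
def energyInf (N : ℕ) (H : Euc N → ℝ) (Ω : Set (Euc N)) (p : ℝ) : ℝ :=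
  sInf {c : ℝ | ∃ u : Euc N → ℝ, ContDiff ℝ (⊤ : ℕ∞) u ∧ HasCompactSupport u ∧
    tsupport u ⊆ Ω ∧ (∫ x in Ω, |u x| ^ (p + 1)) = 1 ∧
    c = ∫ x in Ω, H (gradient u x) ^ N}

/-- A least energy solution of the Finsler Lane–Emden problem on `Ω` with exponent `p`. -/
def IsLeastEnergySolution (N : ℕ) (H : Euc N → ℝ) (Ω : Set (Euc N)) (p : ℝ)
    (u : Euc N → ℝ) : Prop :=
  ContDiffOn ℝ 1 u (closure Ω) ∧
  (∀ x ∈ Ω, 0 < u x) ∧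
  (∀ x ∈ frontier Ω, u x = 0) ∧
  IsWeakSolution N H Ω u (fun x => u x ^ p) ∧
  (∫ x in Ω, H (gradient u x) ^ N)
    = energyInf N H Ω p * (∫ x in Ω, u x ^ (p + 1)) ^ ((N : ℝ) / (p + 1))

/-- The blow-up set of a sequence of functions `v n` on `Ω`. -/
def BlowUpSet {N : ℕ} (Ω : Set (Euc N)) (v : ℕ → Euc N → ℝ) : Set (Euc N) :=
  {x | x ∈ closure Ω ∧ ∃ σ : ℕ → ℕ, StrictMono σ ∧ ∃ xs : ℕ → Euc N,
    (∀ n, xs n ∈ Ω) ∧ Tendsto xs atTop (𝓝 x) ∧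
    Tendsto (fun n => v (σ n) (xs n)) atTop atTop}

/-- The blow-up set of a family `(v_p)_{p>1}` as `p → ∞`. -/
def BlowUpSetFam {N : ℕ} (Ω : Set (Euc N)) (v : ℝ → Euc N → ℝ) : Set (Euc N) :=
  {x | x ∈ closure Ω ∧ ∃ pn : ℕ → ℝ, Tendsto pn atTop atTop ∧ ∃ xs : ℕ → Euc N,
    (∀ n, xs n ∈ Ω) ∧ Tendsto xs atTop (𝓝 x) ∧
    Tendsto (fun n => v (pn n) (xs n)) atTop atTop}

/-- Brunn–Minkowski inequality on the line, for weighted sums of measurable sets. -/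
theorem volume_add_le_of_add_mem {A B C : Set ℝ} (hA : MeasurableSet A) (hB : MeasurableSet B)
    (hA0 : A.Nonempty) (hB0 : B.Nonempty) (h : ∀ x ∈ A, ∀ y ∈ B, x + y ∈ C) :
    volume A + volume B ≤ volume C := by
  have key : ∀ K ⊆ A, IsCompact K → ∀ L ⊆ B, IsCompact L → volume K + volume L ≤ volume C := by
    have aux : ∀ K ⊆ A, IsCompact K → K.Nonempty → ∀ L ⊆ B, IsCompact L → L.Nonempty →
        volume K + volume L ≤ volume C := by
      intro K hKA hK hK0 L hLB hL hL0
      obtain ⟨a, haK, ha⟩ := hK.exists_isGreatest hK0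
      obtain ⟨b, hbL, hb⟩ := hL.exists_isLeast hL0
      have h1 : volume ((fun x => b + x) '' K) = volume K := by
        rw [image_add_left, measure_preimage_add]
      have h2 : volume ((fun x => a + x) '' L) = volume L := by
        rw [image_add_left, measure_preimage_add]
      have hmL : MeasurableSet ((fun x => a + x) '' L) :=
        (hL.image (continuous_const.add continuous_id)).measurableSet
      have h3 : volume (((fun x => b + x) '' K) ∩ ((fun x => a + x) '' L)) = 0 := by
        refine measure_mono_null (t := {a + b}) ?_ (measure_singleton _)
        rintro z ⟨⟨x, hx, rfl⟩, ⟨y, hy, hxy⟩⟩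
        have := ha hx
        have := hb hy
        simp only [mem_singleton_iff] at *
        linarith
      have h4 := measure_union_add_inter (μ := volume) ((fun x => b + x) '' K) hmL
      rw [h3, add_zero, h1, h2] at h4
      rw [← h4]
      refine measure_mono ?_
      rintro z (⟨x, hx, rfl⟩ | ⟨y, hy, rfl⟩)
      · simpa only [add_comm] using h x (hKA hx) b (hLB hbL)
      · exact h a (hKA haK) y (hLB hy)
    intro K hKA hK L hLB hL
    obtain ⟨a, ha⟩ := hA0
    obtain ⟨b, hb⟩ := hB0
    refine le_trans (add_le_add (measure_mono (subset_insert a K))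
      (measure_mono (subset_insert b L))) ?_
    exact aux _ (insert_subset ha hKA) (hK.insert a) (insert_nonempty _ _) _
      (insert_subset hb hLB) (hL.insert b) (insert_nonempty _ _)
  have key2 : ∀ L ⊆ B, IsCompact L → volume A + volume L ≤ volume C := by
    intro L hLB hL
    have hLf : volume L ≠ ⊤ := hL.measure_lt_top.ne
    have : volume A ≤ volume C - volume L := by
      rw [hA.measure_eq_iSup_isCompact]
      exact iSup₂_le fun K hKA => iSup_le fun hK =>
        ENNReal.le_sub_of_add_le_right hLf (key K hKA hK L hLB hL)
    refine (add_le_add_left this _).trans ?_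
    rw [tsub_add_cancel_of_le]
    exact le_trans (by simp) (key ∅ (empty_subset _) isCompact_empty L hLB hL)
  have hAC : volume A ≤ volume C := by
    simpa using key2 ∅ (empty_subset _) isCompact_empty
  by_cases hAf : volume A = ⊤
  · rw [hAf, top_le_iff] at hAC
    rw [hAC]; exact le_top
  have : volume B ≤ volume C - volume A := by
    rw [hB.measure_eq_iSup_isCompact]
    exact iSup₂_le fun L hLB => iSup_le fun hL =>
      ENNReal.le_sub_of_add_le_left hAf (key2 L hLB hL)
  refine (add_le_add_right this _).trans ?_
  rw [add_tsub_cancel_of_le hAC]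

/-- The Prékopa–Leindler inequality on the line for functions normalized to have supremum `1`. -/
theorem prekopa_leindler_line_normalized {l : ℝ} (hl0 : 0 < l) (hl1 : l < 1) {f g h : ℝ → ℝ}
    (hf : Measurable f) (hg : Measurable g) (hh : Measurable h)
    (hf0 : ∀ x, 0 ≤ f x) (hg0 : ∀ x, 0 ≤ g x) (hh0 : ∀ x, 0 ≤ h x)
    (hf1 : ∀ x, f x ≤ 1) (hg1 : ∀ x, g x ≤ 1)
    (hfs : ∀ t < 1, ∃ x, t < f x) (hgs : ∀ t < 1, ∃ x, t < g x)
    (H : ∀ t, 0 < t → ∀ x y, t < f x → t < g y → t < h ((1 - l) * x + l * y)) :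
    ENNReal.ofReal (1 - l) * (∫⁻ x, ENNReal.ofReal (f x)) + ENNReal.ofReal l *
      (∫⁻ x, ENNReal.ofReal (g x)) ≤ ∫⁻ x, ENNReal.ofReal (h x) := by
  have hmeas : ∀ (k : ℝ → ℝ), Measurable fun t : ℝ => volume {x | t < k x} := fun k =>
    Antitone.measurable fun s t hst => measure_mono fun x hx => lt_of_le_of_lt hst hx
  have hscale : ∀ c : ℝ, 0 < c → ∀ s : Set ℝ, volume ((fun x => c * x) '' s)
      = ENNReal.ofReal c * volume s := by
    intro c hc s
    have := Measure.addHaar_smul (volume : Measure ℝ) c s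
    simpa [abs_of_pos hc, ← image_smul] using this
  rw [lintegral_eq_lintegral_meas_lt volume (ae_of_all _ hf0) hf.aemeasurable,
    lintegral_eq_lintegral_meas_lt volume (ae_of_all _ hg0) hg.aemeasurable,
    lintegral_eq_lintegral_meas_lt volume (ae_of_all _ hh0) hh.aemeasurable,
    ← lintegral_const_mul _ (hmeas f), ← lintegral_const_mul _ (hmeas g),
    ← lintegral_add_left ((hmeas f).const_mul _)]
  refine setLIntegral_mono' measurableSet_Ioi fun t ht => ?_
  rcases lt_or_ge t 1 with ht1 | ht1
  · rw [← hscale _ (sub_pos.2 hl1), ← hscale _ hl0]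
    refine volume_add_le_of_add_mem
      ((measurableEmbedding_mulLeft₀ (sub_pos.2 hl1).ne').measurableSet_image.2
        (measurableSet_lt measurable_const hf))
      ((measurableEmbedding_mulLeft₀ hl0.ne').measurableSet_image.2
        (measurableSet_lt measurable_const hg))
      (Nonempty.image _ (hfs t ht1)) (Nonempty.image _ (hgs t ht1)) ?_
    rintro _ ⟨x, hx, rfl⟩ _ ⟨y, hy, rfl⟩
    exact H t ht x y hx hy
  · have e1 : {x | t < f x} = ∅ := by
      ext x; simpa using (hf1 x).trans ht1
    have e2 : {x | t < g x} = ∅ := by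
      ext x; simpa using (hg1 x).trans ht1
    simp [e1, e2]

theorem ENNReal.rpow_mul_rpow_le_add {l : ℝ} (hl0 : 0 < l) (hl1 : l < 1) (a b : ENNReal) :
    a ^ (1 - l) * b ^ l ≤ ENNReal.ofReal (1 - l) * a + ENNReal.ofReal l * b := by
  have hpq : (1 - l)⁻¹.HolderConjugate l⁻¹ := by
    refine Real.holderConjugate_iff.2 ⟨?_, ?_⟩
    · exact (one_lt_inv₀ (sub_pos.2 hl1)).2 (by linarith)
    · simp
  have := ENNReal.young_inequality (a ^ (1 - l)) (b ^ l) hpq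
  rw [← ENNReal.rpow_mul, ← ENNReal.rpow_mul, mul_inv_cancel₀ (sub_pos.2 hl1).ne',
    mul_inv_cancel₀ hl0.ne', ENNReal.rpow_one, ENNReal.rpow_one] at this
  refine this.trans (le_of_eq ?_)
  rw [ENNReal.ofReal_inv_of_pos (sub_pos.2 hl1), ENNReal.ofReal_inv_of_pos hl0,
    ENNReal.div_eq_inv_mul, ENNReal.div_eq_inv_mul, inv_inv, inv_inv]

theorem prekopa_leindler_line_of_bounded {l : ℝ} (hl0 : 0 < l) (hl1 : l < 1)
    {f g h : ℝ → ENNReal} (hf : Measurable f) (hg : Measurable g) (hh : Measurable h)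
    (hfb : ⨆ x, f x ≠ ⊤) (hgb : ⨆ x, g x ≠ ⊤)
    (H : ∀ x y, f x ^ (1 - l) * g y ^ l ≤ h ((1 - l) * x + l * y)) :
    (∫⁻ x, f x) ^ (1 - l) * (∫⁻ x, g x) ^ l ≤ ∫⁻ x, h x := by
  have hl1' := sub_pos.2 hl1
  set a := ⨆ x, f x with ha
  set b := ⨆ x, g x with hb
  have hfa : ∀ x, f x ≤ a := le_iSup f
  have hgb' : ∀ x, g x ≤ b := le_iSup g
  by_cases ha0 : a = 0
  · have : ∀ x, f x = 0 := fun x => le_antisymm (ha0 ▸ hfa x) bot_le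
    simp [this, ENNReal.zero_rpow_of_pos hl1']
  by_cases hb0 : b = 0
  · have : ∀ x, g x = 0 := fun x => le_antisymm (hb0 ▸ hgb' x) bot_le
    simp [this, ENNReal.zero_rpow_of_pos hl0]
  set c := a ^ (1 - l) * b ^ l with hc
  have hc0 : c ≠ 0 := by
    simp [hc, ENNReal.rpow_eq_zero_iff, ha0, hb0, hfb, hgb]
  have hct : c ≠ ⊤ :=
    ENNReal.mul_ne_top (ENNReal.rpow_ne_top_of_nonneg hl1'.le hfb)
      (ENNReal.rpow_ne_top_of_nonneg hl0.le hgb)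
  have hdiv : ∀ (k : ℝ → ENNReal) (s : ENNReal), s ≠ 0 → s ≠ ⊤ → (∀ x, k x ≤ s) →
      (∀ x, ENNReal.ofReal (k x / s).toReal = k x / s) := fun k s hs0 hst hk x =>
    ENNReal.ofReal_toReal (ENNReal.div_ne_top ((hk x).trans_lt hst.lt_top).ne hs0)
  have hle1 : ∀ (k : ℝ → ENNReal) (s : ENNReal), (∀ x, k x ≤ s) →
      ∀ x, (k x / s).toReal ≤ 1 := fun k s hk x =>
    ENNReal.toReal_le_of_le_ofReal zero_le_one (by
      rw [ENNReal.ofReal_one]; exact ENNReal.div_le_of_le_mul (by simpa using hk x))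
  have hsup : ∀ (k : ℝ → ENNReal), (⨆ x, k x) ≠ 0 → (⨆ x, k x) ≠ ⊤ → ∀ t < (1 : ℝ),
      ∃ x, t < (k x / ⨆ x, k x).toReal := by
    intro k hk0 hkt t ht
    by_contra! hcon
    have h1 : ∀ x, k x ≤ ENNReal.ofReal t * ⨆ x, k x := fun x => by
      have h2 : k x / (⨆ x, k x) ≤ ENNReal.ofReal t := by
        rw [← hdiv k _ hk0 hkt (le_iSup k) x]
        exact ENNReal.ofReal_le_ofReal (hcon x)
      exact (ENNReal.div_le_iff hk0 hkt).1 h2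
    have h3 : (⨆ x, k x) ≤ ENNReal.ofReal t * ⨆ x, k x := iSup_le h1
    have h4 : ENNReal.ofReal t * (⨆ x, k x) < 1 * ⨆ x, k x :=
      ENNReal.mul_lt_mul_left hk0 hkt (by
        rw [← ENNReal.ofReal_one]; exact (ENNReal.ofReal_lt_ofReal_iff one_pos).2 ht)
    rw [one_mul] at h4
    exact absurd h3 (not_le.2 h4)
  have main := prekopa_leindler_line_normalized hl0 hl1 (f := fun x => (f x / a).toReal)
    (g := fun x => (g x / b).toReal) (h := fun x => (min (h x / c) 1).toReal)
    (hf.div_const a).ennreal_toReal (hg.div_const b).ennreal_toReal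
    ((hh.div_const c).min measurable_const).ennreal_toReal
    (fun x => ENNReal.toReal_nonneg) (fun x => ENNReal.toReal_nonneg)
    (fun x => ENNReal.toReal_nonneg) (hle1 f a hfa) (hle1 g b hgb')
    (hsup f ha0 hfb) (hsup g hb0 hgb) ?_
  · simp only [hdiv f a ha0 hfb hfa, hdiv g b hb0 hgb hgb'] at main
    have h5 : ∫⁻ x, ENNReal.ofReal (min (h x / c) 1).toReal ≤ (∫⁻ x, h x) / c := by
      rw [div_eq_mul_inv, ← lintegral_mul_const' _ _ (ENNReal.inv_ne_top.2 hc0)]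
      refine lintegral_mono fun x => ?_
      exact ENNReal.ofReal_toReal_le.trans (min_le_left _ _)
    have h6 := (ENNReal.rpow_mul_rpow_le_add hl0 hl1 _ _).trans (main.trans h5)
    simp only [div_eq_mul_inv] at h6
    rw [lintegral_mul_const' _ _ (ENNReal.inv_ne_top.2 ha0),
      lintegral_mul_const' _ _ (ENNReal.inv_ne_top.2 hb0), ← div_eq_mul_inv, ← div_eq_mul_inv,
      ENNReal.div_rpow_of_nonneg _ _ hl1'.le, ENNReal.div_rpow_of_nonneg _ _ hl0.le] at h6
    rw [← ENNReal.mul_div_mul_comm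
      (Or.inl (by simp [ENNReal.rpow_eq_zero_iff, ha0, hfb]))
      (Or.inl (ENNReal.rpow_ne_top_of_nonneg hl1'.le hfb)), ENNReal.div_le_iff hc0 hct,
      mul_assoc, ENNReal.inv_mul_cancel hc0 hct, mul_one] at h6
    exact h6
  · intro t ht x y hx hy
    have htop : min (h ((1 - l) * x + l * y) / c) 1 ≠ ⊤ := by simp
    rw [← ENNReal.ofReal_lt_iff_lt_toReal ht.le htop]
    rw [← ENNReal.ofReal_lt_iff_lt_toReal ht.le
      (by rw [← hdiv f a ha0 hfb hfa]; exact ENNReal.ofReal_ne_top)] at hx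
    rw [← ENNReal.ofReal_lt_iff_lt_toReal ht.le
      (by rw [← hdiv g b hb0 hgb hgb']; exact ENNReal.ofReal_ne_top)] at hy
    have ht1 : ENNReal.ofReal t < 1 := hx.trans_le (by
      rw [← hdiv f a ha0 hfb hfa, ← ENNReal.ofReal_one]
      exact ENNReal.ofReal_le_ofReal (hle1 f a hfa x))
    refine lt_min ?_ ht1
    calc ENNReal.ofReal t = ENNReal.ofReal t ^ (1 - l) * ENNReal.ofReal t ^ l := by
          rw [← ENNReal.rpow_add_of_nonneg _ _ hl1'.le hl0.le]; simp
      _ < (f x / a) ^ (1 - l) * (g y / b) ^ l :=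
          ENNReal.mul_lt_mul (ENNReal.rpow_lt_rpow hx hl1') (ENNReal.rpow_lt_rpow hy hl0)
      _ = f x ^ (1 - l) * g y ^ l / c := by
          rw [ENNReal.div_rpow_of_nonneg _ _ hl1'.le, ENNReal.div_rpow_of_nonneg _ _ hl0.le,
            ENNReal.mul_div_mul_comm
              (Or.inl (by simp [ENNReal.rpow_eq_zero_iff, ha0, hfb]))
              (Or.inl (ENNReal.rpow_ne_top_of_nonneg hl1'.le hfb))]
      _ ≤ _ := ENNReal.div_le_div_right (H x y) c

theorem ENNReal.iSup_min_natCast (a : ENNReal) : ⨆ n : ℕ, min a n = a := by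
  refine le_antisymm (iSup_le fun n => min_le_left _ _) ?_
  refine le_of_forall_lt fun c hc => ?_
  obtain ⟨n, hn⟩ := ENNReal.exists_nat_gt (ne_top_of_lt hc)
  exact (lt_min hc hn).trans_le (le_iSup (fun n : ℕ => min a (n : ENNReal)) n)

theorem lintegral_rpow_eq_iSup_min {f : ℝ → ENNReal} (hf : Measurable f) {l : ℝ} (hl : 0 < l) :
    (∫⁻ x, f x) ^ l = ⨆ n : ℕ, (∫⁻ x, min (f x) n) ^ l := by
  have h1 : ∫⁻ x, f x = ⨆ n : ℕ, ∫⁻ x, min (f x) n := by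
    rw [← lintegral_iSup (fun n => hf.min measurable_const)
      (fun m n hmn x => min_le_min le_rfl (Nat.cast_le.2 hmn))]
    simp only [ENNReal.iSup_min_natCast]
  rw [h1]
  exact (ENNReal.orderIsoRpow l hl).map_iSup _

/-- The Prékopa–Leindler inequality on the real line. -/
theorem prekopa_leindler_line {l : ℝ} (hl0 : 0 < l) (hl1 : l < 1)
    {f g h : ℝ → ENNReal} (hf : Measurable f) (hg : Measurable g) (hh : Measurable h)
    (H : ∀ x y, f x ^ (1 - l) * g y ^ l ≤ h ((1 - l) * x + l * y)) :
    (∫⁻ x, f x) ^ (1 - l) * (∫⁻ x, g x) ^ l ≤ ∫⁻ x, h x := by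
  have hl1' := sub_pos.2 hl1
  have hb : ∀ (k : ℝ → ENNReal) (n : ℕ), ⨆ x, min (k x) n ≠ ⊤ := fun k n =>
    ((iSup_le fun x => min_le_right _ _).trans_lt (ENNReal.natCast_lt_top n)).ne
  rw [lintegral_rpow_eq_iSup_min hf hl1', lintegral_rpow_eq_iSup_min hg hl0, ENNReal.iSup_mul]
  refine iSup_le fun n => ?_
  rw [ENNReal.mul_iSup]
  refine iSup_le fun m => ?_
  refine prekopa_leindler_line_of_bounded hl0 hl1 (hf.min measurable_const)
    (hg.min measurable_const) hh (hb f n) (hb g m) fun x y => le_trans ?_ (H x y)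
  gcongr
  · exact min_le_left _ _
  · exact min_le_left _ _

/-- The Prékopa–Leindler inequality in `ℝⁿ`. -/
theorem prekopa_leindler_pi {l : ℝ} (hl0 : 0 < l) (hl1 : l < 1) (n : ℕ) :
    ∀ {f g h : (Fin n → ℝ) → ENNReal}, Measurable f → Measurable g → Measurable h →
    (∀ x y, f x ^ (1 - l) * g y ^ l ≤ h ((1 - l) • x + l • y)) →
    (∫⁻ x, f x) ^ (1 - l) * (∫⁻ x, g x) ^ l ≤ ∫⁻ x, h x := by
  induction n with
  | zero =>
    intro f g h hf hg hh H
    simp only [MeasureTheory.Measure.volume_pi_eq_dirac (0 : Fin 0 → ℝ), lintegral_dirac' _ hf, lintegral_dirac' _ hg,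
      lintegral_dirac' _ hh]
    simpa using H 0 0
  | succ n ih =>
    intro f g h hf hg hh H
    have hm := volume_preserving_piFinSuccAbove (fun _ : Fin (n + 1) => ℝ) 0
    have hms : Measurable fun q : ℝ × (Fin n → ℝ) => (Fin.cons q.1 q.2 : Fin (n + 1) → ℝ) := by
      refine measurable_pi_iff.2 fun i => ?_
      refine Fin.cases ?_ (fun j => ?_) i
      · simpa using measurable_fst
      · simpa using! (measurable_pi_apply j).comp measurable_snd
    have key : ∀ {k : (Fin (n + 1) → ℝ) → ENNReal}, Measurable k →
        ∫⁻ x, k x = ∫⁻ s : ℝ, ∫⁻ y : Fin n → ℝ, k (Fin.cons s y) := by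
      intro k hk
      rw [← (hm.symm _).lintegral_comp hk, Measure.volume_eq_prod, lintegral_prod]
      · refine lintegral_congr fun s => lintegral_congr fun y => congrArg k ?_
        ext i
        refine Fin.cases ?_ (fun j => ?_) i <;> simp [MeasurableEquiv.piFinSuccAbove]
      · exact (hk.comp (MeasurableEquiv.measurable _)).aemeasurable
    have hmm : ∀ {k : (Fin (n + 1) → ℝ) → ENNReal}, Measurable k →
        Measurable fun s : ℝ => ∫⁻ y : Fin n → ℝ, k (Fin.cons s y) := fun hk =>
      (hk.comp hms).lintegral_prod_right'
    rw [key hf, key hg, key hh]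
    refine prekopa_leindler_line hl0 hl1 (hmm hf) (hmm hg) (hmm hh) fun s t => ?_
    refine ih (hf.comp (hms.comp measurable_prodMk_left))
      (hg.comp (hms.comp measurable_prodMk_left))
      (hh.comp (hms.comp measurable_prodMk_left)) fun x y => (H _ _).trans (le_of_eq ?_)
    congr 1
    ext i
    refine Fin.cases ?_ (fun j => ?_) i <;> simp

/-- The multiplicative Brunn–Minkowski inequality in `ℝⁿ`. -/
theorem brunn_minkowski_mul {n : ℕ} {l : ℝ} (hl0 : 0 < l) (hl1 : l < 1) {A B C : Set (Euc n)}
    (hA : MeasurableSet A) (hB : MeasurableSet B) (hC : MeasurableSet C)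
    (H : ∀ x ∈ A, ∀ y ∈ B, (1 - l) • x + l • y ∈ C) :
    volume A ^ (1 - l) * volume B ^ l ≤ volume C := by
  have hl1' := sub_pos.2 hl1
  have hm := PiLp.volume_preserving_toLp (Fin n)
  have key : ∀ {S : Set (Euc n)}, MeasurableSet S →
      volume S = ∫⁻ x : Fin n → ℝ, S.indicator 1 (WithLp.toLp 2 x : Euc n) := fun hS => by
    rw [hm.lintegral_comp (measurable_one.indicator hS), lintegral_indicator_one hS]
  rw [key hA, key hB, key hC]
  refine prekopa_leindler_pi hl0 hl1 n ((measurable_one.indicator hA).comp hm.measurable)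
    ((measurable_one.indicator hB).comp hm.measurable)
    ((measurable_one.indicator hC).comp hm.measurable) fun x y => ?_
  by_cases hx : WithLp.toLp 2 x ∈ A
  · by_cases hy : WithLp.toLp 2 y ∈ B
    · have := H _ hx _ hy
      simp [hx, hy, this]
    · simp [hy, ENNReal.zero_rpow_of_pos hl0]
  · simp [hx, ENNReal.zero_rpow_of_pos hl1']

namespace IsFinslerNorm

open scoped Pointwise

variable {N : ℕ} {H : Euc N → ℝ}

theorem nonneg (hH : IsFinslerNorm N H) (x : Euc N) : 0 ≤ H x := hH.2.1 x

theorem map_smul (hH : IsFinslerNorm N H) (t : ℝ) (x : Euc N) : H (t • x) = |t| * H x :=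
  hH.2.2.2 t x

theorem map_zero (hH : IsFinslerNorm N H) : H 0 = 0 := (hH.2.2.1 0).2 rfl

theorem pos (hH : IsFinslerNorm N H) {x : Euc N} (hx : x ≠ 0) : 0 < H x :=
  lt_of_le_of_ne (hH.nonneg x) fun h => hx ((hH.2.2.1 x).1 h.symm)

theorem add_le (hH : IsFinslerNorm N H) (x y : Euc N) : H (x + y) ≤ H x + H y := by
  have h := hH.1.2 (mem_univ x) (mem_univ y) (show (0:ℝ) ≤ 1/2 by norm_num)
    (show (0:ℝ) ≤ 1/2 by norm_num) (by norm_num)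
  rw [← smul_add, hH.map_smul] at h
  simp only [smul_eq_mul] at h
  rw [abs_of_pos (by norm_num)] at h
  linarith

theorem continuous (hH : IsFinslerNorm N H) : Continuous H := by
  exact (ConvexOn.locallyLipschitz hH.1).continuous

theorem exists_le_norm (hH : IsFinslerNorm N H) : ∃ C > 0, ∀ x, H x ≤ C * ‖x‖ := by
  obtain ⟨C, hC⟩ := (isCompact_sphere (0 : Euc N) 1).bddAbove_image hH.continuous.continuousOn
  refine ⟨max C 1, by positivity, fun x => ?_⟩
  rcases eq_or_ne x 0 with rfl | hx
  · simp [hH.map_zero]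
  have hx' := norm_pos_iff.2 hx
  have h1 : H (‖x‖⁻¹ • x) ≤ C := hC ⟨_, by simp [norm_smul, hx'.ne'], rfl⟩
  rw [hH.map_smul, abs_of_pos (inv_pos.2 hx'), inv_mul_le_iff₀ hx', mul_comm] at h1
  exact h1.trans (by gcongr; exact le_max_left _ _)

theorem exists_norm_le (hH : IsFinslerNorm N H) : ∃ c > 0, ∀ x, c * ‖x‖ ≤ H x := by
  rcases (Metric.sphere (0 : Euc N) 1).eq_empty_or_nonempty with he | hne
  · refine ⟨1, one_pos, fun x => ?_⟩
    rcases eq_or_ne x 0 with rfl | hx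
    · simp [hH.map_zero]
    have hx' := norm_pos_iff.2 hx
    have : ‖x‖⁻¹ • x ∈ Metric.sphere (0 : Euc N) 1 := by simp [norm_smul, hx'.ne']
    simp [he] at this
  · obtain ⟨z, hz, hmin⟩ := (isCompact_sphere (0 : Euc N) 1).exists_isMinOn hne
      hH.continuous.continuousOn
    have hz0 : z ≠ 0 := by
      rintro rfl; simp at hz
    refine ⟨H z, hH.pos hz0, fun x => ?_⟩
    rcases eq_or_ne x 0 with rfl | hx
    · simp [hH.map_zero]
    have hx' := norm_pos_iff.2 hx
    have h1 : H z ≤ H (‖x‖⁻¹ • x) := hmin (by simp [norm_smul, hx'.ne'])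
    rwa [hH.map_smul, abs_of_pos (inv_pos.2 hx'), le_inv_mul_iff₀ hx', mul_comm] at h1

theorem inner_le (hH : IsFinslerNorm N H) (x ξ : Euc N) : ⟪x, ξ⟫ ≤ dualNorm H x * H ξ := by
  rcases eq_or_ne ξ 0 with rfl | hξ
  · simp [hH.map_zero]
  rw [← div_le_iff₀ (hH.pos hξ)]
  refine le_csSup ?_ ⟨ξ, hξ, rfl⟩
  obtain ⟨c, hc, hcx⟩ := hH.exists_norm_le
  refine ⟨‖x‖ / c, ?_⟩
  rintro r ⟨η, hη, rfl⟩
  have := norm_pos_iff.2 hη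
  calc ⟪x, η⟫ / H η ≤ ‖x‖ * ‖η‖ / H η := by
        gcongr
        · exact hH.nonneg _
        · exact real_inner_le_norm _ _
    _ ≤ ‖x‖ * ‖η‖ / (c * ‖η‖) := by
        gcongr
        exact hcx η
    _ = ‖x‖ / c := by field_simp

theorem dualNorm_le (hH : IsFinslerNorm N H) {x : Euc N} {l : ℝ} (hl : 0 ≤ l)
    (h : ∀ ξ, ⟪x, ξ⟫ ≤ l * H ξ) : dualNorm H x ≤ l := by
  refine Real.sSup_le ?_ hl
  rintro r ⟨ξ, hξ, rfl⟩
  exact (div_le_iff₀ (hH.pos hξ)).2 (h ξ)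

theorem dualNorm_nonneg (hH : IsFinslerNorm N H) (x : Euc N) : 0 ≤ dualNorm H x := by
  rcases eq_or_ne x 0 with rfl | hx
  · refine Real.sSup_nonneg ?_
    rintro r ⟨ξ, hξ, rfl⟩
    simp
  · have h := hH.inner_le x x
    have h1 : 0 < ⟪x, x⟫ := real_inner_self_pos.2 hx
    exact (pos_of_mul_pos_left (h1.trans_le h) (hH.nonneg x)).le

theorem dualNorm_zero (hH : IsFinslerNorm N H) : dualNorm H (0 : Euc N) = 0 :=
  le_antisymm (hH.dualNorm_le le_rfl fun ξ => by simp) (hH.dualNorm_nonneg 0)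

theorem dualNorm_smul (hH : IsFinslerNorm N H) (t : ℝ) (x : Euc N) :
    dualNorm H (t • x) = |t| * dualNorm H x := by
  have h1 : ∀ (t : ℝ) (x : Euc N), dualNorm H (t • x) ≤ |t| * dualNorm H x := fun t x => by
    refine hH.dualNorm_le (mul_nonneg (abs_nonneg t) (hH.dualNorm_nonneg x)) fun ξ => ?_
    rw [real_inner_smul_left, ← real_inner_smul_right, mul_right_comm, mul_comm,
      ← hH.map_smul]
    exact hH.inner_le _ _
  refine le_antisymm (h1 t x) ?_
  rcases eq_or_ne t 0 with rfl | ht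
  · simp [hH.dualNorm_zero]
  have := h1 t⁻¹ (t • x)
  rw [inv_smul_smul₀ ht, abs_inv, le_inv_mul_iff₀ (abs_pos.2 ht)] at this
  exact this

theorem dualNorm_neg (hH : IsFinslerNorm N H) (x : Euc N) : dualNorm H (-x) = dualNorm H x := by
  simpa using hH.dualNorm_smul (-1) x

theorem dualNorm_add_le (hH : IsFinslerNorm N H) (x y : Euc N) :
    dualNorm H (x + y) ≤ dualNorm H x + dualNorm H y := by
  refine hH.dualNorm_le (add_nonneg (hH.dualNorm_nonneg x) (hH.dualNorm_nonneg y)) fun ξ => ?_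
  rw [inner_add_left, add_mul]
  exact add_le_add (hH.inner_le _ _) (hH.inner_le _ _)

theorem exists_dualNorm_le_norm (hH : IsFinslerNorm N H) :
    ∃ C > 0, ∀ x, dualNorm H x ≤ C * ‖x‖ := by
  obtain ⟨c, hc, hcx⟩ := hH.exists_norm_le
  refine ⟨c⁻¹, inv_pos.2 hc, fun x => hH.dualNorm_le (by positivity) fun ξ => ?_⟩
  calc ⟪x, ξ⟫ ≤ ‖x‖ * ‖ξ‖ := real_inner_le_norm _ _
    _ = c⁻¹ * ‖x‖ * (c * ‖ξ‖) := by field_simp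
    _ ≤ _ := by gcongr; exact hcx ξ

theorem exists_norm_le_dualNorm (hH : IsFinslerNorm N H) :
    ∃ C > 0, ∀ x, ‖x‖ ≤ C * dualNorm H x := by
  obtain ⟨C, hC, hCx⟩ := hH.exists_le_norm
  refine ⟨C, hC, fun x => ?_⟩
  rcases eq_or_ne x 0 with rfl | hx
  · simp [hH.dualNorm_zero]
  have hx' := norm_pos_iff.2 hx
  have h1 : ‖x‖ * ‖x‖ ≤ dualNorm H x * (C * ‖x‖) := by
    rw [← real_inner_self_eq_norm_mul_norm]
    exact (hH.inner_le x x).trans (by gcongr; exacts [hH.dualNorm_nonneg x, hCx x])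
  rw [← mul_assoc] at h1
  have := le_of_mul_le_mul_right h1 hx'
  linarith

theorem dualNorm_pos (hH : IsFinslerNorm N H) {x : Euc N} (hx : x ≠ 0) : 0 < dualNorm H x := by
  obtain ⟨C, hC, h⟩ := hH.exists_norm_le_dualNorm
  exact pos_of_mul_pos_right ((norm_pos_iff.2 hx).trans_le (h x)) hC.le

theorem abs_dualNorm_sub_le (hH : IsFinslerNorm N H) (x y : Euc N) :
    |dualNorm H x - dualNorm H y| ≤ dualNorm H (x - y) := by
  rw [abs_le]
  constructor
  · have := hH.dualNorm_add_le (y - x) x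
    rw [sub_add_cancel, ← neg_sub, hH.dualNorm_neg] at this
    linarith
  · have := hH.dualNorm_add_le (x - y) y
    rw [sub_add_cancel] at this
    linarith

theorem continuous_dualNorm (hH : IsFinslerNorm N H) : Continuous (dualNorm H) := by
  obtain ⟨C, hC, h⟩ := hH.exists_dualNorm_le_norm
  have : LipschitzWith (Real.toNNReal C) (dualNorm H) := LipschitzWith.of_dist_le_mul fun x y => by
    rw [Real.dist_eq, dist_eq_norm, Real.coe_toNNReal _ hC.le]
    exact (hH.abs_dualNorm_sub_le x y).trans (h _)
  exact this.continuous

theorem isOpen_ball (hH : IsFinslerNorm N H) (r : ℝ) : IsOpen {x | dualNorm H x < r} :=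
  isOpen_lt hH.continuous_dualNorm continuous_const

theorem isCompact_closedBall (hH : IsFinslerNorm N H) (r : ℝ) :
    IsCompact {x | dualNorm H x ≤ r} := by
  obtain ⟨C, hC, h⟩ := hH.exists_norm_le_dualNorm
  refine Metric.isCompact_of_isClosed_isBounded
    (isClosed_le hH.continuous_dualNorm continuous_const) ?_
  refine (Metric.isBounded_closedBall (x := (0 : Euc N)) (r := C * r)).subset fun x hx => ?_
  rw [mem_closedBall_zero_iff]
  exact (h x).trans (by gcongr; exact hx)

theorem volume_ball_ne_top (hH : IsFinslerNorm N H) (r : ℝ) :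
    volume {x | dualNorm H x < r} ≠ ⊤ :=
  ((measure_mono fun x (hx : dualNorm H x < r) => hx.le).trans_lt (hH.isCompact_closedBall r).measure_lt_top).ne

theorem wulffVol_pos (hH : IsFinslerNorm N H) : 0 < wulffVol N H := by
  refine ENNReal.toReal_pos ?_ (hH.volume_ball_ne_top 1)
  exact ((hH.isOpen_ball 1).measure_pos volume ⟨0, by simp [hH.dualNorm_zero]⟩).ne'

theorem ball_eq_smul (hH : IsFinslerNorm N H) {r s : ℝ} (hr : 0 < r) :
    {x | dualNorm H x < r * s} = r • {x | dualNorm H x < s} := by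
  ext x
  rw [mem_smul_set_iff_inv_smul_mem₀ hr.ne', mem_ofPred_eq, mem_ofPred_eq, hH.dualNorm_smul,
    abs_of_pos (inv_pos.2 hr), inv_mul_lt_iff₀ hr]

theorem volume_ball (hH : IsFinslerNorm N H) {r : ℝ} (hr : 0 < r) :
    volume {x | dualNorm H x < r} = ENNReal.ofReal (wulffVol N H * r ^ N) := by
  have := hH.ball_eq_smul (s := 1) hr
  rw [mul_one] at this
  rw [this, Measure.addHaar_smul, finrank_euclideanSpace_fin, abs_of_pos (pow_pos hr N),
    mul_comm (wulffVol N H), ENNReal.ofReal_mul (by positivity), wulffVol,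
    ENNReal.ofReal_toReal (hH.volume_ball_ne_top 1)]

/-- The Brunn–Minkowski inequality against a Wulff ball. -/
theorem brunn_minkowski (hH : IsFinslerNorm N H) {A A' : Set (Euc N)} (hA : MeasurableSet A)
    (hA' : MeasurableSet A') {r h : ℝ} (hr : 0 < r) (hh : 0 < h)
    (hvol : volume A = ENNReal.ofReal (wulffVol N H * r ^ N))
    (hadd : ∀ x ∈ A, ∀ y, dualNorm H y < h → x + y ∈ A') :
    ENNReal.ofReal (wulffVol N H * (r + h) ^ N) ≤ volume A' := by
  have hrh : 0 < r + h := by positivity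
  have hκ := hH.wulffVol_pos
  set l := h / (r + h) with hl
  have hl0 : 0 < l := by positivity
  have hl1 : 1 - l = r / (r + h) := by rw [hl]; field_simp; ring
  have hl1' : 0 < 1 - l := by rw [hl1]; positivity
  have h1 := brunn_minkowski_mul hl0 (by linarith) (A := (1 - l)⁻¹ • A)
    (B := {x | dualNorm H x < r + h}) (hA.const_smul₀ _) (hH.isOpen_ball _).measurableSet hA'
    (by
      rintro x hx y hy
      rw [mem_smul_set_iff_inv_smul_mem₀ (inv_pos.2 hl1').ne', inv_inv] at hx
      refine hadd _ hx _ ?_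
      rw [hH.dualNorm_smul, abs_of_pos hl0]
      calc l * dualNorm H y < l * (r + h) := by gcongr; exact hy
        _ = h := by rw [hl]; field_simp)
  have h2 : volume ((1 - l)⁻¹ • A) = ENNReal.ofReal (wulffVol N H * (r + h) ^ N) := by
    rw [Measure.addHaar_smul, finrank_euclideanSpace_fin, hvol, abs_of_pos (by positivity),
      ← ENNReal.ofReal_mul (by positivity), hl1]
    congr 1
    rw [inv_div, div_pow]
    field_simp
  rw [h2, hH.volume_ball hrh, ← ENNReal.rpow_add_of_nonneg _ _ hl1'.le hl0.le, sub_add_cancel,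
    ENNReal.rpow_one] at h1
  exact h1

end IsFinslerNorm

namespace IsFinslerNorm

variable {N : ℕ} {H : Euc N → ℝ}

theorem hasGradientAt (hreg : FinslerRegular N H) {ξ : Euc N} (hξ : ξ ≠ 0) :
    HasGradientAt H (gradient H ξ) ξ :=
  ((hreg.1.contDiffAt (isOpen_compl_singleton.mem_nhds hξ)).differentiableAt
    (by norm_num)).hasGradientAt

theorem hasDerivAt_line (hreg : FinslerRegular N H) {ξ : Euc N} (hξ : ξ ≠ 0) (η : Euc N) :
    HasDerivAt (fun t : ℝ => H (ξ + t • η)) ⟪gradient H ξ, η⟫ 0 := by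
  have h1 : HasDerivAt (fun t : ℝ => ξ + t • η) η 0 := by
    simpa using ((hasDerivAt_id (0 : ℝ)).smul_const η).const_add ξ
  have h2 := (hasGradientAt hreg hξ).hasFDerivAt
  have h3 : HasFDerivAt H ((InnerProductSpace.toDual ℝ (Euc N)) (gradient H ξ))
      (ξ + (0 : ℝ) • η) := by simpa using h2
  simpa using! h3.comp_hasDerivAt (0 : ℝ) h1

theorem inner_gradient_le (hH : IsFinslerNorm N H) (hreg : FinslerRegular N H) {ξ : Euc N}
    (hξ : ξ ≠ 0) (η : Euc N) : ⟪gradient H ξ, η⟫ ≤ H η := by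
  have h1 := hasDerivAt_line hreg hξ η
  have h2 := (hasDerivAt_iff_tendsto_slope.1 h1).mono_left
    (nhdsWithin_mono (0 : ℝ) (fun t (ht : t ∈ Ioi (0:ℝ)) => (ne_of_gt ht : t ≠ 0)))
  refine le_of_tendsto h2 ?_
  filter_upwards [self_mem_nhdsWithin] with t ht
  have ht' : 0 < t := ht
  have h3 := hH.add_le ξ (t • η)
  rw [hH.map_smul, abs_of_pos ht'] at h3
  rw [slope_def_field, sub_zero, zero_smul, add_zero, div_le_iff₀ ht']
  linarith

theorem inner_gradient_self (hH : IsFinslerNorm N H) (hreg : FinslerRegular N H) {ξ : Euc N}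
    (hξ : ξ ≠ 0) : ⟪gradient H ξ, ξ⟫ = H ξ := by
  refine le_antisymm (hH.inner_gradient_le hreg hξ ξ) ?_
  have := hH.inner_gradient_le hreg hξ (-ξ)
  have h1 := hasDerivAt_line hreg hξ ξ
  have h2 : HasDerivAt (fun t : ℝ => (1 + t) * H ξ) (1 * H ξ) 0 :=
    ((hasDerivAt_id (0:ℝ)).const_add 1).mul_const _
  have h3 : (fun t : ℝ => H (ξ + t • ξ)) =ᶠ[𝓝 0] fun t : ℝ => (1 + t) * H ξ := by
    filter_upwards [lt_mem_nhds (show (-1 : ℝ) < 0 by norm_num)] with t ht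
    have : ξ + t • ξ = (1 + t) • ξ := by rw [add_smul, one_smul]
    rw [this, hH.map_smul, abs_of_pos (by linarith)]
  have := h1.unique (h2.congr_of_eventuallyEq h3)
  linarith

theorem dualNorm_gradient_le (hH : IsFinslerNorm N H) (hreg : FinslerRegular N H) {ξ : Euc N}
    (hξ : ξ ≠ 0) : dualNorm H (gradient H ξ) ≤ 1 :=
  hH.dualNorm_le zero_le_one fun η => by simpa using hH.inner_gradient_le hreg hξ η

/-- Duality: `H` is controlled by pairing against the dual norm. -/
theorem le_of_inner_le (hH : IsFinslerNorm N H) (hreg : FinslerRegular N H) {ξ : Euc N} {l : ℝ}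
    (hl : 0 ≤ l) (h : ∀ z, ⟪ξ, z⟫ ≤ l * dualNorm H z) : H ξ ≤ l := by
  rcases eq_or_ne ξ 0 with rfl | hξ
  · rwa [hH.map_zero]
  calc H ξ = ⟪ξ, gradient H ξ⟫ := by rw [real_inner_comm, hH.inner_gradient_self hreg hξ]
    _ ≤ l * dualNorm H (gradient H ξ) := h _
    _ ≤ l * 1 := by gcongr; exact hH.dualNorm_gradient_le hreg hξ
    _ = l := mul_one l

/-- The vector field `H^{N-1} ∇H` defining the Finsler `N`-Laplacian. -/
def _root_.finslerFlux (N : ℕ) (H : Euc N → ℝ) (ξ : Euc N) : Euc N :=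
  H ξ ^ (N - 1) • gradient H ξ

theorem continuous_flux (hH : IsFinslerNorm N H) (hreg : FinslerRegular N H) (hN : 2 ≤ N) :
    Continuous (finslerFlux N H) := by
  rw [continuous_iff_continuousAt]
  intro ξ
  rcases eq_or_ne ξ 0 with rfl | hξ
  · obtain ⟨C, hC, hCx⟩ := hH.exists_norm_le_dualNorm
    have h0 : finslerFlux N H 0 = 0 := by
      simp [finslerFlux, hH.map_zero, show N - 1 ≠ 0 by omega]
    rw [ContinuousAt, h0]
    refine squeeze_zero_norm (a := fun ξ => H ξ ^ (N - 1) * C) (fun η => ?_) ?_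
    · rcases eq_or_ne η 0 with rfl | hη
      · rw [h0, norm_zero]
        exact mul_nonneg (pow_nonneg (hH.nonneg _) _) hC.le
      · rw [finslerFlux, norm_smul, norm_pow, Real.norm_of_nonneg (hH.nonneg η)]
        refine mul_le_mul_of_nonneg_left ?_ (pow_nonneg (hH.nonneg _) _)
        exact (hCx _).trans (mul_le_of_le_one_right hC.le (hH.dualNorm_gradient_le hreg hη))
    · have : Continuous fun ξ => H ξ ^ (N - 1) * C := (hH.continuous.pow _).mul continuous_const
      simpa [hH.map_zero, show N - 1 ≠ 0 by omega] using this.tendsto 0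
  · refine (hH.continuous.pow _).continuousAt.smul ?_
    have h1 : ContinuousAt (fderiv ℝ H) ξ :=
      (hreg.1.contDiffAt (isOpen_compl_singleton.mem_nhds hξ)).continuousAt_fderiv (by norm_num)
    exact (InnerProductSpace.toDual ℝ (Euc N)).symm.continuous.continuousAt.comp h1

theorem inner_flux_self (hH : IsFinslerNorm N H) (hreg : FinslerRegular N H) (hN : 2 ≤ N)
    (ξ : Euc N) : ⟪finslerFlux N H ξ, ξ⟫ = H ξ ^ N := by
  rcases eq_or_ne ξ 0 with rfl | hξ
  · simp [hH.map_zero, show N ≠ 0 by omega]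
  · rw [finslerFlux, real_inner_smul_left, hH.inner_gradient_self hreg hξ, ← pow_succ]
    congr 1
    omega

/-- Integration in polar coordinates for the Wulff ball, as an identity of measures. -/
theorem map_dualNorm (hH : IsFinslerNorm N H) (hN : N ≠ 0) {R : ℝ} (hR : 0 < R) :
    Measure.map (dualNorm H) (volume.restrict {x | dualNorm H x < R}) =
      (volume.restrict (Ioo 0 R)).withDensity
        fun r => ENNReal.ofReal (N * wulffVol N H * r ^ (N - 1)) := by
  have hκ := hH.wulffVol_pos
  have hKm := hH.continuous_dualNorm.measurable
  have hvol : ∀ r ≥ 0, volume {x | dualNorm H x < r} = ENNReal.ofReal (wulffVol N H * r ^ N) := by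
    intro r hr
    rcases hr.eq_or_lt with rfl | hr
    · have : {x : Euc N | dualNorm H x < 0} = ∅ := by
        ext x; simpa using hH.dualNorm_nonneg x
      simp [this, hN]
    · exact hH.volume_ball hr
  have hdens : ∀ a, 0 ≤ a → a ≤ R →
      ∫⁻ r in Ioo a R, ENNReal.ofReal (N * wulffVol N H * r ^ (N - 1)) =
        ENNReal.ofReal (wulffVol N H * R ^ N - wulffVol N H * a ^ N) := by
    intro a ha haR
    rw [restrict_Ioo_eq_restrict_Ioc, ← ofReal_integral_eq_lintegral_ofReal]
    · rw [← intervalIntegral.integral_of_le haR]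
      simp only [intervalIntegral.integral_const_mul, integral_pow]
      congr 1
      rw [show N - 1 + 1 = N by omega, Nat.cast_sub (by omega)]
      have : (N : ℝ) ≠ 0 := by exact_mod_cast hN
      rw [Nat.cast_one, sub_add_cancel]
      field_simp
    · exact (Continuous.integrableOn_Ioc (by fun_prop))
    · filter_upwards [ae_restrict_mem measurableSet_Ioc] with r hr
      have : 0 ≤ r := ha.trans hr.1.le
      positivity
  have hfin : IsFiniteMeasure (volume.restrict {x : Euc N | dualNorm H x < R}) :=
    ⟨by simpa using (hH.volume_ball_ne_top R).lt_top⟩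
  have := Measure.isFiniteMeasure_map (volume.restrict {x : Euc N | dualNorm H x < R}) (dualNorm H)
  refine Measure.ext_of_Ici _ _ fun a => ?_
  rw [Measure.map_apply hKm measurableSet_Ici, Measure.restrict_apply (hKm measurableSet_Ici),
    withDensity_apply _ measurableSet_Ici, Measure.restrict_restrict measurableSet_Ici]
  rcases le_or_gt R a with ha | ha
  · have h1 : dualNorm H ⁻¹' Ici a ∩ {x | dualNorm H x < R} = ∅ := by
      ext x
      simp only [mem_inter_iff, mem_preimage, mem_Ici, mem_ofPred_eq, mem_empty_iff_false, iff_false,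
        not_and, not_lt]
      intro h; linarith
    have h2 : Ici a ∩ Ioo 0 R = ∅ := by
      ext x
      simp only [mem_inter_iff, mem_Ici, mem_Ioo, mem_empty_iff_false, iff_false, not_and]
      intro h; intros; linarith
    simp [h1, h2]
  · have h1 : dualNorm H ⁻¹' Ici a ∩ {x | dualNorm H x < R} =
        {x | dualNorm H x < R} \ {x | dualNorm H x < max a 0} := by
      ext x
      have := hH.dualNorm_nonneg x
      simp only [mem_inter_iff, mem_preimage, mem_Ici, mem_ofPred_eq, Set.mem_sdiff, not_lt, max_le_iff]
      tauto
    have h2 : (Ici a ∩ Ioo 0 R : Set ℝ) =ᵐ[volume] Ioo (max a 0) R := by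
      have : Ioo (max a 0) R ⊆ Ici a ∩ Ioo 0 R := fun x hx =>
        ⟨(le_max_left a 0).trans hx.1.le, (le_max_right a 0).trans_lt hx.1, hx.2⟩
      refine Filter.EventuallyLE.antisymm ?_ this.eventuallyLE
      filter_upwards [compl_mem_ae_iff.2 (measure_singleton a)] with x hx hx'
      exact ⟨max_lt (lt_of_le_of_ne hx'.1 fun h => hx h.symm) hx'.2.1, hx'.2.2⟩
    rw [h1, measure_sdiff, hvol R hR.le, hvol _ (le_max_right _ _), setLIntegral_congr h2,
      hdens _ (le_max_right _ _) (max_le ha.le hR.le), ENNReal.ofReal_sub]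
    · positivity
    · intro x hx
      exact lt_of_lt_of_le hx (max_le ha.le hR.le)
    · exact (hKm measurableSet_Iio).nullMeasurableSet
    · exact hH.volume_ball_ne_top _

end IsFinslerNorm

/-- A continuous function which is positive and `C¹` in the Wulff ball of radius `R` and vanishes
outside of it. -/
structure WulffProfile (N : ℕ) (H : Euc N → ℝ) (R : ℝ) (U : Euc N → ℝ) : Prop where
  cont : Continuous U
  eq_zero : ∀ x, ¬ dualNorm H x < R → U x = 0
  pos : ∀ x, dualNorm H x < R → 0 < U x
  smooth : ContDiffOn ℝ 1 U {x | dualNorm H x < R}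

/-- The radius of the Wulff ball with the same volume as `{U > t}`. -/
def levelRadius (N : ℕ) (H : Euc N → ℝ) (U : Euc N → ℝ) (t : ℝ) : ℝ :=
  (volume.real {x | t < U x} / wulffVol N H) ^ (1 / (N : ℝ))

theorem pow_add_le_add_pow {a b : ℝ} (ha : 0 ≤ a) (hb : 0 ≤ b) (n : ℕ) :
    a ^ n + n * b * a ^ (n - 1) ≤ (a + b) ^ n := by
  induction n with
  | zero => simp
  | succ n ih =>
    rcases n with _ | n
    · simp
    simp only [Nat.add_sub_cancel] at ih ⊢
    rw [pow_succ (a + b)]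
    have h1 := mul_le_mul_of_nonneg_right ih (add_nonneg ha hb)
    have h2 : 0 ≤ (n + 1 : ℕ) * b * a ^ n * b := by positivity
    push_cast at *
    calc a ^ (n + 1 + 1) + ((n : ℝ) + 1 + 1) * b * a ^ (n + 1)
        ≤ a ^ (n + 1 + 1) + ((n : ℝ) + 1 + 1) * b * a ^ (n + 1) + (n + 1) * b * a ^ n * b := by
          linarith
      _ = (a ^ (n + 1) + (n + 1) * b * a ^ n) * (a + b) := by ring
      _ ≤ _ := h1

namespace WulffProfile

variable {N : ℕ} {H : Euc N → ℝ} {R : ℝ} {U : Euc N → ℝ}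

theorem nonneg (hU : WulffProfile N H R U) (x : Euc N) : 0 ≤ U x := by
  by_cases h : dualNorm H x < R
  · exact (hU.pos x h).le
  · exact (hU.eq_zero x h).ge

theorem superlevel_subset (hU : WulffProfile N H R U) {t : ℝ} (ht : 0 ≤ t) :
    {x | t < U x} ⊆ {x | dualNorm H x < R} := fun x hx => by
  by_contra h
  have : t < U x := hx
  rw [hU.eq_zero x h] at this
  exact absurd this (not_lt.2 ht)

theorem volume_superlevel_ne_top (hU : WulffProfile N H R U) (hH : IsFinslerNorm N H) {t : ℝ}
    (ht : 0 ≤ t) : volume {x | t < U x} ≠ ⊤ :=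
  ((measure_mono (hU.superlevel_subset ht)).trans_lt (hH.volume_ball_ne_top R).lt_top).ne

theorem isOpen_superlevel (hU : WulffProfile N H R U) (t : ℝ) : IsOpen {x | t < U x} :=
  isOpen_lt continuous_const hU.cont

theorem levelRadius_nonneg (U : Euc N → ℝ) (t : ℝ) : 0 ≤ levelRadius N H U t :=
  Real.rpow_nonneg (div_nonneg measureReal_nonneg ENNReal.toReal_nonneg) _

theorem wulffVol_mul_levelRadius_pow (hH : IsFinslerNorm N H) (hN : N ≠ 0) (U : Euc N → ℝ)
    (t : ℝ) : wulffVol N H * levelRadius N H U t ^ N = volume.real {x | t < U x} := by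
  have hκ := hH.wulffVol_pos
  rw [levelRadius, ← Real.rpow_natCast, ← Real.rpow_mul (by positivity), one_div,
    inv_mul_cancel₀ (by exact_mod_cast hN), Real.rpow_one, mul_div_cancel₀ _ hκ.ne']

theorem volume_superlevel (hU : WulffProfile N H R U) (hH : IsFinslerNorm N H) (hN : N ≠ 0)
    {t : ℝ} (ht : 0 ≤ t) :
    volume {x | t < U x} = ENNReal.ofReal (wulffVol N H * levelRadius N H U t ^ N) := by
  rw [wulffVol_mul_levelRadius_pow hH hN, ofReal_measureReal (hU.volume_superlevel_ne_top hH ht)]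

section Truncation

variable {G : ℝ → ℝ} {a : ℝ}

theorem tsupport_comp_subset (hU : WulffProfile N H R U) (hG : ∀ t ≤ a, G t = 0) :
    tsupport (fun x => G (U x)) ⊆ {x | a ≤ U x} := by
  refine closure_minimal (fun x hx => ?_) (isClosed_le continuous_const hU.cont)
  by_contra h
  exact hx (hG _ (not_le.1 h).le)

theorem setOf_le_subset (hU : WulffProfile N H R U) (ha : 0 < a) :
    {x | a ≤ U x} ⊆ {x | dualNorm H x < R} := fun _ hx =>
  hU.superlevel_subset (half_pos ha).le (lt_of_lt_of_le (half_lt_self ha) hx)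

theorem hasCompactSupport_comp (hU : WulffProfile N H R U) (hH : IsFinslerNorm N H) (ha : 0 < a)
    (hG : ∀ t ≤ a, G t = 0) : HasCompactSupport fun x => G (U x) :=
  (hH.isCompact_closedBall R).of_isClosed_subset (isClosed_tsupport _)
    ((hU.tsupport_comp_subset hG).trans ((hU.setOf_le_subset ha).trans fun x (hx : dualNorm H x < R) => hx.le))

theorem eventuallyEq_zero (hU : WulffProfile N H R U) (ha : 0 < a) (hG : ∀ t ≤ a, G t = 0)
    {x : Euc N} (hx : ¬ dualNorm H x < R) : (fun x => G (U x)) =ᶠ[𝓝 x] fun _ => 0 := by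
  have : ∀ᶠ y in 𝓝 x, U y < a :=
    hU.cont.continuousAt.eventually_lt continuousAt_const (by rwa [hU.eq_zero x hx])
  filter_upwards [this] with y hy using hG _ hy.le

theorem contDiff_comp (hU : WulffProfile N H R U) (hH : IsFinslerNorm N H) (ha : 0 < a)
    (hG1 : ContDiff ℝ 1 G) (hG : ∀ t ≤ a, G t = 0) : ContDiff ℝ 1 fun x => G (U x) := by
  rw [contDiff_iff_contDiffAt]
  intro x
  by_cases hx : dualNorm H x < R
  · exact hG1.contDiffAt.comp x (hU.smooth.contDiffAt ((hH.isOpen_ball R).mem_nhds hx))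
  · exact contDiffAt_const.congr_of_eventuallyEq (hU.eventuallyEq_zero ha hG hx)

theorem differentiableAt (hU : WulffProfile N H R U) (hH : IsFinslerNorm N H) {x : Euc N}
    (hx : dualNorm H x < R) : DifferentiableAt ℝ U x :=
  (hU.smooth.contDiffAt ((hH.isOpen_ball R).mem_nhds hx)).differentiableAt (by norm_num)

theorem gradient_comp (hU : WulffProfile N H R U) (hH : IsFinslerNorm N H)
    {g : ℝ → ℝ} (hG1 : ∀ t, HasDerivAt G (g t) t) {x : Euc N} (hx : dualNorm H x < R) :
    gradient (fun x => G (U x)) x = g (U x) • gradient U x := by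
  refine HasGradientAt.gradient ?_
  have h1 := (hU.differentiableAt hH hx).hasGradientAt.hasFDerivAt
  have h2 := (hG1 (U x)).comp_hasFDerivAt x h1
  rw [hasGradientAt_iff_hasFDerivAt, LinearIsometryEquiv.map_smul]
  exact h2

theorem gradient_comp_eq_zero (hU : WulffProfile N H R U) (ha : 0 < a)
    (hG : ∀ t ≤ a, G t = 0) {x : Euc N} (hx : ¬ dualNorm H x < R) :
    gradient (fun x => G (U x)) x = 0 := by
  have := (hasGradientAt_const x (0 : ℝ)).congr_of_eventuallyEq
    (hU.eventuallyEq_zero ha hG hx)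
  exact this.gradient

theorem continuousOn_gradient (hU : WulffProfile N H R U) (hH : IsFinslerNorm N H) :
    ContinuousOn (gradient U) {x | dualNorm H x < R} := by
  have h1 := hU.smooth.continuousOn_fderiv_of_isOpen (hH.isOpen_ball R) le_rfl
  exact (InnerProductSpace.toDual ℝ (Euc N)).symm.continuous.comp_continuousOn h1

end Truncation

end WulffProfile

theorem continuous_gradient {N : ℕ} {f : Euc N → ℝ} (hf : ContDiff ℝ 1 f) :
    Continuous (gradient f) :=
  (InnerProductSpace.toDual ℝ (Euc N)).symm.continuous.comp (hf.continuous_fderiv (by norm_num))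

theorem hasCompactSupport_gradient {N : ℕ} {f : Euc N → ℝ} (hf : HasCompactSupport f) :
    HasCompactSupport (gradient f) :=
  (hf.fderiv (𝕜 := ℝ)).comp_left (g := (InnerProductSpace.toDual ℝ (Euc N)).symm) (map_zero _)

theorem IsFinslerNorm.sub_le_of_gradient_le {N : ℕ} {H : Euc N → ℝ} (hH : IsFinslerNorm N H)
    {f : Euc N → ℝ} (hf : Differentiable ℝ f) {x y : Euc N} {C : ℝ}
    (hC : ∀ t ∈ Icc (0 : ℝ) 1, H (gradient f (x + t • y)) ≤ C) :
    f (x + y) - f x ≤ C * dualNorm H y := by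
  have hd : ∀ t : ℝ, HasDerivAt (fun t : ℝ => f (x + t • y)) ⟪gradient f (x + t • y), y⟫ t := by
    intro t
    have h1 : HasDerivAt (fun t : ℝ => x + t • y) y t := by
      simpa using ((hasDerivAt_id t).smul_const y).const_add x
    simpa using! (hf (x + t • y)).hasGradientAt.hasFDerivAt.comp_hasDerivAt t h1
  obtain ⟨t, ht, h⟩ := exists_hasDerivAt_eq_slope (fun t : ℝ => f (x + t • y)) _ one_pos
    (fun t _ => (hd t).continuousAt.continuousWithinAt) fun t _ => hd t
  simp only [one_smul, zero_smul, add_zero, sub_zero, div_one] at h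
  rw [← h, real_inner_comm]
  refine (hH.inner_le _ _).trans ?_
  rw [mul_comm]
  exact mul_le_mul_of_nonneg_right (hC t ⟨ht.1.le, ht.2.le⟩) (hH.dualNorm_nonneg y)

theorem hasDerivAt_primitive {g : ℝ → ℝ} (hg : Continuous g) (t : ℝ) :
    HasDerivAt (fun t => ∫ s in (0:ℝ)..t, g s) (g t) t :=
  intervalIntegral.integral_hasDerivAt_right (hg.intervalIntegrable _ _)
    (hg.stronglyMeasurableAtFilter _ _) hg.continuousAt

theorem contDiff_primitive {g : ℝ → ℝ} (hg : Continuous g) :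
    ContDiff ℝ 1 fun t => ∫ s in (0:ℝ)..t, g s := by
  rw [contDiff_one_iff_deriv]
  refine ⟨fun t => (hasDerivAt_primitive hg t).differentiableAt, ?_⟩
  have : deriv (fun t => ∫ s in (0:ℝ)..t, g s) = g := funext fun t => (hasDerivAt_primitive hg t).deriv
  rwa [this]

theorem primitive_eq_zero {g : ℝ → ℝ} {a : ℝ} (ha : 0 ≤ a) (hg : ∀ t ≤ a, g t = 0) {t : ℝ}
    (ht : t ≤ a) : ∫ s in (0:ℝ)..t, g s = 0 := by
  rw [intervalIntegral.integral_congr (g := fun _ => (0:ℝ)), intervalIntegral.integral_zero]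
  intro s hs
  rw [mem_uIcc] at hs
  refine hg s ?_
  rcases hs with hs | hs
  · exact hs.2.trans ht
  · exact hs.2.trans ha

theorem monotone_primitive {g : ℝ → ℝ} (hg : Continuous g) (hg0 : ∀ t, 0 ≤ g t) :
    Monotone fun t => ∫ s in (0:ℝ)..t, g s :=
  monotone_of_deriv_nonneg (fun t => (hasDerivAt_primitive hg t).differentiableAt)
    fun t => by rw [(hasDerivAt_primitive hg t).deriv]; exact hg0 t

namespace WulffProfile

variable {N : ℕ} {H : Euc N → ℝ} {R : ℝ} {U : Euc N → ℝ}

theorem antitone_volume_superlevel (U : Euc N → ℝ) : Antitone fun t => volume {x | t < U x} :=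
  fun _ _ hst => measure_mono fun _ hx => lt_of_le_of_lt hst hx

theorem volume_add_le_of_sup (hU : WulffProfile N H R U) (hH : IsFinslerNorm N H) (hN : 2 ≤ N)
    {h : ℝ} (hh : 0 < h) {t : ℝ} (ht : 0 ≤ t) {S : Set (Euc N)} (hS : MeasurableSet S)
    (hsub : ∀ x, t < U x → ∀ y, dualNorm H y < h → x + y ∈ S) :
    volume {x | t < U x} + ENNReal.ofReal h *
      ENNReal.ofReal (N * wulffVol N H * levelRadius N H U t ^ (N - 1)) ≤ volume S := by
  have hN0 : N ≠ 0 := by omega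
  have hκ := hH.wulffVol_pos
  have hvol := hU.volume_superlevel hH hN0 ht
  rcases (levelRadius_nonneg (H := H) U t).eq_or_lt with h0 | hpos
  · rw [← h0, zero_pow hN0, mul_zero, ENNReal.ofReal_zero] at hvol
    rw [hvol, ← h0, zero_pow (by omega)]
    simp
  · refine le_trans ?_ (hH.brunn_minkowski (hU.isOpen_superlevel t).measurableSet hS hpos hh hvol
      hsub)
    rw [hvol, ← ENNReal.ofReal_mul hh.le, ← ENNReal.ofReal_add (by positivity) (by positivity)]
    refine ENNReal.ofReal_le_ofReal ?_
    calc _ = wulffVol N H * (levelRadius N H U t ^ N + N * h * levelRadius N H U t ^ (N - 1)) := by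
          ring
      _ ≤ _ := by
          gcongr
          exact pow_add_le_add_pow hpos.le hh.le N

/-- An integrated form of the anisotropic isoperimetric inequality. -/
theorem isoperimetric (hU : WulffProfile N H R U) (hH : IsFinslerNorm N H) (hN : 2 ≤ N)
    {g : ℝ → ℝ} (hg : Continuous g) (hg0 : ∀ t, 0 ≤ g t) {a : ℝ} (ha : 0 < a)
    (hga : ∀ t ≤ a, g t = 0) :
    ∫⁻ t in Ioi 0, ENNReal.ofReal (N * wulffVol N H * levelRadius N H U t ^ (N - 1)) *
        ENNReal.ofReal (g t) ≤
      ∫⁻ x in {x | dualNorm H x < R}, ENNReal.ofReal (H (gradient U x) * g (U x)) := by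
  set G : ℝ → ℝ := fun t => ∫ s in (0:ℝ)..t, g s with hG
  have hGd := hasDerivAt_primitive hg
  have hG0 : ∀ t ≤ a, G t = 0 := fun t ht => primitive_eq_zero ha.le hga ht
  have hGm : Monotone G := monotone_primitive hg hg0
  set φ : Euc N → ℝ := fun x => G (U x) with hφ
  have hφ1 : ContDiff ℝ 1 φ := hU.contDiff_comp hH ha (contDiff_primitive hg) hG0
  have hφc : HasCompactSupport φ := hU.hasCompactSupport_comp hH ha hG0
  have hφ0 : ∀ x, 0 ≤ φ x := fun x => by
    have : G 0 = 0 := hG0 0 ha.le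
    rw [← this]; exact hGm (hU.nonneg x)
  set B : Set (Euc N) := {x | dualNorm H x < R + 1} with hB
  have hBm : MeasurableSet B := (hH.isOpen_ball _).measurableSet
  set J := ∫⁻ t in Ioi 0, ENNReal.ofReal (N * wulffVol N H * levelRadius N H U t ^ (N - 1)) *
        ENNReal.ofReal (g t) with hJ
  set q : Euc N → ℝ := fun x => H (gradient φ x) with hq
  have hqc : Continuous q := hH.continuous.comp (continuous_gradient hφ1)
  have hqu : UniformContinuous q :=
    ((hasCompactSupport_gradient hφc).comp_left hH.map_zero).uniformContinuous_of_continuous hqc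
  have hφfin : ∫⁻ x, ENNReal.ofReal (φ x) ≠ ⊤ :=
    (hφ1.continuous.integrable_of_hasCompactSupport hφc).lintegral_lt_top.ne
  have hcake : ∀ V : Euc N → ℝ, Measurable V → (∀ x, 0 ≤ V x) →
      ∫⁻ x, ENNReal.ofReal (G (V x)) =
        ∫⁻ t in Ioi 0, volume {x | t < V x} * ENNReal.ofReal (g t) := fun V hV hV0 =>
    lintegral_comp_eq_lintegral_meas_lt_mul volume (Eventually.of_forall hV0) hV.aemeasurable
      (fun t _ => hg.intervalIntegrable _ _) (Eventually.of_forall hg0)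
  have key : ∀ e > 0, J ≤ ∫⁻ x in B, (ENNReal.ofReal (q x) + ENNReal.ofReal e) := by
    intro e he
    obtain ⟨δ, hδ, hδq⟩ := Metric.uniformContinuous_iff.1 hqu e he
    obtain ⟨C, hC, hCx⟩ := hH.exists_norm_le_dualNorm
    set h : ℝ := min 1 (δ / (2 * C)) with hh_def
    have hh : 0 < h := by positivity
    have hhδ : ∀ y, dualNorm H y ≤ h → ‖y‖ < δ := fun y hy => by
      calc ‖y‖ ≤ C * dualNorm H y := hCx y
        _ ≤ C * (δ / (2 * C)) := by gcongr; exact hy.trans (min_le_right _ _)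
        _ = δ / 2 := by field_simp
        _ < δ := by linarith
    have hmax : ∀ x, ∃ y, dualNorm H y ≤ h ∧ ∀ y', dualNorm H y' ≤ h → U (x + y') ≤ U (x + y) := by
      intro x
      obtain ⟨y, hy, hy'⟩ := (hH.isCompact_closedBall h).exists_isMaxOn
        ⟨0, by simpa [hH.dualNorm_zero] using hh.le⟩
        (hU.cont.comp (continuous_const.add continuous_id)).continuousOn (f := fun y => U (x + y))
      exact ⟨y, hy, fun y' h' => hy' h'⟩
    choose Y hY hYmax using hmax
    set V : Euc N → ℝ := fun x => U (x + Y x) with hV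
    have hV0 : ∀ x, 0 ≤ V x := fun x => hU.nonneg _
    have hVlevel : ∀ t, {x | t < V x} = ⋃ y ∈ {y | dualNorm H y ≤ h}, {x | t < U (x + y)} := by
      intro t
      ext x
      simp only [mem_ofPred_eq, mem_iUnion, exists_prop]
      exact ⟨fun hx => ⟨Y x, hY x, hx⟩, fun ⟨y, hy, hx⟩ => hx.trans_le (hYmax x y hy)⟩
    have hVopen : ∀ t, IsOpen {x | t < V x} := fun t => by
      rw [hVlevel]
      exact isOpen_biUnion fun y _ =>
        isOpen_lt continuous_const (hU.cont.comp (continuous_id.add continuous_const))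
    have hVm : Measurable V := measurable_of_Ioi fun t => (hVopen t).measurableSet
    have hlow : (∫⁻ x, ENNReal.ofReal (φ x)) + ENNReal.ofReal h * J ≤
        ∫⁻ x, ENNReal.ofReal (G (V x)) := by
      rw [hcake V hVm hV0, hcake U hU.cont.measurable hU.nonneg, hJ,
        ← lintegral_const_mul' _ _ ENNReal.ofReal_ne_top, ← lintegral_add_left]
      · refine setLIntegral_mono' measurableSet_Ioi fun t ht => ?_
        rw [← mul_assoc, ← add_mul]
        gcongr
        refine hU.volume_add_le_of_sup hH hN hh (le_of_lt ht) (hVopen t).measurableSet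
          fun x hx y hy => ?_
        rw [hVlevel]
        simp only [mem_iUnion, exists_prop, mem_ofPred_eq]
        exact ⟨-y, by rw [hH.dualNorm_neg]; exact hy.le, by simpa using hx⟩
      · exact (antitone_volume_superlevel U).measurable.mul hg.measurable.ennreal_ofReal
    have hup : ∫⁻ x, ENNReal.ofReal (G (V x)) ≤ (∫⁻ x, ENNReal.ofReal (φ x)) +
        ENNReal.ofReal h * ∫⁻ x in B, (ENNReal.ofReal (q x) + ENNReal.ofReal e) := by
      have h1 : ∀ x ∉ B, G (V x) = 0 := by
        intro x hx
        have : ¬ dualNorm H (x + Y x) < R := by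
          intro hlt
          refine hx ?_
          have h2 := hH.dualNorm_add_le (x + Y x) (-Y x)
          rw [hH.dualNorm_neg, add_neg_cancel_right] at h2
          have h3 := (hY x).trans (min_le_left _ _)
          simp only [hB, mem_ofPred_eq]
          linarith
        rw [hV]
        simp only [hU.eq_zero _ this, hG0 0 ha.le]
      have h2 : ∫⁻ x, ENNReal.ofReal (G (V x)) = ∫⁻ x in B, ENNReal.ofReal (G (V x)) := by
        rw [← lintegral_indicator hBm]
        refine lintegral_congr fun x => ?_
        by_cases hx : x ∈ B
        · rw [indicator_of_mem hx]
        · rw [indicator_of_notMem hx, h1 x hx, ENNReal.ofReal_zero]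
      rw [h2]
      calc ∫⁻ x in B, ENNReal.ofReal (G (V x))
          ≤ ∫⁻ x in B, (ENNReal.ofReal (φ x) +
              ENNReal.ofReal h * (ENNReal.ofReal (q x) + ENNReal.ofReal e)) := by
            refine lintegral_mono fun x => ?_
            rw [← ENNReal.ofReal_add (hH.nonneg _) he.le, ← ENNReal.ofReal_mul hh.le,
              ← ENNReal.ofReal_add (hφ0 x)
                (mul_nonneg hh.le (add_nonneg (hH.nonneg _) he.le))]
            refine ENNReal.ofReal_le_ofReal ?_
            have h3 := hH.sub_le_of_gradient_le (f := φ) (hφ1.differentiable (by norm_num))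
              (x := x) (y := Y x) (C := q x + e) fun t ht => by
                have h4 : dist (x + t • Y x) x < δ := by
                  rw [dist_eq_norm, add_sub_cancel_left]
                  refine hhδ _ ?_
                  rw [hH.dualNorm_smul, abs_of_nonneg ht.1]
                  exact (mul_le_of_le_one_left (hH.dualNorm_nonneg _) ht.2).trans (hY x)
                have h5 := hδq h4
                rw [Real.dist_eq] at h5
                have h6 := (abs_lt.1 h5).2
                simp only [hq] at h6 ⊢
                linarith
            have h7 : (q x + e) * dualNorm H (Y x) ≤ (q x + e) * h :=
              mul_le_mul_of_nonneg_left (hY x) (add_nonneg (hH.nonneg _) he.le)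
            simp only [hφ] at h3 ⊢
            simp only [hV]
            linarith
        _ = (∫⁻ x in B, ENNReal.ofReal (φ x)) +
            ENNReal.ofReal h * ∫⁻ x in B, (ENNReal.ofReal (q x) + ENNReal.ofReal e) := by
            rw [lintegral_add_left hφ1.continuous.measurable.ennreal_ofReal,
              lintegral_const_mul' _ _ ENNReal.ofReal_ne_top]
        _ ≤ _ := by
            gcongr
            exact Measure.restrict_le_self
    have h8 := (ENNReal.add_le_add_iff_left hφfin).1 (hlow.trans hup)
    exact (ENNReal.mul_le_mul_iff_right (ENNReal.ofReal_pos.2 hh).ne' ENNReal.ofReal_ne_top).1 h8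
  have hlim : J ≤ ∫⁻ x in B, ENNReal.ofReal (q x) := by
    have h1 : ∀ e > 0, J ≤ (∫⁻ x in B, ENNReal.ofReal (q x)) + ENNReal.ofReal e * volume B := by
      intro e he
      have := key e he
      rwa [lintegral_add_left hqc.measurable.ennreal_ofReal, setLIntegral_const] at this
    have h2 : Tendsto (fun e : ℝ => (∫⁻ x in B, ENNReal.ofReal (q x)) +
        ENNReal.ofReal e * volume B) (𝓝[>] 0)
        (𝓝 ((∫⁻ x in B, ENNReal.ofReal (q x)) + ENNReal.ofReal 0 * volume B)) := by
      refine Tendsto.mono_left ?_ nhdsWithin_le_nhds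
      refine Tendsto.const_add _ (ENNReal.Tendsto.mul_const ?_ (Or.inr (hH.volume_ball_ne_top _)))
      exact ENNReal.continuous_ofReal.tendsto 0
    simp only [ENNReal.ofReal_zero, zero_mul, add_zero] at h2
    exact ge_of_tendsto h2 (by filter_upwards [self_mem_nhdsWithin] with e he using h1 e he)
  refine hlim.trans ((setLIntegral_le_lintegral _ _).trans (le_of_eq ?_))
  rw [← lintegral_indicator (hH.isOpen_ball R).measurableSet]
  refine lintegral_congr fun x => ?_
  by_cases hx : dualNorm H x < R
  · rw [indicator_of_mem (show x ∈ {x | dualNorm H x < R} from hx)]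
    simp only [hq, hφ]
    rw [hU.gradient_comp hH hGd hx, hH.map_smul, abs_of_nonneg (hg0 _), mul_comm]
  · rw [indicator_of_notMem (show x ∉ {x | dualNorm H x < R} from hx)]
    simp only [hq, hφ]
    rw [hU.gradient_comp_eq_zero ha hG0 hx, hH.map_zero, ENNReal.ofReal_zero]

end WulffProfile

theorem exists_mollification {N : ℕ} {f : Euc N → ℝ} (hf : Continuous f) {δ : ℝ} (hδ : 0 < δ) :
    ∃ ψ : Euc N → ℝ, ContDiff ℝ (⊤ : ℕ∞) ψ ∧ tsupport ψ ⊆ Metric.cthickening δ (tsupport f) ∧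
      (∀ x c, (∀ y ∈ Metric.ball x δ, |f y - f x| ≤ c) → |ψ x - f x| ≤ c) ∧
      ∀ x y c, (∀ z ∈ Metric.ball x δ, f (z + y) - f z ≤ c) → ψ (x + y) - ψ x ≤ c := by
  let b : ContDiffBump (0 : Euc N) := ⟨δ / 2, δ, half_pos hδ, half_lt_self hδ⟩
  set L := ContinuousLinearMap.lsmul ℝ ℝ (E := ℝ) with hL
  set k : Euc N → ℝ := b.normed volume with hk
  have hk0 : ∀ x, 0 ≤ k x := fun x => b.nonneg_normed x
  have hkc : HasCompactSupport k := b.hasCompactSupport_normed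
  have hkcont : Continuous k := b.continuous_normed
  have hk1 : ∫ x, k x = 1 := b.integral_normed
  have hki : Integrable k := hkcont.integrable_of_hasCompactSupport hkc
  have hkz : ∀ t, k t ≠ 0 → ‖t‖ < δ := fun t ht => by
    have : t ∈ Function.support k := ht
    rw [hk, b.support_normed_eq] at this
    simpa [b] using this
  set ψ := convolution k f L volume with hψ
  have hψx : ∀ x, ψ x = ∫ t, k t * f (x - t) := fun x => by
    rw [hψ, hL, convolution_lsmul]; rfl
  have hint : ∀ x, Integrable fun t => k t * f (x - t) := fun x =>
    (hkcont.mul (hf.comp (continuous_const.sub continuous_id))).integrable_of_hasCompactSupport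
      hkc.mul_right
  refine ⟨ψ, hkc.contDiff_convolution_left L b.contDiff_normed hf.locallyIntegrable, ?_, ?_, ?_⟩
  · refine closure_minimal (fun x hx => ?_) Metric.isClosed_cthickening
    obtain ⟨t, ht, y, hy, rfl⟩ := support_convolution_subset L hx
    refine Metric.mem_cthickening_of_dist_le _ y _ _ (subset_closure hy) ?_
    rw [dist_eq_norm]
    simpa using (hkz t ht).le
  · intro x c hc
    have := b.dist_normed_convolution_le (μ := volume) (g := f) (x₀ := x) (ε := c)
      hf.aestronglyMeasurable fun y hy => by rw [Real.dist_eq]; exact hc y hy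
    rwa [Real.dist_eq] at this
  · intro x y c hc
    rw [hψx, hψx, ← integral_sub (hint _) (hint _)]
    calc ∫ t, (k t * f (x + y - t) - k t * f (x - t)) ≤ ∫ t, k t * c := by
          refine integral_mono ((hint _).sub (hint _)) (hki.mul_const c) fun t => ?_
          simp only
          rw [← mul_sub]
          by_cases ht : k t = 0
          · simp [ht]
          refine mul_le_mul_of_nonneg_left ?_ (hk0 t)
          have := hc (x - t) (by simpa [dist_eq_norm] using hkz t ht)
          rwa [sub_add_eq_add_sub] at this
      _ = c := by rw [integral_mul_const, hk1, one_mul]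

theorem inner_gradient_le_of_sub_le {N : ℕ} {ψ : Euc N → ℝ} {x y : Euc N} {c : ℝ}
    (hψ : DifferentiableAt ℝ ψ x) (h : ∀ᶠ t : ℝ in 𝓝[>] 0, ψ (x + t • y) - ψ x ≤ t * c) :
    ⟪gradient ψ x, y⟫ ≤ c := by
  have h1 : HasDerivAt (fun t : ℝ => x + t • y) y 0 := by
    simpa using ((hasDerivAt_id (0 : ℝ)).smul_const y).const_add x
  have h3 : HasFDerivAt ψ ((InnerProductSpace.toDual ℝ (Euc N)) (gradient ψ x))
      (x + (0 : ℝ) • y) := by simpa using hψ.hasGradientAt.hasFDerivAt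
  have h4 : HasDerivAt (fun t : ℝ => ψ (x + t • y)) ⟪gradient ψ x, y⟫ 0 := by
    simpa using! h3.comp_hasDerivAt (0 : ℝ) h1
  have h2 := (hasDerivAt_iff_tendsto_slope.1 h4).mono_left
    (nhdsWithin_mono (0 : ℝ) (fun t (ht : t ∈ Ioi (0:ℝ)) => (ne_of_gt ht : t ≠ 0)))
  refine le_of_tendsto h2 ?_
  filter_upwards [self_mem_nhdsWithin, h] with t ht h
  have ht' : 0 < t := ht
  rw [slope_def_field, sub_zero, zero_smul, add_zero, div_le_iff₀ ht']
  linarith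

theorem hasDerivAt_comp_line {N : ℕ} {f : Euc N → ℝ} {x y : Euc N} {t : ℝ}
    (hf : DifferentiableAt ℝ f (x + t • y)) :
    HasDerivAt (fun t : ℝ => f (x + t • y)) ⟪gradient f (x + t • y), y⟫ t := by
  have h1 : HasDerivAt (fun t : ℝ => x + t • y) y t := by
    simpa using ((hasDerivAt_id t).smul_const y).const_add x
  simpa using! hf.hasGradientAt.hasFDerivAt.comp_hasDerivAt t h1

/-- Uniform `C¹` approximation of compactly supported `C¹` functions by test functions. -/
theorem exists_smooth_approx {N : ℕ} {φ : Euc N → ℝ} (hφ : ContDiff ℝ 1 φ)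
    (hφc : HasCompactSupport φ) {δ₀ ε : ℝ} (hδ₀ : 0 < δ₀) (hε : 0 < ε) :
    ∃ ψ : Euc N → ℝ, ContDiff ℝ (⊤ : ℕ∞) ψ ∧ tsupport ψ ⊆ Metric.cthickening δ₀ (tsupport φ) ∧
      (∀ x, |ψ x - φ x| ≤ ε) ∧ ∀ x, ‖gradient ψ x - gradient φ x‖ ≤ ε := by
  have hu1 := hφc.uniformContinuous_of_continuous hφ.continuous
  have hu2 := (hasCompactSupport_gradient hφc).uniformContinuous_of_continuous
    (continuous_gradient hφ)
  obtain ⟨δ₁, hδ₁, h1⟩ := Metric.uniformContinuous_iff.1 hu1 ε hε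
  obtain ⟨δ₂, hδ₂, h2⟩ := Metric.uniformContinuous_iff.1 hu2 ε hε
  set δ := min δ₀ (min δ₁ (δ₂ / 2)) with hδd
  have hδ : 0 < δ := by positivity
  have hδ0 : δ ≤ δ₀ := min_le_left _ _
  have hδ1 : δ ≤ δ₁ := (min_le_right _ _).trans (min_le_left _ _)
  have hδ2 : δ ≤ δ₂ / 2 := (min_le_right _ _).trans (min_le_right _ _)
  obtain ⟨ψ, hψ, hsupp, hψ0, hψ1⟩ := exists_mollification hφ.continuous hδ
  refine ⟨ψ, hψ, hsupp.trans (Metric.cthickening_mono hδ0 _), fun x => hψ0 x ε fun y hy => ?_,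
    fun x => ?_⟩
  · have := h1 (lt_of_lt_of_le hy hδ1)
    rw [Real.dist_eq] at this
    exact this.le
  · have key : ∀ y, ⟪gradient ψ x, y⟫ ≤ ⟪gradient φ x, y⟫ + ε * ‖y‖ := by
      intro y
      refine inner_gradient_le_of_sub_le (hψ.differentiable (by simp) x) ?_
      have hev : ∀ᶠ t : ℝ in 𝓝[>] 0, t * ‖y‖ < δ := by
        have : Tendsto (fun t : ℝ => t * ‖y‖) (𝓝[>] 0) (𝓝 (0 * ‖y‖)) :=
          (tendsto_id.mono_left nhdsWithin_le_nhds).mul_const _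
        rw [zero_mul] at this
        exact this.eventually_lt_const hδ
      filter_upwards [self_mem_nhdsWithin, hev] with t ht hty
      have ht' : 0 < t := ht
      refine hψ1 x (t • y) _ fun z hz => ?_
      obtain ⟨s, hs, hs'⟩ := exists_hasDerivAt_eq_slope
        (fun s : ℝ => φ (z + s • (t • y))) _ one_pos
        (fun s _ => (hasDerivAt_comp_line
          (hφ.differentiable (by norm_num) _)).continuousAt.continuousWithinAt)
        fun s _ => hasDerivAt_comp_line (hφ.differentiable (by norm_num) _)
      simp only [one_smul, zero_smul, add_zero, sub_zero, div_one] at hs'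
      rw [← hs', real_inner_smul_right]
      refine mul_le_mul_of_nonneg_left ?_ ht'.le
      have hd : dist (z + s • t • y) x < δ₂ := by
        calc dist (z + s • t • y) x ≤ dist (z + s • t • y) z + dist z x := dist_triangle _ _ _
          _ < δ + δ := by
              refine add_lt_add_of_le_of_lt ?_ hz
              rw [dist_eq_norm, add_sub_cancel_left, norm_smul, norm_smul,
                Real.norm_of_nonneg hs.1.le, Real.norm_of_nonneg ht'.le]
              exact (mul_le_of_le_one_left (by positivity) hs.2.le).trans hty.le
          _ ≤ δ₂ := by linarith
      have h3 := (h2 hd).le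
      rw [dist_eq_norm] at h3
      have h4 : ⟪gradient φ (z + s • t • y) - gradient φ x, y⟫ ≤ ε * ‖y‖ :=
        (real_inner_le_norm _ _).trans (by gcongr)
      rw [inner_sub_left] at h4
      linarith
    have h5 := key (gradient ψ x - gradient φ x)
    have h6 : ‖gradient ψ x - gradient φ x‖ * ‖gradient ψ x - gradient φ x‖ ≤
        ε * ‖gradient ψ x - gradient φ x‖ := by
      rw [← real_inner_self_eq_norm_mul_norm, inner_sub_left]
      linarith
    rcases (norm_nonneg (gradient ψ x - gradient φ x)).eq_or_lt with h | h
    · rw [← h]; exact hε.le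
    · exact le_of_mul_le_mul_right h6 h

theorem gradient_eq_zero_of_notMem_tsupport {N : ℕ} {φ : Euc N → ℝ} {x : Euc N}
    (hx : x ∉ tsupport φ) : gradient φ x = 0 := by
  have h1 : φ =ᶠ[𝓝 x] fun _ => 0 := notMem_tsupport_iff_eventuallyEq.1 hx
  exact ((hasGradientAt_const x (0 : ℝ)).congr_of_eventuallyEq h1).gradient

/-- An identity in the sense of distributions extends to compactly supported `C¹` functions. -/
theorem integral_inner_gradient_eq {N : ℕ} {Ω : Set (Euc N)} (hΩ : IsOpen Ω) {F : Euc N → Euc N}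
    {g : Euc N → ℝ} (hF : ContinuousOn F Ω) (hg : ContinuousOn g Ω)
    (h : ∀ φ : Euc N → ℝ, ContDiff ℝ (⊤ : ℕ∞) φ → HasCompactSupport φ → tsupport φ ⊆ Ω →
      ∫ x in Ω, ⟪F x, gradient φ x⟫ = ∫ x in Ω, g x * φ x)
    {φ : Euc N → ℝ} (hφ : ContDiff ℝ 1 φ) (hφc : HasCompactSupport φ) (hφΩ : tsupport φ ⊆ Ω) :
    ∫ x in Ω, ⟪F x, gradient φ x⟫ = ∫ x in Ω, g x * φ x := by
  obtain ⟨δ₀, hδ₀, hQΩ⟩ := hφc.isCompact.exists_cthickening_subset_open hΩ hφΩ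
  set Q := Metric.cthickening δ₀ (tsupport φ) with hQ
  have hQc : IsCompact Q := hφc.isCompact.cthickening
  have hφQ : tsupport φ ⊆ Q := Metric.self_subset_cthickening _
  have hFQ := hF.mono hQΩ
  have hgQ := hg.mono hQΩ
  have hl : ∀ χ : Euc N → ℝ, tsupport χ ⊆ Q →
      ∫ x in Ω, ⟪F x, gradient χ x⟫ = ∫ x in Q, ⟪F x, gradient χ x⟫ := fun χ hχ =>
    (setIntegral_eq_of_subset_of_forall_sdiff_eq_zero hΩ.measurableSet hQΩ fun x hx => by
      rw [gradient_eq_zero_of_notMem_tsupport fun h => hx.2 (hχ h), inner_zero_right])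
  have hr : ∀ χ : Euc N → ℝ, tsupport χ ⊆ Q →
      ∫ x in Ω, g x * χ x = ∫ x in Q, g x * χ x := fun χ hχ =>
    (setIntegral_eq_of_subset_of_forall_sdiff_eq_zero hΩ.measurableSet hQΩ fun x hx => by
      rw [image_eq_zero_of_notMem_tsupport fun h => hx.2 (hχ h), mul_zero])
  have hil : ∀ χ : Euc N → ℝ, ContDiff ℝ 1 χ → IntegrableOn (fun x => ⟪F x, gradient χ x⟫) Q :=
    fun χ hχ => (hFQ.inner (continuous_gradient hχ).continuousOn).integrableOn_compact hQc
  have hir : ∀ χ : Euc N → ℝ, ContDiff ℝ 1 χ → IntegrableOn (fun x => g x * χ x) Q :=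
    fun χ hχ => (hgQ.mul hχ.continuous.continuousOn).integrableOn_compact hQc
  have hiF : IntegrableOn (fun x => ‖F x‖) Q := hFQ.norm.integrableOn_compact hQc
  have hig : IntegrableOn (fun x => |g x|) Q := hgQ.abs.integrableOn_compact hQc
  set M := (∫ x in Q, ‖F x‖) + ∫ x in Q, |g x| with hM
  have key : ∀ ε > 0, |(∫ x in Q, ⟪F x, gradient φ x⟫) - ∫ x in Q, g x * φ x| ≤ ε * M := by
    intro ε hε
    obtain ⟨ψ, hψ, hsupp, h0, h1⟩ := exists_smooth_approx hφ hφc hδ₀ hε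
    have hψ1 : ContDiff ℝ 1 ψ := hψ.of_le (by exact_mod_cast le_top)
    have hψc : HasCompactSupport ψ := hQc.of_isClosed_subset (isClosed_tsupport _) hsupp
    have h2 := h ψ hψ hψc (hsupp.trans hQΩ)
    rw [hl ψ hsupp, hr ψ hsupp] at h2
    have h3 : |(∫ x in Q, ⟪F x, gradient ψ x⟫) - ∫ x in Q, ⟪F x, gradient φ x⟫| ≤
        ε * ∫ x in Q, ‖F x‖ := by
      rw [← integral_sub (hil ψ hψ1) (hil φ hφ), ← integral_const_mul, ← Real.norm_eq_abs]
      refine norm_integral_le_of_norm_le (hiF.const_mul ε) (Eventually.of_forall fun x => ?_)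
      rw [← inner_sub_right, mul_comm]
      exact (norm_inner_le_norm _ _).trans (by gcongr; exact h1 x)
    have h4 : |(∫ x in Q, g x * ψ x) - ∫ x in Q, g x * φ x| ≤ ε * ∫ x in Q, |g x| := by
      rw [← integral_sub (hir ψ hψ1) (hir φ hφ), ← integral_const_mul, ← Real.norm_eq_abs]
      refine norm_integral_le_of_norm_le (hig.const_mul ε) (Eventually.of_forall fun x => ?_)
      rw [← mul_sub, mul_comm, norm_mul, Real.norm_eq_abs, Real.norm_eq_abs]
      gcongr
      exact h0 x
    rw [h2] at h3
    rw [hM, mul_add]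
    rw [abs_le] at *
    constructor <;> linarith [h3.1, h3.2, h4.1, h4.2]
  rw [hl φ hφQ, hr φ hφQ, ← sub_eq_zero, ← abs_nonpos_iff]
  have hlim : Tendsto (fun ε : ℝ => ε * M) (𝓝[>] 0) (𝓝 (0 * M)) :=
    (tendsto_id.mono_left nhdsWithin_le_nhds).mul_const _
  rw [zero_mul] at hlim
  exact ge_of_tendsto hlim (by filter_upwards [self_mem_nhdsWithin] with e he using key e he)

/-- A profile solving the Finsler Lane-Emden equation and satisfying the energy inequality of
a least energy solution. -/
structure LaneEmdenProfile (N : ℕ) (H : Euc N → ℝ) (R p : ℝ) (U : Euc N → ℝ) : Prop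
    extends WulffProfile N H R U where
  weak : ∀ φ : Euc N → ℝ, ContDiff ℝ 1 φ → HasCompactSupport φ →
    tsupport φ ⊆ {x | dualNorm H x < R} →
    ∫ x in {x | dualNorm H x < R}, ⟪finslerFlux N H (gradient U x), gradient φ x⟫ =
      ∫ x in {x | dualNorm H x < R}, U x ^ p * φ x
  energy_le : ∫ x in {x | dualNorm H x < R}, U x ^ (p + 1) ≤
    energyInf N H {x | dualNorm H x < R} p *
      (∫ x in {x | dualNorm H x < R}, U x ^ (p + 1)) ^ ((N : ℝ) / (p + 1))

theorem IsFinslerNorm.convex_ball {N : ℕ} {H : Euc N → ℝ} (hH : IsFinslerNorm N H) (R : ℝ) :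
    Convex ℝ {x | dualNorm H x < R} := by
  have : ConvexOn ℝ univ (dualNorm H) := by
    refine ⟨convex_univ, fun x _ y _ a b ha hb _ => ?_⟩
    refine (hH.dualNorm_add_le _ _).trans ?_
    rw [hH.dualNorm_smul, hH.dualNorm_smul, abs_of_nonneg ha, abs_of_nonneg hb]; rfl
  simpa using this.convex_lt R

theorem IsFinslerNorm.closure_ball_subset {N : ℕ} {H : Euc N → ℝ} (hH : IsFinslerNorm N H) (R : ℝ) :
    closure {x | dualNorm H x < R} ⊆ {x | dualNorm H x ≤ R} :=
  closure_minimal (fun x (hx : dualNorm H x < R) => hx.le)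
    (isClosed_le hH.continuous_dualNorm continuous_const)

section

variable {N : ℕ} {H : Euc N → ℝ} {R p : ℝ} {u : Euc N → ℝ}

theorem IsLeastEnergySolution.wulffProfile
    (hu : IsLeastEnergySolution N H {x | dualNorm H x < R} p u) :
    WulffProfile N H R ({x | dualNorm H x < R}.indicator u) := by
  obtain ⟨hu1, hpos, hbd, -, -⟩ := hu
  refine ⟨?_, fun x hx => indicator_of_notMem (show x ∉ {x | dualNorm H x < R} from hx) _,
    fun x hx => ?_, ?_⟩
  · exact continuous_indicator hbd hu1.continuousOn
  · rw [indicator_of_mem (show x ∈ {x | dualNorm H x < R} from hx)]; exact hpos x hx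
  · exact (hu1.mono subset_closure).congr fun x hx => indicator_of_mem hx _

theorem gradient_indicator_eq (hH : IsFinslerNorm N H) {x : Euc N} (hx : dualNorm H x < R) :
    gradient ({x | dualNorm H x < R}.indicator u) x = gradient u x := by
  have h : {x | dualNorm H x < R}.indicator u =ᶠ[𝓝 x] u := by
    filter_upwards [(hH.isOpen_ball R).mem_nhds hx] with y hy
    exact indicator_of_mem (s := {x | dualNorm H x < R}) hy u
  simp only [gradient, h.fderiv_eq]

theorem IsLeastEnergySolution.integrableOn_energy
    (hu : IsLeastEnergySolution N H {x | dualNorm H x < R} p u) (hH : IsFinslerNorm N H) :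
    IntegrableOn (fun x => H (gradient u x) ^ N) {x | dualNorm H x < R} := by
  obtain ⟨hu1, -⟩ := hu
  set Ω : Set (Euc N) := {x | dualNorm H x < R} with hΩ
  have hΩo : IsOpen Ω := hH.isOpen_ball R
  rcases Ω.eq_empty_or_nonempty with he | hne
  · rw [he]; exact integrableOn_empty
  have hK : IsCompact (closure Ω) :=
    (hH.isCompact_closedBall R).of_isClosed_subset isClosed_closure (hH.closure_ball_subset R)
  have hud : UniqueDiffOn ℝ (closure Ω) := by
    refine uniqueDiffOn_convex (hH.convex_ball R).closure (hne.mono ?_)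
    exact interior_maximal subset_closure hΩo
  have h1 := hu1.continuousOn_fderivWithin hud le_rfl
  have h2 : ContinuousOn
      (fun x => H ((InnerProductSpace.toDual ℝ (Euc N)).symm (fderivWithin ℝ u (closure Ω) x)) ^ N)
      (closure Ω) :=
    (hH.continuous.comp_continuousOn
      ((InnerProductSpace.toDual ℝ (Euc N)).symm.continuous.comp_continuousOn h1)).pow N
  refine ((h2.integrableOn_compact hK).mono_set subset_closure).congr_fun (fun x hx => ?_)
    hΩo.measurableSet
  have : fderivWithin ℝ u (closure Ω) x = fderiv ℝ u x :=
    fderivWithin_of_mem_nhds (mem_of_superset (hΩo.mem_nhds hx) subset_closure)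
  simp only [this]; rfl

theorem exists_cutoff {a ε : ℝ} (hε : 0 < ε) :
    ∃ g : ℝ → ℝ, Continuous g ∧ (∀ t, 0 ≤ g t) ∧ (∀ t, g t ≤ 1) ∧ (∀ t ≤ a, g t = 0) ∧
      ∀ t, a + ε ≤ t → g t = 1 := by
  refine ⟨fun t => max 0 (min 1 ((t - a) / ε)), by fun_prop, fun t => le_max_left _ _,
    fun t => max_le zero_le_one (min_le_left _ _), fun t ht => ?_, fun t ht => ?_⟩
  · refine max_eq_left ((min_le_right _ _).trans ?_)
    exact div_nonpos_of_nonpos_of_nonneg (by linarith) hε.le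
  · have : 1 ≤ (t - a) / ε := by rw [le_div_iff₀ hε]; linarith
    simp [min_eq_left this]

end

namespace WulffProfile

variable {N : ℕ} {H : Euc N → ℝ} {R p : ℝ} {U : Euc N → ℝ}

theorem integrableOn_comp (hU : WulffProfile N H R U) (hH : IsFinslerNorm N H)
    {Θ : ℝ → ℝ} (hΘ : ContinuousOn Θ (Ici 0)) :
    IntegrableOn (fun x => Θ (U x)) {x | dualNorm H x < R} := by
  refine IntegrableOn.mono_set ?_ (fun x (hx : dualNorm H x < R) => (hx.le : dualNorm H x ≤ R))
  exact (hΘ.comp hU.cont.continuousOn fun x _ => hU.nonneg x).integrableOn_compact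
    (hH.isCompact_closedBall R)

theorem integral_energy_comp (hU : WulffProfile N H R U) (hH : IsFinslerNorm N H)
    (hreg : FinslerRegular N H) (hN : 2 ≤ N)
    (hw : ∀ φ : Euc N → ℝ, ContDiff ℝ 1 φ → HasCompactSupport φ →
      tsupport φ ⊆ {x | dualNorm H x < R} →
      ∫ x in {x | dualNorm H x < R}, ⟪finslerFlux N H (gradient U x), gradient φ x⟫ =
        ∫ x in {x | dualNorm H x < R}, U x ^ p * φ x)
    {g : ℝ → ℝ} (hg : Continuous g) {a : ℝ} (ha : 0 < a) (hga : ∀ t ≤ a, g t = 0) :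
    ∫ x in {x | dualNorm H x < R}, H (gradient U x) ^ N * g (U x) =
      ∫ x in {x | dualNorm H x < R}, U x ^ p * ∫ s in (0:ℝ)..U x, g s := by
  set G : ℝ → ℝ := fun t => ∫ s in (0:ℝ)..t, g s with hG
  have hG0 : ∀ t ≤ a, G t = 0 := fun t ht => primitive_eq_zero ha.le hga ht
  have h := hw (fun x => G (U x)) (hU.contDiff_comp hH ha (contDiff_primitive hg) hG0)
    (hU.hasCompactSupport_comp hH ha hG0)
    ((hU.tsupport_comp_subset hG0).trans (hU.setOf_le_subset ha))
  rw [← h]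
  refine setIntegral_congr_fun (hH.isOpen_ball R).measurableSet fun x hx => ?_
  have e := hU.gradient_comp hH (hasDerivAt_primitive hg) hx
  show _ = ⟪_, gradient (fun x => ∫ s in (0:ℝ)..U x, g s) x⟫
  rw [e, inner_smul_right, IsFinslerNorm.inner_flux_self hH hreg hN, mul_comm]

theorem integrableOn_energy_comp (hU : WulffProfile N H R U) (hH : IsFinslerNorm N H)
    {Φ : ℝ → ℝ} (hΦ : Continuous Φ)
    {g : ℝ → ℝ} (hg : Continuous g) {a : ℝ} (ha : 0 < a) (hga : ∀ t ≤ a, g t = 0) :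
    IntegrableOn (fun x => Φ (H (gradient U x)) * g (U x)) {x | dualNorm H x < R} := by
  have hK : IsCompact {x | a ≤ U x} :=
    (hH.isCompact_closedBall R).of_isClosed_subset (isClosed_le continuous_const hU.cont)
      ((hU.setOf_le_subset ha).trans fun x (hx : dualNorm H x < R) => hx.le)
  have hc : ContinuousOn (fun x => Φ (H (gradient U x)) * g (U x)) {x | dualNorm H x < R} :=
    ((hΦ.comp hH.continuous).comp_continuousOn (hU.continuousOn_gradient hH)).mul
      (hg.comp hU.cont).continuousOn
  have h1 := (hc.mono (hU.setOf_le_subset ha)).integrableOn_compact hK (μ := volume)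
  refine h1.of_forall_sdiff_eq_zero (hH.isOpen_ball R).measurableSet fun x hx => ?_
  rw [hga _ (not_le.1 hx.2).le, mul_zero]

end WulffProfile

theorem IsLeastEnergySolution.laneEmdenProfile {N : ℕ} {H : Euc N → ℝ} {R p : ℝ} {u : Euc N → ℝ}
    (hu : IsLeastEnergySolution N H {x | dualNorm H x < R} p u) (hH : IsFinslerNorm N H)
    (hreg : FinslerRegular N H) (hN : 2 ≤ N) (hp : 1 < p) :
    LaneEmdenProfile N H R p ({x | dualNorm H x < R}.indicator u) := by
  have hU := hu.wulffProfile
  have hint := hu.integrableOn_energy hH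
  obtain ⟨-, -, -, hweak, hE⟩ := hu
  set Ω : Set (Euc N) := {x | dualNorm H x < R} with hΩ
  have hΩo : IsOpen Ω := hH.isOpen_ball R
  set U := Ω.indicator u with hUdef
  have hUu : ∀ x ∈ Ω, U x = u x := fun x hx => indicator_of_mem hx _
  have hgrad : ∀ x ∈ Ω, gradient U x = gradient u x := fun x hx => gradient_indicator_eq hH hx
  have hpow : ∀ q : ℝ, 0 < q → Continuous fun x => U x ^ q := fun q hq =>
    hU.cont.rpow_const fun x => Or.inr hq.le
  have hw : ∀ φ : Euc N → ℝ, ContDiff ℝ 1 φ → HasCompactSupport φ → tsupport φ ⊆ Ω →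
      ∫ x in Ω, ⟪finslerFlux N H (gradient U x), gradient φ x⟫ = ∫ x in Ω, U x ^ p * φ x := by
    intro φ hφ hφc hφΩ
    refine integral_inner_gradient_eq hΩo
      ((IsFinslerNorm.continuous_flux hH hreg hN).comp_continuousOn (hU.continuousOn_gradient hH))
      (hpow p (by linarith)).continuousOn (fun ψ hψ hψc hψΩ => ?_) hφ hφc hφΩ
    have := hweak ψ hψ hψc hψΩ
    have e : ∫ x in Ω, U x ^ p * ψ x = ∫ x in Ω, u x ^ p * ψ x :=
      setIntegral_congr_fun hΩo.measurableSet fun x hx => by simp only [hUu x hx]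
    rw [e, ← this]
    refine setIntegral_congr_fun hΩo.measurableSet fun x hx => ?_
    show ⟪finslerFlux N H (gradient U x), _⟫ = _
    rw [hgrad x hx, finslerFlux, real_inner_smul_left]
  refine ⟨hU, hw, ?_⟩
  have hUu' : ∫ x in Ω, U x ^ (p + 1) = ∫ x in Ω, u x ^ (p + 1) :=
    setIntegral_congr_fun hΩo.measurableSet fun x hx => by simp only [hUu x hx]
  rw [hUu', ← hE, ← hUu']
  have hi : ∀ q : ℝ, 0 < q → IntegrableOn (fun x => U x ^ q) Ω := fun q hq =>
    hU.integrableOn_comp hH (Real.continuous_rpow_const hq.le).continuousOn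
  have key : ∀ ε > 0, (∫ x in Ω, U x ^ (p + 1)) - ε * ∫ x in Ω, U x ^ p ≤
      ∫ x in Ω, H (gradient u x) ^ N := by
    intro ε hε
    obtain ⟨g, hg, hg0, hg1, hga, hgb⟩ := exists_cutoff (a := ε / 2) (half_pos hε)
    have h1 := hU.integral_energy_comp hH hreg hN hw hg (half_pos hε) hga
    have h2 : ∫ x in Ω, H (gradient U x) ^ N * g (U x) ≤ ∫ x in Ω, H (gradient u x) ^ N := by
      refine setIntegral_mono_on (hU.integrableOn_energy_comp hH (continuous_pow N) hg
        (half_pos hε) hga) hint hΩo.measurableSet fun x hx => ?_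
      rw [hgrad x hx]
      exact mul_le_of_le_one_right (pow_nonneg (hH.nonneg _) _) (hg1 _)
    rw [h1] at h2
    refine le_trans ?_ h2
    rw [← integral_const_mul, ← integral_sub (hi _ (by linarith)) ((hi _ (by linarith)).const_mul _)]
    have hGc : Continuous fun t => ∫ s in (0:ℝ)..t, g s := (contDiff_primitive hg).continuous
    refine setIntegral_mono_on ((hi _ (by linarith)).sub ((hi _ (by linarith)).const_mul _)) ?_
      hΩo.measurableSet fun x hx => ?_
    · exact hU.integrableOn_comp hH (Θ := fun t => t ^ p * ∫ s in (0:ℝ)..t, g s)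
        ((Real.continuous_rpow_const (by linarith)).mul hGc).continuousOn
    · have hx0 : 0 < U x := hU.pos x hx
      rw [Real.rpow_add_one hx0.ne', mul_comm ε, ← mul_sub]
      refine mul_le_mul_of_nonneg_left ?_ (Real.rpow_nonneg hx0.le _)
      have hm := monotone_primitive hg hg0
      rcases le_total (U x) ε with h | h
      · have := hm hx0.le
        simp only [intervalIntegral.integral_same] at this
        linarith
      · have e1 : ∫ s in ε..U x, g s = U x - ε := by
          rw [intervalIntegral.integral_congr (g := fun _ => (1:ℝ)) fun s hs => hgb s ?_]
          · simp
          · rw [uIcc_of_le h] at hs; linarith [hs.1]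
        have e2 : (∫ s in (0:ℝ)..ε, g s) + ∫ s in ε..U x, g s = ∫ s in (0:ℝ)..U x, g s :=
          intervalIntegral.integral_add_adjacent_intervals (hg.intervalIntegrable _ _)
            (hg.intervalIntegrable _ _)
        have e3 := hm hε.le
        simp only [intervalIntegral.integral_same] at e3
        linarith
  have hlim : Tendsto (fun ε : ℝ => (∫ x in Ω, U x ^ (p + 1)) - ε * ∫ x in Ω, U x ^ p) (𝓝[>] 0)
      (𝓝 ((∫ x in Ω, U x ^ (p + 1)) - 0 * ∫ x in Ω, U x ^ p)) :=
    tendsto_const_nhds.sub ((tendsto_id.mono_left nhdsWithin_le_nhds).mul_const _)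
  rw [zero_mul, sub_zero] at hlim
  exact le_of_tendsto hlim (by filter_upwards [self_mem_nhdsWithin] with e he using key e he)

section

variable {N : ℕ} {H : Euc N → ℝ} {R p : ℝ} {ω : ℝ → ℝ}

theorem energyInf_mul_le (hH : IsFinslerNorm N H) (hN : 2 ≤ N) (hp : 1 < p) {Ω : Set (Euc N)}
    {φ : Euc N → ℝ} (hφ : ContDiff ℝ (⊤ : ℕ∞) φ) (hφc : HasCompactSupport φ)
    (hφΩ : tsupport φ ⊆ Ω) :
    energyInf N H Ω p * (∫ x in Ω, |φ x| ^ (p + 1)) ^ ((N : ℝ) / (p + 1)) ≤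
      ∫ x in Ω, H (gradient φ x) ^ N := by
  have hq : 0 < p + 1 := by linarith
  have hN0 : (0:ℝ) < N := by exact_mod_cast (by omega : 0 < N)
  set A := ∫ x in Ω, |φ x| ^ (p + 1) with hA
  have hA0 : 0 ≤ A := integral_nonneg fun x => Real.rpow_nonneg (abs_nonneg _) _
  have hE0 : 0 ≤ ∫ x in Ω, H (gradient φ x) ^ N :=
    integral_nonneg fun x => pow_nonneg (hH.nonneg _) _
  rcases hA0.eq_or_lt with h0 | hpos
  · rw [← h0, Real.zero_rpow (by positivity), mul_zero]; exact hE0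
  set l : ℝ := A ^ (-(1 / (p + 1))) with hl
  have hlpos : 0 < l := Real.rpow_pos_of_pos hpos _
  have hlq : l ^ (p + 1) * A = 1 := by
    rw [hl, ← Real.rpow_mul hA0, neg_mul, one_div_mul_cancel hq.ne', Real.rpow_neg_one,
      inv_mul_cancel₀ hpos.ne']
  have hlN : l ^ N * A ^ ((N : ℝ) / (p + 1)) = 1 := by
    rw [hl, ← Real.rpow_natCast, ← Real.rpow_mul hA0, ← Real.rpow_add hpos]
    rw [show -(1 / (p + 1)) * (N:ℝ) + N / (p + 1) = 0 by ring, Real.rpow_zero]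
  have hle : energyInf N H Ω p ≤ l ^ N * ∫ x in Ω, H (gradient φ x) ^ N := by
    refine csInf_le ⟨0, ?_⟩ ⟨fun x => l * φ x, contDiff_const.mul hφ, hφc.mul_left,
      (tsupport_mul_subset_right (f := fun _ => l)).trans hφΩ, ?_, ?_⟩
    · rintro c ⟨u, -, -, -, -, rfl⟩
      exact integral_nonneg fun x => pow_nonneg (hH.nonneg _) _
    · refine Eq.trans ?_ hlq
      rw [hA, ← integral_const_mul]
      congr 1; ext x
      rw [abs_mul, abs_of_pos hlpos, Real.mul_rpow hlpos.le (abs_nonneg _)]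
    · rw [← integral_const_mul]
      congr 1; ext x
      have : gradient (fun x => l * φ x) x = l • gradient φ x := by
        refine HasGradientAt.gradient ?_
        have h1 := (hφ.differentiable (by simp) x).hasGradientAt.hasFDerivAt.const_mul l
        rw [hasGradientAt_iff_hasFDerivAt, LinearIsometryEquiv.map_smul]
        exact h1
      rw [this, hH.map_smul, abs_of_pos hlpos, mul_pow]
  calc energyInf N H Ω p * A ^ ((N : ℝ) / (p + 1))
      ≤ (l ^ N * ∫ x in Ω, H (gradient φ x) ^ N) * A ^ ((N : ℝ) / (p + 1)) := by gcongr
    _ = (l ^ N * A ^ ((N : ℝ) / (p + 1))) * ∫ x in Ω, H (gradient φ x) ^ N := by ring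
    _ = _ := by rw [hlN, one_mul]

theorem continuous_integral_left (hω : Continuous ω) (R : ℝ) :
    Continuous fun r => ∫ s in r..R, ω s := by
  have : (fun r => ∫ s in r..R, ω s) = fun r => -∫ s in R..r, ω s := by
    ext r; exact intervalIntegral.integral_symm _ _
  rw [this]
  exact (intervalIntegral.continuous_primitive (fun a b => hω.intervalIntegrable a b) R).neg

theorem integral_left_sub (hω : Continuous ω) (R a b : ℝ) :
    (∫ s in a..R, ω s) - ∫ s in b..R, ω s = ∫ s in a..b, ω s := by
  rw [sub_eq_iff_eq_add]
  exact (intervalIntegral.integral_add_adjacent_intervals (hω.intervalIntegrable _ _)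
    (hω.intervalIntegrable _ _)).symm

theorem antitone_integral_left (hω : Continuous ω) (hω0 : ∀ r, 0 ≤ ω r) (R : ℝ) :
    Antitone fun r => ∫ s in r..R, ω s := fun a b hab => by
  have := integral_left_sub hω R a b
  have h2 := intervalIntegral.integral_nonneg (μ := volume) hab (fun s _ => hω0 s)
  simp only; linarith

theorem exists_radial_approx (hH : IsFinslerNorm N H) (hreg : FinslerRegular N H)
    (hω : Continuous ω) (hω0 : ∀ r, 0 ≤ ω r) {ε : ℝ} (hε : 0 < ε) :
    ∃ φ : Euc N → ℝ, ContDiff ℝ (⊤ : ℕ∞) φ ∧ HasCompactSupport φ ∧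
      tsupport φ ⊆ {x | dualNorm H x < R} ∧
      ∀ x, dualNorm H x < R → |φ x - ∫ s in dualNorm H x..R, ω s| ≤ ε ∧
        H (gradient φ x) ≤ ω (dualNorm H x) + ε := by
  set W : ℝ → ℝ := fun r => ∫ s in r..R, ω s with hW
  have hWc : Continuous W := continuous_integral_left hω R
  have hWa : Antitone W := antitone_integral_left hω hω0 R
  have hWR : W R = 0 := intervalIntegral.integral_same
  have hKc := hH.continuous_dualNorm
  obtain ⟨r₁, hr₁R, hr₁⟩ : ∃ r₁ < R, W r₁ ≤ ε / 2 := by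
    have h1 : ∀ᶠ r in 𝓝[<] R, W r < ε / 2 :=
      (hWc.continuousAt.eventually_lt continuousAt_const (by rw [hWR]; positivity)).filter_mono
        nhdsWithin_le_nhds
    obtain ⟨r, h, h'⟩ := (h1.and self_mem_nhdsWithin).exists
    exact ⟨r, h', h.le⟩
  have hW1 : 0 ≤ W r₁ := hWR ▸ hWa hr₁R.le
  set f : Euc N → ℝ := fun x => max (W (dualNorm H x) - W r₁) 0 with hf
  have hfc : Continuous f := ((hWc.comp hKc).sub continuous_const).max continuous_const
  have hts : tsupport f ⊆ {x | dualNorm H x ≤ r₁} := by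
    refine closure_minimal (fun x hx => ?_) (isClosed_le hKc continuous_const)
    by_contra h
    exact hx (max_eq_right (sub_nonpos.2 (hWa (not_le.1 h).le)))
  have hfs : HasCompactSupport f :=
    (hH.isCompact_closedBall r₁).of_isClosed_subset (isClosed_tsupport _) hts
  obtain ⟨δ₃, hδ₃, hthick⟩ := hfs.isCompact.exists_cthickening_subset_open (hH.isOpen_ball R)
    (hts.trans fun x (hx : dualNorm H x ≤ r₁) => lt_of_le_of_lt hx hr₁R)
  obtain ⟨δ₂, hδ₂, hfu⟩ := Metric.uniformContinuous_iff.1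
    (hfs.uniformContinuous_of_continuous hfc) (ε / 2) (half_pos hε)
  obtain ⟨δ₁, hδ₁, hωu⟩ := Metric.uniformContinuousOn_iff.1
    ((isCompact_Icc (a := (0:ℝ)) (b := R + 1)).uniformContinuousOn_of_continuous
      hω.continuousOn) ε hε
  obtain ⟨C, hC, hKC⟩ := hH.exists_dualNorm_le_norm
  set δ₄ := min δ₁ 1 with hδ₄
  have hδ₄p : 0 < δ₄ := lt_min hδ₁ one_pos
  set δ := min (min δ₂ δ₃) (δ₄ / (2 * C)) with hδ
  have hδp : 0 < δ := lt_min (lt_min hδ₂ hδ₃) (by positivity)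
  have hCδ : C * δ ≤ δ₄ / 2 := by
    calc C * δ ≤ C * (δ₄ / (2 * C)) := by gcongr; exact min_le_right _ _
      _ = δ₄ / 2 := by field_simp
  obtain ⟨φ, hφ, hφs, hφ0, hφ1⟩ := exists_mollification hfc hδp
  have hφΩ : tsupport φ ⊆ {x | dualNorm H x < R} :=
    hφs.trans ((Metric.cthickening_mono ((min_le_left _ _).trans (min_le_right _ _)) _).trans
      hthick)
  have hφc : HasCompactSupport φ := hfs.isCompact.cthickening.of_isClosed_subset
    (isClosed_tsupport _) hφs
  refine ⟨φ, hφ, hφc, hφΩ, fun x hx => ⟨?_, ?_⟩⟩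
  · have h1 : |φ x - f x| ≤ ε / 2 := hφ0 x _ fun y hy => by
      rw [← Real.dist_eq]
      exact (hfu (lt_of_lt_of_le hy ((min_le_left _ _).trans (min_le_left _ _)))).le
    have h2 : |f x - W (dualNorm H x)| ≤ ε / 2 := by
      have : 0 ≤ W (dualNorm H x) := hWR ▸ hWa hx.le
      simp only [hf]
      rw [abs_le]
      rcases max_cases (W (dualNorm H x) - W r₁) 0 with h | h <;> constructor <;> linarith
    calc |φ x - W (dualNorm H x)| ≤ |φ x - f x| + |f x - W (dualNorm H x)| := abs_sub_le _ _ _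
      _ ≤ ε := by linarith
  · have hl : 0 ≤ ω (dualNorm H x) + ε := add_nonneg (hω0 _) hε.le
    refine hH.le_of_inner_le hreg hl fun y => ?_
    refine inner_gradient_le_of_sub_le (hφ.differentiable (by simp) x) ?_
    have hsmall : ∀ᶠ t : ℝ in 𝓝[>] 0, t * dualNorm H y < δ₄ / 2 := by
      have : Tendsto (fun t : ℝ => t * dualNorm H y) (𝓝[>] 0) (𝓝 (0 * dualNorm H y)) :=
        (tendsto_id.mono_left nhdsWithin_le_nhds).mul_const _
      exact this.eventually_lt_const (by rw [zero_mul]; positivity)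
    filter_upwards [hsmall, self_mem_nhdsWithin] with t ht (ht0 : 0 < t)
    refine hφ1 x (t • y) _ fun z hz => ?_
    have hKty : dualNorm H (t • y) = t * dualNorm H y := by rw [hH.dualNorm_smul, abs_of_pos ht0]
    have hKy := hH.dualNorm_nonneg y
    have d1 : |dualNorm H (z + t • y) - dualNorm H z| ≤ t * dualNorm H y := by
      have := hH.abs_dualNorm_sub_le (z + t • y) z
      rwa [add_sub_cancel_left, hKty] at this
    have d2 : |dualNorm H z - dualNorm H x| < δ₄ / 2 := by
      refine (hH.abs_dualNorm_sub_le z x).trans_lt ((hKC _).trans_lt ?_)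
      refine lt_of_lt_of_le ?_ hCδ
      rw [mem_ball_iff_norm] at hz
      gcongr
    have hz0 := hH.dualNorm_nonneg (z + t • y)
    have hx0 := hH.dualNorm_nonneg x
    set r := dualNorm H z
    set r' := dualNorm H (z + t • y)
    rw [abs_le] at d1
    rw [abs_lt] at d2
    rcases le_total r r' with h | h
    · have h1 : f (z + t • y) ≤ f z := max_le_max_right _ (sub_le_sub_right (hWa h) _)
      have : 0 ≤ t * ((ω (dualNorm H x) + ε) * dualNorm H y) := by positivity
      linarith
    · have h1 : f (z + t • y) - f z ≤ W r' - W r := by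
        have := hWa h
        simp only [hf]
        rcases max_cases (W r' - W r₁) 0 with h' | h' <;>
          rcases max_cases (W r - W r₁) 0 with h'' | h'' <;> linarith
      refine h1.trans ?_
      rw [integral_left_sub hω]
      have h2 : ∫ s in r'..r, ω s ≤ ∫ s in r'..r, (ω (dualNorm H x) + ε) := by
        refine intervalIntegral.integral_mono_on h (hω.intervalIntegrable _ _)
          (by simp) fun s hs => ?_
        have hδ1 : δ₄ ≤ 1 := min_le_right _ _
        have hδ2 : δ₄ ≤ δ₁ := min_le_left _ _
        have hx' : dualNorm H x < R := hx
        have := hωu s ⟨by linarith [hs.1], by linarith [hs.2]⟩ (dualNorm H x)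
          ⟨hx0, by linarith⟩ (by
            rw [Real.dist_eq, abs_lt]; constructor <;> linarith [hs.1, hs.2])
        rw [Real.dist_eq, abs_lt] at this
        linarith
      rw [intervalIntegral.integral_const, smul_eq_mul] at h2
      refine h2.trans ?_
      calc (r - r') * (ω (dualNorm H x) + ε) ≤ (t * dualNorm H y) * (ω (dualNorm H x) + ε) := by
            gcongr; linarith
        _ = _ := by ring

theorem IsFinslerNorm.integrableOn_comp (hH : IsFinslerNorm N H) {Θ : ℝ → ℝ} (hΘ : Continuous Θ) :
    IntegrableOn (fun x => Θ (dualNorm H x)) {x | dualNorm H x < R} :=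
  IntegrableOn.mono_set ((hΘ.comp hH.continuous_dualNorm).continuousOn.integrableOn_compact
    (hH.isCompact_closedBall R)) fun x (hx : dualNorm H x < R) => hx.le

theorem energyInf_mul_le_of_radial (hH : IsFinslerNorm N H) (hreg : FinslerRegular N H)
    (hN : 2 ≤ N) (hp : 1 < p) (hω : Continuous ω) (hω0 : ∀ r, 0 ≤ ω r) :
    energyInf N H {x | dualNorm H x < R} p *
        (∫ x in {x | dualNorm H x < R}, (∫ s in dualNorm H x..R, ω s) ^ (p + 1)) ^
          ((N : ℝ) / (p + 1)) ≤
      ∫ x in {x | dualNorm H x < R}, ω (dualNorm H x) ^ N := by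
  set Ω : Set (Euc N) := {x | dualNorm H x < R} with hΩ
  have hΩm : MeasurableSet Ω := (hH.isOpen_ball R).measurableSet
  set W : ℝ → ℝ := fun r => ∫ s in r..R, ω s with hW
  have hWc : Continuous W := continuous_integral_left hω R
  have hWa : Antitone W := antitone_integral_left hω hω0 R
  have hWR : W R = 0 := intervalIntegral.integral_same
  have hq : 0 < p + 1 := by linarith
  have hN0 : (0:ℝ) < N := by exact_mod_cast (by omega : 0 < N)
  have hKc := hH.continuous_dualNorm
  set e : ℕ → ℝ := fun n => 1 / ((n : ℝ) + 1) with he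
  have he0 : ∀ n, 0 < e n := fun n => by positivity
  have he1 : ∀ n, e n ≤ 1 := fun n => by
    rw [he]; simp only; rw [div_le_one (by positivity)]; linarith [n.cast_nonneg (α := ℝ)]
  have hel : Tendsto e atTop (𝓝 0) := tendsto_one_div_add_atTop_nhds_zero_nat
  choose φ hφ hφc hφΩ hφb using fun n => exists_radial_approx hH hreg hω hω0 (he0 n)
  have hfin : IsFiniteMeasure (volume.restrict Ω) :=
    ⟨by rw [Measure.restrict_apply_univ]; exact (hH.volume_ball_ne_top R).lt_top⟩
  have l1 : Tendsto (fun n => ∫ x in Ω, |φ n x| ^ (p + 1)) atTop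
      (𝓝 (∫ x in Ω, W (dualNorm H x) ^ (p + 1))) := by
    refine tendsto_integral_of_dominated_convergence (fun _ => (W 0 + 1) ^ (p + 1))
      (fun n => ((hφ n).continuous.abs.rpow_const
        fun x => Or.inr hq.le).aestronglyMeasurable) (integrable_const _) (fun n => ?_) ?_
    · rw [ae_restrict_iff' hΩm]
      refine Eventually.of_forall fun x hx => ?_
      rw [Real.norm_eq_abs, abs_of_nonneg (Real.rpow_nonneg (abs_nonneg _) _)]
      refine Real.rpow_le_rpow (abs_nonneg _) ?_ hq.le
      have h1 := (hφb n x hx).1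
      have h2 : W (dualNorm H x) ≤ W 0 := hWa (hH.dualNorm_nonneg x)
      have h3 : 0 ≤ W (dualNorm H x) := hWR ▸ hWa (le_of_lt hx)
      have h4 := he1 n
      change |φ n x - W (dualNorm H x)| ≤ e n at h1
      rw [abs_le] at *
      constructor <;> linarith
    · rw [ae_restrict_iff' hΩm]
      refine Eventually.of_forall fun x hx => ?_
      have h3 : 0 ≤ W (dualNorm H x) := hWR ▸ hWa (le_of_lt hx)
      have h1 : Tendsto (fun n => φ n x) atTop (𝓝 (W (dualNorm H x))) := by
        rw [tendsto_iff_dist_tendsto_zero]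
        exact squeeze_zero (fun _ => dist_nonneg) (fun n => (hφb n x hx).1) hel
      have h2 := h1.abs.rpow_const (p := p + 1) (Or.inr hq.le)
      rwa [abs_of_nonneg h3] at h2
  have l2 : Tendsto (fun n => ∫ x in Ω, (ω (dualNorm H x) + e n) ^ N) atTop
      (𝓝 (∫ x in Ω, ω (dualNorm H x) ^ N)) := by
    refine tendsto_integral_of_dominated_convergence (fun x => (ω (dualNorm H x) + 1) ^ N)
      (fun n => (((hω.comp hKc).add continuous_const).pow N).aestronglyMeasurable)
      (hH.integrableOn_comp (Θ := fun r => (ω r + 1) ^ N) (by fun_prop)) (fun n => ?_) ?_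
    · refine Eventually.of_forall fun x => ?_
      have := hω0 (dualNorm H x)
      rw [Real.norm_eq_abs, abs_of_nonneg (by have := he0 n; positivity)]
      have := he1 n; have := he0 n
      gcongr
    · refine Eventually.of_forall fun x => ?_
      have := (hel.const_add (ω (dualNorm H x))).pow N
      rwa [add_zero] at this
  refine le_of_tendsto_of_tendsto' ((l1.rpow_const (Or.inr (by positivity))).const_mul _) l2
    fun n => (energyInf_mul_le hH hN hp (hφ n) (hφc n) (hφΩ n)).trans ?_
  refine setIntegral_mono_on ?_
    (hH.integrableOn_comp (Θ := fun r => (ω r + e n) ^ N) (by fun_prop)) hΩm fun x hx =>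
      pow_le_pow_left₀ (hH.nonneg _) (hφb n x hx).2 _
  have hφ1 : ContDiff ℝ 1 (φ n) := (hφ n).of_le (by exact_mod_cast le_top)
  have hc : Continuous fun x => H (gradient (φ n) x) ^ N :=
    (hH.continuous.comp (continuous_gradient hφ1)).pow N
  exact (hc.continuousOn.integrableOn_compact (hH.isCompact_closedBall R)).mono_set
    fun x (hx : dualNorm H x < R) => hx.le

end

/-- The mass of `U ^ p` above the level `s`. -/
def excessMass (N : ℕ) (H : Euc N → ℝ) (R p : ℝ) (U : Euc N → ℝ) (s : ℝ) : ℝ :=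
  ∫ x in {x | dualNorm H x < R}, max (U x ^ p - s) 0

/-- The largest mass of `U ^ p` in a set of volume `V`, written as a concave conjugate. -/
def concentration (N : ℕ) (H : Euc N → ℝ) (R p : ℝ) (U : Euc N → ℝ) (V : ℝ) : ℝ :=
  sInf ((fun s => excessMass N H R p U s + s * V) '' Ici 0)

/-- `ω` is the slope of the radial solution of the symmetrized problem, whose flux through the
Wulff ball of volume `V` is `F V`. -/
structure RadialMajorant (N : ℕ) (H : Euc N → ℝ) (R p : ℝ) (U : Euc N → ℝ)
    (F ω : ℝ → ℝ) : Prop where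
  le_mass : ∀ V, 0 ≤ V → F V ≤ ∫ x in {x | dualNorm H x < R}, U x ^ p
  le_excess : ∀ s V, 0 ≤ s → 0 ≤ V → F V ≤ excessMass N H R p U s + s * V
  mass_le : ∀ t, 0 ≤ t → ∫ x in {x | t < U x}, U x ^ p ≤ F (volume.real {x | t < U x})
  cont : Continuous ω
  slope_nonneg : ∀ r, 0 ≤ ω r
  slope_pos : ∀ r, r ≠ 0 → 0 < ω r
  flux : ∀ r, 0 ≤ r → N * wulffVol N H * (r * ω r) ^ (N - 1) = F (wulffVol N H * r ^ N)

namespace WulffProfile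

variable {N : ℕ} {H : Euc N → ℝ} {R p S : ℝ} {U : Euc N → ℝ}

theorem continuous_rpow (hU : WulffProfile N H R U) (hp : 0 < p) : Continuous fun x => U x ^ p :=
  hU.cont.rpow_const fun _ => Or.inr hp.le

theorem integrableOn_rpow (hU : WulffProfile N H R U) (hH : IsFinslerNorm N H) (hp : 0 < p) :
    IntegrableOn (fun x => U x ^ p) {x | dualNorm H x < R} :=
  hU.integrableOn_comp hH (Real.continuous_rpow_const hp.le).continuousOn

theorem integrableOn_excess (hU : WulffProfile N H R U) (hH : IsFinslerNorm N H) (hp : 0 < p)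
    (s : ℝ) : IntegrableOn (fun x => max (U x ^ p - s) 0) {x | dualNorm H x < R} :=
  hU.integrableOn_comp hH (Θ := fun t => max (t ^ p - s) 0)
    (((Real.continuous_rpow_const hp.le).sub continuous_const).max continuous_const).continuousOn

theorem excessMass_nonneg (s : ℝ) : 0 ≤ excessMass N H R p U s :=
  integral_nonneg fun _ => le_max_right _ _

theorem excessMass_eq_zero (hS : ∀ x, U x ^ p ≤ S) {s : ℝ} (hs : S ≤ s) :
    excessMass N H R p U s = 0 := by
  rw [excessMass, integral_eq_zero_of_ae]
  exact Eventually.of_forall fun x => max_eq_right (by linarith [hS x])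

theorem excessMass_zero (hU : WulffProfile N H R U) :
    excessMass N H R p U 0 = ∫ x in {x | dualNorm H x < R}, U x ^ p := by
  rw [excessMass]
  congr 1; ext x
  rw [sub_zero, max_eq_left (Real.rpow_nonneg (hU.nonneg x) _)]

theorem antitone_excessMass (hU : WulffProfile N H R U) (hH : IsFinslerNorm N H) (hp : 0 < p) :
    Antitone (excessMass N H R p U) := fun s t hst => by
  refine integral_mono (hU.integrableOn_excess hH hp t) (hU.integrableOn_excess hH hp s) fun x => ?_
  exact max_le_max_right _ (by linarith)

theorem concentration_le {s V : ℝ} (hs : 0 ≤ s) (hV : 0 ≤ V) :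
    concentration N H R p U V ≤ excessMass N H R p U s + s * V := by
  refine csInf_le ⟨0, ?_⟩ ⟨s, hs, rfl⟩
  rintro _ ⟨s, hs, rfl⟩
  exact add_nonneg (excessMass_nonneg s) (mul_nonneg hs hV)

theorem le_concentration {c V : ℝ} (h : ∀ s, 0 ≤ s → c ≤ excessMass N H R p U s + s * V) :
    c ≤ concentration N H R p U V := by
  refine le_csInf (nonempty_Ici.image _) ?_
  rintro _ ⟨s, hs, rfl⟩
  exact h s hs

theorem concentration_nonneg {V : ℝ} (hV : 0 ≤ V) : 0 ≤ concentration N H R p U V :=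
  le_concentration fun s hs => add_nonneg (excessMass_nonneg s) (mul_nonneg hs hV)

theorem concentration_le_mul (hS0 : 0 ≤ S) (hS : ∀ x, U x ^ p ≤ S) {V : ℝ} (hV : 0 ≤ V) :
    concentration N H R p U V ≤ S * V := by
  have := concentration_le (N := N) (H := H) (R := R) (p := p) (U := U) hS0 hV
  rwa [excessMass_eq_zero hS le_rfl, zero_add] at this

theorem concentration_sub_le (hS0 : 0 ≤ S) (hS : ∀ x, U x ^ p ≤ S) {V V' : ℝ} (hV : 0 ≤ V)
    (hV' : 0 ≤ V') :
    concentration N H R p U V' ≤ concentration N H R p U V + S * |V' - V| := by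
  rw [← sub_le_iff_le_add]
  refine le_concentration fun s hs => ?_
  have h1 := le_abs_self (V' - V)
  have h2 := abs_nonneg (V' - V)
  rcases le_total s S with h | h
  · have := concentration_le (N := N) (H := H) (R := R) (p := p) (U := U) hs hV'
    nlinarith
  · have := concentration_le_mul (N := N) (H := H) (R := R) (p := p) (U := U) hS0 hS hV'
    have := excessMass_nonneg (N := N) (H := H) (R := R) (p := p) (U := U) s
    nlinarith

theorem continuousOn_concentration (hS0 : 0 ≤ S) (hS : ∀ x, U x ^ p ≤ S) :
    ContinuousOn (concentration N H R p U) (Ici 0) := by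
  have : LipschitzOnWith ⟨S, hS0⟩ (concentration N H R p U) (Ici 0) :=
    LipschitzOnWith.of_le_add_mul _ fun x hx y hy => by
      rw [Real.dist_eq]; exact concentration_sub_le hS0 hS hy hx
  exact this.continuousOn

theorem concentration_pos (hU : WulffProfile N H R U) (hH : IsFinslerNorm N H) (hp : 0 < p)
    (hR : 0 < R) {V : ℝ} (hV : 0 < V) : 0 < concentration N H R p U V := by
  have h0 : 0 < U 0 ^ p := Real.rpow_pos_of_pos (hU.pos 0 (by rwa [hH.dualNorm_zero])) _
  set s₀ := U 0 ^ p / 2 with hs₀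
  have hs₀p : 0 < s₀ := half_pos h0
  have he : 0 < excessMass N H R p U s₀ := by
    have hnn : 0 ≤ᵐ[volume.restrict {x | dualNorm H x < R}] fun x => max (U x ^ p - s₀) 0 :=
      Eventually.of_forall fun x => le_max_right _ _
    rw [excessMass, setIntegral_pos_iff_support_of_nonneg_ae hnn (hU.integrableOn_excess hH hp s₀)]
    have hc : Continuous fun x => max (U x ^ p - s₀) 0 :=
      ((hU.continuous_rpow hp).sub continuous_const).max continuous_const
    refine IsOpen.measure_pos _ (hc.isOpen_support.inter (hH.isOpen_ball R)) ⟨0, ?_, ?_⟩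
    · have : 0 < U 0 ^ p - s₀ := by rw [hs₀]; linarith
      exact (lt_max_of_lt_left this).ne'
    · show dualNorm H 0 < R
      rwa [hH.dualNorm_zero]
  refine lt_of_lt_of_le (lt_min he (mul_pos hs₀p hV)) (le_concentration fun s hs => ?_)
  rcases le_total s s₀ with h | h
  · exact (min_le_left _ _).trans ((hU.antitone_excessMass hH hp h).trans
      (le_add_of_nonneg_right (mul_nonneg hs hV.le)))
  · exact (min_le_right _ _).trans ((mul_le_mul_of_nonneg_right h hV.le).trans
      (le_add_of_nonneg_left (excessMass_nonneg s)))

theorem setIntegral_le_concentration (hU : WulffProfile N H R U) (hH : IsFinslerNorm N H)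
    (hp : 0 < p) {t : ℝ} (ht : 0 ≤ t) :
    ∫ x in {x | t < U x}, U x ^ p ≤ concentration N H R p U (volume.real {x | t < U x}) := by
  refine le_concentration fun s hs => ?_
  have hsub := hU.superlevel_subset ht
  have hm : MeasurableSet {x | t < U x} := (hU.isOpen_superlevel t).measurableSet
  have hfin := hU.volume_superlevel_ne_top hH ht
  have hi := (hU.integrableOn_excess hH hp s).mono_set hsub
  have hc : IntegrableOn (fun _ => s) {x | t < U x} :=
    integrableOn_const hfin
  calc ∫ x in {x | t < U x}, U x ^ p
      ≤ ∫ x in {x | t < U x}, (max (U x ^ p - s) 0 + s) := by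
        refine integral_mono ((hU.integrableOn_rpow hH hp).mono_set hsub) (hi.add hc) fun x => ?_
        have := le_max_left (U x ^ p - s) 0
        simp only; linarith
    _ = (∫ x in {x | t < U x}, max (U x ^ p - s) 0) + s * volume.real {x | t < U x} := by
        rw [integral_add hi hc, setIntegral_const, smul_eq_mul, mul_comm]
    _ ≤ _ := by
        gcongr
        exact setIntegral_mono_set (hU.integrableOn_excess hH hp s)
          (Eventually.of_forall fun x => le_max_right _ _) hsub.eventuallyLE

/-- The slope of the symmetrized solution. -/
def symmSlope (N : ℕ) (H : Euc N → ℝ) (R p : ℝ) (U : Euc N → ℝ) (r : ℝ) : ℝ :=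
  (concentration N H R p U (wulffVol N H * |r| ^ N) / (N * wulffVol N H)) ^ (1 / ((N:ℝ) - 1)) / |r|

theorem continuous_symmSlope (hH : IsFinslerNorm N H) (hN : 2 ≤ N) (hS0 : 0 ≤ S)
    (hS : ∀ x, U x ^ p ≤ S) : Continuous (symmSlope N H R p U) := by
  have hκ := hH.wulffVol_pos
  have hN1 : (0:ℝ) < (N:ℝ) - 1 := by
    have : (2:ℝ) ≤ N := by exact_mod_cast hN
    linarith
  have hN0 : (0:ℝ) < N := by linarith
  rw [continuous_iff_continuousAt]
  intro r
  rcases eq_or_ne r 0 with rfl | hr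
  · have h0 : symmSlope N H R p U 0 = 0 := by simp [symmSlope]
    rw [ContinuousAt, h0]
    have hb : ∀ r, |symmSlope N H R p U r| ≤
        (S / N) ^ (1 / ((N:ℝ) - 1)) * |r| ^ (1 / ((N:ℝ) - 1)) := by
      intro r
      rcases eq_or_ne r 0 with rfl | hr
      · rw [h0, abs_zero]; positivity
      have hr' : 0 < |r| := abs_pos.2 hr
      have hV : 0 ≤ wulffVol N H * |r| ^ N := by positivity
      have hF := concentration_nonneg (N := N) (H := H) (R := R) (p := p) (U := U) hV
      rw [symmSlope, abs_of_nonneg (by positivity), div_le_iff₀ hr']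
      calc (concentration N H R p U (wulffVol N H * |r| ^ N) / (N * wulffVol N H)) ^
            (1 / ((N:ℝ) - 1))
          ≤ (S / N * |r| ^ N) ^ (1 / ((N:ℝ) - 1)) := by
            refine Real.rpow_le_rpow (by positivity) ?_ (by positivity)
            rw [div_le_iff₀ (by positivity)]
            refine (concentration_le_mul hS0 hS hV).trans (le_of_eq ?_)
            field_simp
        _ = (S / N) ^ (1 / ((N:ℝ) - 1)) * |r| ^ (1 / ((N:ℝ) - 1)) * |r| := by
            rw [Real.mul_rpow (by positivity) (by positivity), mul_assoc, ← Real.rpow_natCast,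
              ← Real.rpow_mul hr'.le, ← Real.rpow_add_one hr'.ne']
            congr 2
            field_simp; ring
    refine squeeze_zero_norm hb ?_
    have : Continuous fun r : ℝ => (S / N) ^ (1 / ((N:ℝ) - 1)) * |r| ^ (1 / ((N:ℝ) - 1)) :=
      continuous_const.mul (continuous_abs.rpow_const fun _ => Or.inr (by positivity))
    have h2 := this.tendsto 0
    rwa [abs_zero, Real.zero_rpow (by positivity), mul_zero] at h2
  · have h1 : Continuous fun r : ℝ => concentration N H R p U (wulffVol N H * |r| ^ N) :=
      (continuousOn_concentration hS0 hS).comp_continuous (by fun_prop)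
        fun r => mem_Ici.2 (by positivity)
    exact ((h1.div_const _).rpow_const fun _ => Or.inr (by positivity)).continuousAt.div
      continuous_abs.continuousAt (abs_pos.2 hr).ne'

theorem radialMajorant (hU : WulffProfile N H R U) (hH : IsFinslerNorm N H) (hN : 2 ≤ N)
    (hp : 0 < p) (hR : 0 < R) (hS : ∀ x, U x ^ p ≤ S) :
    RadialMajorant N H R p U (concentration N H R p U) (symmSlope N H R p U) := by
  have hκ := hH.wulffVol_pos
  have hN1 : (0:ℝ) < (N:ℝ) - 1 := by
    have : (2:ℝ) ≤ N := by exact_mod_cast hN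
    linarith
  have hN0 : (0:ℝ) < N := by linarith
  have hS0 : 0 ≤ S := (Real.rpow_nonneg (hU.nonneg 0) p).trans (hS 0)
  have hVr : ∀ r : ℝ, 0 ≤ wulffVol N H * |r| ^ N := fun r => by positivity
  refine ⟨fun V hV => ?_, fun s V => concentration_le,
    fun t => hU.setIntegral_le_concentration hH hp, continuous_symmSlope hH hN hS0 hS,
    fun r => ?_, fun r hr => ?_, fun r hr => ?_⟩
  · have := concentration_le (N := N) (H := H) (R := R) (p := p) (U := U) le_rfl hV
    rwa [hU.excessMass_zero, zero_mul, add_zero] at this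
  · have := concentration_nonneg (N := N) (H := H) (R := R) (p := p) (U := U) (hVr r)
    rw [symmSlope]; positivity
  · have hr' : 0 < |r| := abs_pos.2 hr
    have := hU.concentration_pos hH hp hR (V := wulffVol N H * |r| ^ N) (by positivity)
    rw [symmSlope]; positivity
  · have hF := concentration_nonneg (N := N) (H := H) (R := R) (p := p) (U := U) (hVr r)
    rcases hr.eq_or_lt with rfl | hr
    · have := concentration_le_mul (N := N) (H := H) (R := R) hS0 hS (V := 0) le_rfl
      rw [mul_zero] at this
      have h2 := concentration_nonneg (N := N) (H := H) (R := R) (p := p) (U := U) (V := 0) le_rfl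
      rw [zero_mul, zero_pow (by omega), zero_pow (by omega), mul_zero, mul_zero]
      linarith
    · rw [symmSlope, abs_of_pos hr, mul_div_cancel₀ _ hr.ne', ← Real.rpow_natCast,
        ← Real.rpow_mul (by rw [abs_of_pos hr] at hF; positivity), Nat.cast_sub (by omega),
        Nat.cast_one, one_div_mul_cancel hN1.ne', Real.rpow_one]
      field_simp

end WulffProfile

section

variable {N : ℕ} {H : Euc N → ℝ} {R p : ℝ} {U : Euc N → ℝ} {F ω : ℝ → ℝ}

theorem IsFinslerNorm.integral_radial (hH : IsFinslerNorm N H) (hN : N ≠ 0) (hR : 0 < R)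
    {Θ : ℝ → ℝ} (hΘ : Continuous Θ) :
    ∫ x in {x | dualNorm H x < R}, Θ (dualNorm H x) =
      ∫ r in (0:ℝ)..R, N * wulffVol N H * r ^ (N - 1) * Θ r := by
  have hκ := hH.wulffVol_pos
  rw [← integral_map (μ := volume.restrict {x | dualNorm H x < R}) (f := Θ)
    hH.continuous_dualNorm.aemeasurable hΘ.aestronglyMeasurable, hH.map_dualNorm hN hR,
    integral_withDensity_eq_integral_toReal_smul (by fun_prop)
      (Eventually.of_forall fun _ => ENNReal.ofReal_lt_top),
    intervalIntegral.integral_of_le hR.le, integral_Ioc_eq_integral_Ioo]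
  refine setIntegral_congr_fun measurableSet_Ioo fun r hr => ?_
  have : 0 < r := hr.1
  rw [ENNReal.toReal_ofReal (by positivity), smul_eq_mul]

theorem hasDerivAt_integral_left (hω : Continuous ω) (R r : ℝ) :
    HasDerivAt (fun r => ∫ s in r..R, ω s) (-ω r) r :=
  intervalIntegral.integral_hasDerivAt_left (hω.intervalIntegrable _ _)
    hω.stronglyMeasurable.stronglyMeasurableAtFilter hω.continuousAt

theorem integral_slope_mul_comp (hω : Continuous ω) {g : ℝ → ℝ} (hg : Continuous g) (a b : ℝ) :
    ∫ r in a..b, ω r * g (∫ s in r..R, ω s) =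
      ∫ t in (∫ s in b..R, ω s)..(∫ s in a..R, ω s), g t := by
  have h := intervalIntegral.integral_comp_mul_deriv (a := a) (b := b) (g := g)
    (fun r _ => hasDerivAt_integral_left hω R r) hω.neg.continuousOn hg
  rw [intervalIntegral.integral_symm (∫ s in a..R, ω s), ← h, ← intervalIntegral.integral_neg]
  congr 1; ext r
  simp only [Function.comp]; ring

theorem integral_max_sub_le {y c τ : ℝ} (hp : 0 < p) (hy : 0 ≤ y) (hc : 0 < c) :
    ∫ σ in (0:ℝ)..τ, max (y ^ p - (c * σ) ^ p) 0 ≤ p / (p + 1) * (y ^ (p + 1) / c) := by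
  have hq : 0 < p + 1 := by linarith
  have hcp : Continuous fun σ : ℝ => (c * σ) ^ p :=
    (continuous_const.mul continuous_id).rpow_const fun _ => Or.inr hp.le
  have hgc : Continuous fun σ : ℝ => max (y ^ p - (c * σ) ^ p) 0 :=
    (continuous_const.sub hcp).max continuous_const
  have hii := fun a b => hgc.intervalIntegrable (μ := volume) a b
  have hyc : 0 ≤ y / c := div_nonneg hy hc.le
  set M := max τ (y / c) with hM
  have h1 : ∫ σ in (0:ℝ)..τ, max (y ^ p - (c * σ) ^ p) 0 ≤
      ∫ σ in (0:ℝ)..M, max (y ^ p - (c * σ) ^ p) 0 := by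
    rw [← intervalIntegral.integral_add_adjacent_intervals (hii 0 τ) (hii τ M)]
    have := intervalIntegral.integral_nonneg (μ := volume) (le_max_left τ (y / c))
      (fun σ _ => le_max_right (y ^ p - (c * σ) ^ p) 0)
    linarith
  refine h1.trans ?_
  rw [← intervalIntegral.integral_add_adjacent_intervals (hii 0 (y / c)) (hii (y / c) M)]
  have h2 : ∫ σ in (y / c)..M, max (y ^ p - (c * σ) ^ p) 0 = 0 := by
    rw [intervalIntegral.integral_congr (g := fun _ => (0:ℝ)), intervalIntegral.integral_zero]
    intro σ hσ
    rw [uIcc_of_le (le_max_right _ _)] at hσ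
    refine max_eq_right (sub_nonpos.2 (Real.rpow_le_rpow hy ?_ hp.le))
    have := hσ.1
    rwa [div_le_iff₀' hc] at this
  have h3 : ∫ σ in (0:ℝ)..(y / c), max (y ^ p - (c * σ) ^ p) 0 =
      ∫ σ in (0:ℝ)..(y / c), (y ^ p - c ^ p * σ ^ p) := by
    refine intervalIntegral.integral_congr fun σ hσ => ?_
    rw [uIcc_of_le hyc] at hσ
    have := hσ.2
    rw [le_div_iff₀' hc] at this
    rw [max_eq_left (sub_nonneg.2 (Real.rpow_le_rpow (mul_nonneg hc.le hσ.1) this hp.le)),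
      Real.mul_rpow hc.le hσ.1]
  rw [h2, h3, add_zero, intervalIntegral.integral_sub (by simp)
    ((intervalIntegral.intervalIntegrable_rpow (Or.inl hp.le)).const_mul _),
    intervalIntegral.integral_const, intervalIntegral.integral_const_mul,
    integral_rpow (Or.inl (by linarith)), Real.zero_rpow hq.ne', Real.div_rpow hy hc.le,
    sub_zero, sub_zero, smul_eq_mul]
  rcases hy.eq_or_lt with rfl | hy
  · simp [Real.zero_rpow hq.ne', Real.zero_rpow hp.ne']
  · rw [Real.rpow_add_one hy.ne', Real.rpow_add_one hc.ne']
    have := Real.rpow_pos_of_pos hc p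
    apply le_of_eq
    field_simp; ring

namespace RadialMajorant

theorem potential_nonneg (hM : RadialMajorant N H R p U F ω) {r : ℝ} (hr : r ≤ R) :
    0 ≤ ∫ s in r..R, ω s :=
  intervalIntegral.integral_nonneg hr fun s _ => hM.slope_nonneg s

theorem integral_mul_potential_pow (hM : RadialMajorant N H R p U F ω) (hH : IsFinslerNorm N H)
    (hN : 2 ≤ N) (hp : 0 < p) (hR : 0 < R) :
    ∫ r in (0:ℝ)..R, ω r * ((∫ s in r..R, ω s) ^ p * (wulffVol N H * r ^ N)) =
      (∫ x in {x | dualNorm H x < R}, (∫ s in dualNorm H x..R, ω s) ^ (p + 1)) / (p + 1) := by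
  have hq : 0 < p + 1 := by linarith
  set W : ℝ → ℝ := fun r => ∫ s in r..R, ω s with hW
  have hWc : Continuous W := continuous_integral_left hM.cont R
  have hW1 : Continuous fun r => W r ^ (p + 1) := hWc.rpow_const fun _ => Or.inr hq.le
  have hWp : Continuous fun r => W r ^ p := hWc.rpow_const fun _ => Or.inr hp.le
  rw [hH.integral_radial (by omega) hR (Θ := fun r => W r ^ (p + 1)) hW1, eq_div_iff hq.ne']
  set κ := wulffVol N H
  have hωc := hM.cont
  have hd : ∀ r : ℝ, HasDerivAt (fun r => κ * r ^ N * W r ^ (p + 1))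
      (N * κ * r ^ (N - 1) * W r ^ (p + 1) - ω r * (W r ^ p * (κ * r ^ N)) * (p + 1)) r := by
    intro r
    have h1 := (hasDerivAt_pow N r).const_mul κ
    have h2 := (hasDerivAt_integral_left hωc R r).rpow_const (p := p + 1) (Or.inr (by linarith))
    refine (h1.mul h2).congr_deriv ?_
    rw [add_sub_cancel_right]; ring
  have hi1 : IntervalIntegrable (fun r => N * κ * r ^ (N - 1) * W r ^ (p + 1)) volume 0 R :=
    ((by fun_prop : Continuous fun r : ℝ => N * κ * r ^ (N - 1)).mul hW1).intervalIntegrable _ _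
  have hi2 : IntervalIntegrable (fun r => ω r * (W r ^ p * (κ * r ^ N)) * (p + 1)) volume 0 R :=
    ((hωc.mul (hWp.mul (by fun_prop : Continuous fun r : ℝ => κ * r ^ N))).mul
      continuous_const).intervalIntegrable _ _
  have h := intervalIntegral.integral_eq_sub_of_hasDerivAt (fun r _ => hd r) (hi1.sub hi2)
  rw [intervalIntegral.integral_sub hi1 hi2, intervalIntegral.integral_mul_const] at h
  have hWR : W R = 0 := intervalIntegral.integral_same
  rw [hWR, Real.zero_rpow hq.ne', zero_pow (by omega), mul_zero, mul_zero, zero_mul, sub_zero] at h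
  linarith

theorem energy_eq (hM : RadialMajorant N H R p U F ω) (hH : IsFinslerNorm N H)
    (hN : 2 ≤ N) (hR : 0 < R) :
    ∫ x in {x | dualNorm H x < R}, ω (dualNorm H x) ^ N =
      ∫ r in (0:ℝ)..R, ω r * F (wulffVol N H * r ^ N) := by
  rw [hH.integral_radial (by omega) hR (Θ := fun r => ω r ^ N) (hM.cont.pow N)]
  refine intervalIntegral.integral_congr fun r hr => ?_
  rw [uIcc_of_le hR.le] at hr
  rw [← hM.flux r hr.1, mul_pow]
  obtain ⟨k, rfl⟩ : ∃ k, N = k + 1 := ⟨N - 1, by omega⟩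
  simp only [Nat.add_sub_cancel, pow_succ]
  ring

theorem energy_le (hM : RadialMajorant N H R p U F ω) (hU : WulffProfile N H R U)
    (hH : IsFinslerNorm N H) (hN : 2 ≤ N) (hp : 0 < p) (hR : 0 < R) {c : ℝ} (hc : 0 < c) :
    ∫ x in {x | dualNorm H x < R}, ω (dualNorm H x) ^ N ≤
      p / (p + 1) * ((∫ x in {x | dualNorm H x < R}, U x ^ (p + 1)) / c) +
      c ^ p * ((∫ x in {x | dualNorm H x < R}, (∫ s in dualNorm H x..R, ω s) ^ (p + 1)) /
        (p + 1)) := by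
  have hq : 0 < p + 1 := by linarith
  rw [← hM.integral_mul_potential_pow hH hN hp hR, hM.energy_eq hH hN hR]
  set Ω : Set (Euc N) := {x | dualNorm H x < R} with hΩ
  have hΩm : MeasurableSet Ω := (hH.isOpen_ball R).measurableSet
  set W : ℝ → ℝ := fun r => ∫ s in r..R, ω s with hW
  have hωc := hM.cont
  have hWc : Continuous W := continuous_integral_left hωc R
  have hWp : Continuous fun r => W r ^ p := hWc.rpow_const fun _ => Or.inr hp.le
  have hcWp : Continuous fun r => (c * W r) ^ p :=
    (continuous_const.mul hWc).rpow_const fun _ => Or.inr hp.le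
  have hκ := hH.wulffVol_pos
  have hUp := hU.continuous_rpow hp
  set f : ℝ → Euc N → ℝ := fun r x => ω r * max (U x ^ p - (c * W r) ^ p) 0 with hf
  have hfc : Continuous (Function.uncurry f) :=
    (hωc.comp continuous_fst).mul (((hUp.comp continuous_snd).sub
      (hcWp.comp continuous_fst)).max continuous_const)
  have hfi : Integrable (Function.uncurry f)
      ((volume.restrict (Ioc 0 R)).prod (volume.restrict Ω)) := by
    rw [Measure.prod_restrict]
    exact (hfc.continuousOn.integrableOn_compact
      ((isCompact_Icc (a := (0:ℝ)) (b := R)).prod (hH.isCompact_closedBall R))).mono_set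
      (prod_mono Ioc_subset_Icc_self fun x (hx : dualNorm H x < R) => hx.le)
  have hfr : ∀ r, ∫ x in Ω, f r x = ω r * excessMass N H R p U ((c * W r) ^ p) := fun r => by
    rw [excessMass, ← integral_const_mul]
  have hi1 : IntervalIntegrable (fun r => ∫ x in Ω, f r x) volume 0 R := by
    rw [intervalIntegrable_iff_integrableOn_Ioc_of_le hR.le]
    exact hfi.integral_prod_left
  have hi2 : IntervalIntegrable (fun r => ω r * (W r ^ p * (wulffVol N H * r ^ N))) volume 0 R :=
    (hωc.mul (hWp.mul
      (by fun_prop : Continuous fun r : ℝ => wulffVol N H * r ^ N))).intervalIntegrable _ _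
  have hi0 : IntervalIntegrable (fun r => ω r * F (wulffVol N H * r ^ N)) volume 0 R := by
    have : Continuous fun r => ω r * (N * wulffVol N H * (r * ω r) ^ (N - 1)) := by fun_prop
    refine (this.intervalIntegrable 0 R).congr fun r hr => ?_
    rw [uIoc_of_le hR.le] at hr
    simp only [hM.flux r hr.1.le]
  have step1 : ∫ r in (0:ℝ)..R, ω r * F (wulffVol N H * r ^ N) ≤
      ∫ r in (0:ℝ)..R, ((∫ x in Ω, f r x) + c ^ p * (ω r * (W r ^ p * (wulffVol N H * r ^ N)))) := by
    refine intervalIntegral.integral_mono_on hR.le hi0 (hi1.add (hi2.const_mul _)) fun r hr => ?_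
    have hWr : 0 ≤ W r := hM.potential_nonneg hr.2
    have hr0 : 0 ≤ r := hr.1
    have h1 := hM.le_excess ((c * W r) ^ p) (wulffVol N H * r ^ N) (by positivity) (by positivity)
    rw [hfr]
    have h2 := mul_le_mul_of_nonneg_left h1 (hM.slope_nonneg r)
    rw [Real.mul_rpow hc.le hWr] at h2 ⊢
    linarith
  refine step1.trans ?_
  rw [intervalIntegral.integral_add hi1 (hi2.const_mul _), intervalIntegral.integral_const_mul]
  gcongr
  rw [intervalIntegral.integral_of_le hR.le, integral_integral_swap hfi]
  have hR' : ∀ x, ∫ r in Ioc 0 R, f r x ≤ p / (p + 1) * (U x ^ (p + 1) / c) := fun x => by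
    rw [← intervalIntegral.integral_of_le hR.le]
    have hgc : Continuous fun σ : ℝ => max (U x ^ p - (c * σ) ^ p) 0 :=
      (continuous_const.sub ((continuous_const.mul continuous_id).rpow_const
        fun _ => Or.inr hp.le)).max continuous_const
    have h1 := integral_slope_mul_comp (R := R) hωc hgc 0 R
    rw [intervalIntegral.integral_same] at h1
    exact h1.trans_le (integral_max_sub_le hp (hU.nonneg x) hc)
  calc ∫ x in Ω, ∫ r in Ioc 0 R, f r x ≤ ∫ x in Ω, p / (p + 1) * (U x ^ (p + 1) / c) :=
        integral_mono hfi.integral_prod_right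
          (((hU.integrableOn_rpow hH hq).div_const c).const_mul _) hR'
    _ = _ := by rw [integral_const_mul, integral_div]

end RadialMajorant

theorem WulffProfile.integral_rpow_pos (hU : WulffProfile N H R U) (hH : IsFinslerNorm N H)
    (hp : 0 < p) (hR : 0 < R) : 0 < ∫ x in {x | dualNorm H x < R}, U x ^ p := by
  have hnn : 0 ≤ᵐ[volume.restrict {x | dualNorm H x < R}] fun x => U x ^ p :=
    Eventually.of_forall fun x => Real.rpow_nonneg (hU.nonneg x) _
  rw [setIntegral_pos_iff_support_of_nonneg_ae hnn (hU.integrableOn_rpow hH hp)]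
  refine IsOpen.measure_pos _ ((hU.continuous_rpow hp).isOpen_support.inter (hH.isOpen_ball R))
    ⟨0, ?_, ?_⟩
  · exact (Real.rpow_pos_of_pos (hU.pos 0 (by rwa [hH.dualNorm_zero])) _).ne'
  · show dualNorm H 0 < R
    rwa [hH.dualNorm_zero]

theorem RadialMajorant.norm_le (hM : RadialMajorant N H R p U F ω)
    (hU : LaneEmdenProfile N H R p U) (hH : IsFinslerNorm N H) (hreg : FinslerRegular N H)
    (hN : 2 ≤ N) (hp : 1 < p) (hR : 0 < R) :
    ∫ x in {x | dualNorm H x < R}, (∫ s in dualNorm H x..R, ω s) ^ (p + 1) ≤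
      ∫ x in {x | dualNorm H x < R}, U x ^ (p + 1) := by
  have hp0 : 0 < p := by linarith
  have hq : 0 < p + 1 := by linarith
  have ha := hU.integral_rpow_pos hH hq hR
  have h1 := energyInf_mul_le_of_radial (R := R) hH hreg hN hp hM.cont hM.slope_nonneg
  have h2 := hU.energy_le
  have h3 := fun c (hc : 0 < c) => hM.energy_le hU.toWulffProfile hH hN hp0 hR hc
  set a := ∫ x in {x | dualNorm H x < R}, U x ^ (p + 1)
  set b := ∫ x in {x | dualNorm H x < R}, (∫ s in dualNorm H x..R, ω s) ^ (p + 1)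
  set E := energyInf N H {x | dualNorm H x < R} p
  by_contra! hab
  have hb : 0 < b := ha.trans hab
  have hN1 : (1:ℝ) < N := by exact_mod_cast (by omega : 1 < N)
  have hE : 0 < E := by
    by_contra! h
    have := mul_nonpos_of_nonpos_of_nonneg h (Real.rpow_nonneg ha.le ((N:ℝ) / (p + 1)))
    linarith
  set c := (a / b) ^ (1 / (p + 1)) with hc
  have hcpos : 0 < c := Real.rpow_pos_of_pos (div_pos ha hb) _
  have hcq : c ^ p * c = a / b := by
    rw [← Real.rpow_add_one hcpos.ne', hc, ← Real.rpow_mul (div_pos ha hb).le,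
      one_div_mul_cancel hq.ne', Real.rpow_one]
  have h4 : E * b ^ ((N:ℝ) / (p + 1)) * c ≤ a := by
    calc E * b ^ ((N:ℝ) / (p + 1)) * c ≤ (p / (p + 1) * (a / c) + c ^ p * (b / (p + 1))) * c := by
          gcongr; exact h1.trans (h3 c hcpos)
      _ = p / (p + 1) * a + (c ^ p * c) * b / (p + 1) := by field_simp
      _ = a := by rw [hcq]; field_simp
  have h5 : b ^ ((N:ℝ) / (p + 1)) * c ≤ a ^ ((N:ℝ) / (p + 1)) := by
    refine le_of_mul_le_mul_left ?_ hE
    rw [← mul_assoc]; exact h4.trans h2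
  have e1 : (N:ℝ) / (p + 1) = (N - 1) / (p + 1) + 1 / (p + 1) := by ring
  have hb1 := Real.rpow_pos_of_pos hb (1 / (p + 1))
  have ha1 := Real.rpow_pos_of_pos ha (1 / (p + 1))
  rw [hc, Real.div_rpow ha.le hb.le, e1, Real.rpow_add hb, Real.rpow_add ha, mul_assoc,
    mul_div_cancel₀ _ hb1.ne'] at h5
  have h6 := le_of_mul_le_mul_right h5 ha1
  exact absurd h6 (not_le.2 (Real.rpow_lt_rpow ha.le hab (div_pos (by linarith) hq)))

end

section

variable {N : ℕ} {H : Euc N → ℝ} {R p : ℝ} {U : Euc N → ℝ} {F ω : ℝ → ℝ}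

theorem exists_bump {α β η : ℝ} (hη : 0 < η) (h : 3 * η < β - α) :
    ∃ g : ℝ → ℝ, Continuous g ∧ (∀ t, 0 ≤ g t) ∧ (∀ t, g t ≤ 1) ∧ (∀ t ≤ α + η, g t = 0) ∧
      (∀ t, β ≤ t → g t = 0) ∧ β - α - 3 * η ≤ ∫ t in α..β, g t := by
  obtain ⟨g₁, hc₁, h0₁, h1₁, hz₁, ho₁⟩ := exists_cutoff (a := α + η) hη
  obtain ⟨g₂, hc₂, h0₂, h1₂, hz₂, ho₂⟩ := exists_cutoff (a := -β) hη
  have hc : Continuous fun t => g₁ t * g₂ (-t) := hc₁.mul (hc₂.comp continuous_neg)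
  have h0 : ∀ t, 0 ≤ g₁ t * g₂ (-t) := fun t => mul_nonneg (h0₁ t) (h0₂ _)
  refine ⟨fun t => g₁ t * g₂ (-t), hc, h0, fun t => mul_le_one₀ (h1₁ t) (h0₂ _) (h1₂ _),
    fun t ht => by simp [hz₁ t ht], fun t ht => by simp [hz₂ (-t) (by linarith)], ?_⟩
  have hi := fun a b => hc.intervalIntegrable (μ := volume) a b
  have e1 : ∫ t in (α + 2 * η)..(β - η), g₁ t * g₂ (-t) = β - α - 3 * η := by
    rw [intervalIntegral.integral_congr (g := fun _ => (1:ℝ)), intervalIntegral.integral_const,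
      smul_eq_mul]
    · ring
    · intro t ht
      rw [uIcc_of_le (by linarith)] at ht
      simp only
      rw [ho₁ t (by linarith [ht.1]), ho₂ (-t) (by linarith [ht.2]), one_mul]
  have e2 := intervalIntegral.integral_nonneg (μ := volume) (a := α) (b := α + 2 * η)
    (by linarith) (fun t _ => h0 t)
  have e3 := intervalIntegral.integral_nonneg (μ := volume) (a := β - η) (b := β)
    (by linarith) (fun t _ => h0 t)
  rw [← intervalIntegral.integral_add_adjacent_intervals (hi α (α + 2 * η)) (hi _ β),
    ← intervalIntegral.integral_add_adjacent_intervals (hi (α + 2 * η) (β - η)) (hi _ β)]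
  linarith

/-- Young's inequality with exponents `N` and `N / (N - 1)`. -/
theorem young_pow {h k : ℝ} (hh : 0 ≤ h) (hk : 0 ≤ k) (hN : 1 ≤ N) :
    N * (h * k ^ (N - 1)) ≤ h ^ N + ((N:ℝ) - 1) * k ^ N := by
  obtain ⟨n, rfl⟩ : ∃ n, N = n + 1 := ⟨N - 1, by omega⟩
  rcases hk.eq_or_lt with rfl | hk
  · rcases Nat.eq_zero_or_pos n with rfl | hn
    · simp
    · simp [zero_pow hn.ne']; positivity
  have hb := one_add_mul_le_pow (a := h / k - 1) (by
    have : 0 ≤ h / k := by positivity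
    linarith) (n + 1)
  rw [add_sub_cancel, div_pow, le_div_iff₀ (by positivity)] at hb
  have e : (1 + ((n + 1 : ℕ):ℝ) * (h / k - 1)) * k ^ (n + 1) =
      ((n + 1 : ℕ):ℝ) * (h * k ^ n) - (((n + 1 : ℕ):ℝ) - 1) * k ^ (n + 1) := by
    field_simp; ring
  rw [e] at hb
  simp only [Nat.add_sub_cancel]
  linarith

theorem eq_of_young_pow_le {h k : ℝ} (hh : 0 ≤ h) (hk : 0 ≤ k) (hN : 2 ≤ N)
    (hle : h ^ N + ((N:ℝ) - 1) * k ^ N ≤ N * (h * k ^ (N - 1))) : h = k := by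
  obtain ⟨n, rfl⟩ : ∃ n, N = n + 2 := ⟨N - 2, by omega⟩
  have hy := young_pow (N := n + 1) hh hk (by omega)
  simp only [Nat.add_sub_cancel, show n + 2 - 1 = n + 1 from rfl] at hle hy
  push_cast at hle hy
  have h1 := mul_le_mul_of_nonneg_left hy hh
  have h2 : ((n:ℝ) + 1) * k ^ n * (h - k) ^ 2 ≤ 0 := by
    have e1 : h * h ^ (n + 1) = h ^ (n + 2) := by ring
    have e2 : ((n:ℝ) + 1) * k ^ n * (h - k) ^ 2 =
      (n + 1) * (h * (h * k ^ n)) + (n + 1) * k ^ (n + 2) - 2 * (n + 1) * (h * k ^ (n + 1)) := by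
      ring
    nlinarith
  have h3 : 0 ≤ ((n:ℝ) + 1) * k ^ n * (h - k) ^ 2 := by positivity
  have h4 := le_antisymm h2 h3
  rcases hk.eq_or_lt with rfl | hk'
  · have : h ^ (n + 2) ≤ 0 := by simpa using hle
    exact (pow_eq_zero_iff (by omega)).1 (le_antisymm this (pow_nonneg hh _))
  · have : (h - k) ^ 2 = 0 := by
      rcases mul_eq_zero.1 h4 with h5 | h5
      · exact absurd h5 (by positivity)
      · exact h5
    linarith [pow_eq_zero_iff (two_ne_zero) |>.1 this]

theorem WulffProfile.antitoneOn_levelRadius (hU : WulffProfile N H R U) (hH : IsFinslerNorm N H) :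
    AntitoneOn (levelRadius N H U) (Ici 0) := fun s hs t _ hst => by
  have hκ := hH.wulffVol_pos
  refine Real.rpow_le_rpow (by positivity) ?_ (by positivity)
  gcongr
  exact hU.volume_superlevel_ne_top hH hs

theorem WulffProfile.levelRadius_le (hU : WulffProfile N H R U) (hH : IsFinslerNorm N H)
    (hN : N ≠ 0) (hR : 0 < R) {t : ℝ} (ht : 0 ≤ t) : levelRadius N H U t ≤ R := by
  have hκ := hH.wulffVol_pos
  have h1 := WulffProfile.wulffVol_mul_levelRadius_pow hH hN U t
  have h2 : volume.real {x | t < U x} ≤ wulffVol N H * R ^ N := by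
    have := ENNReal.toReal_mono (hH.volume_ball_ne_top R) (measure_mono (hU.superlevel_subset ht))
    rwa [hH.volume_ball hR, ENNReal.toReal_ofReal (by positivity)] at this
  rw [← h1] at h2
  exact le_of_pow_le_pow_left₀ hN hR.le (le_of_mul_le_mul_left h2 hκ)

/-- The integrated form of Talenti's differential inequality. -/
theorem RadialMajorant.sub_mul_le (hM : RadialMajorant N H R p U F ω)
    (hU : LaneEmdenProfile N H R p U) (hH : IsFinslerNorm N H) (hreg : FinslerRegular N H)
    (hN : 2 ≤ N) (hp : 0 < p) {α β : ℝ} (hα : 0 ≤ α) (hαβ : α < β)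
    (hA : 0 < levelRadius N H U α) :
    (β - α) * (N * levelRadius N H U β ^ (N - 1) - levelRadius N H U α ^ (N - 1)) * N ≤
      ((N:ℝ) - 1) * ω (levelRadius N H U α) *
        (levelRadius N H U α ^ N - levelRadius N H U β ^ N) := by
  have hP := hU.toWulffProfile
  have hκ := hH.wulffVol_pos
  have hN0 : N ≠ 0 := by omega
  have hN1 : (1:ℝ) ≤ N := by exact_mod_cast (by omega : 1 ≤ N)
  set A := levelRadius N H U α
  set B := levelRadius N H U β
  set κ := wulffVol N H
  set k := ω A with hk
  have hk0 : 0 < k := hM.slope_pos A hA.ne'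
  have hB0 : 0 ≤ B := WulffProfile.levelRadius_nonneg U β
  have hBA : B ≤ A := hP.antitoneOn_levelRadius hH hα (hα.trans hαβ.le) hαβ.le
  have hV := WulffProfile.wulffVol_mul_levelRadius_pow hH hN0 U α
  have hVβ := WulffProfile.wulffVol_mul_levelRadius_pow hH hN0 U β
  have hmul : κ * A ^ N - κ * B ^ N = κ * (A ^ N - B ^ N) := by ring
  have hABN : B ^ N ≤ A ^ N := pow_le_pow_left₀ hB0 hBA N
  have key : ∀ η, 0 < η → 3 * η < β - α → 0 ≤ N * B ^ (N - 1) - A ^ (N - 1) →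
      (β - α - 3 * η) * (N * B ^ (N - 1) - A ^ (N - 1)) * N ≤ (N - 1) * k * (A ^ N - B ^ N) := by
    intro η hη hη3 hcoef
    obtain ⟨g, hgc, hg0, hg1, hgα, hgβ, hγ⟩ := exists_bump hη hη3
    set γ := ∫ t in α..β, g t with hγd
    have hαη : 0 < α + η := by linarith
    set Ω : Set (Euc N) := {x | dualNorm H x < R}
    have iX : IntegrableOn (fun x => H (gradient U x) * g (U x)) Ω :=
      hP.integrableOn_energy_comp hH (Φ := fun y => y) continuous_id hgc hαη hgα
    have iY : IntegrableOn (fun x => H (gradient U x) ^ N * g (U x)) Ω :=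
      hP.integrableOn_energy_comp hH (Φ := fun y => y ^ N) (continuous_pow N) hgc hαη hgα
    have iZ : IntegrableOn (fun x => g (U x)) Ω := hP.integrableOn_comp hH hgc.continuousOn
    have hγ0 : 0 ≤ γ := intervalIntegral.integral_nonneg hαβ.le fun t _ => hg0 t
    -- lower bound for the weighted perimeter
    have hX : N * κ * B ^ (N - 1) * γ ≤ ∫ x in Ω, H (gradient U x) * g (U x) := by
      have h1 := hP.isoperimetric hH hN hgc hg0 hαη hgα
      rw [← ofReal_integral_eq_lintegral_ofReal iX
        (Eventually.of_forall fun x => mul_nonneg (hH.nonneg _) (hg0 _))] at h1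
      have h2 : ENNReal.ofReal (N * κ * B ^ (N - 1)) * ENNReal.ofReal γ ≤
          ∫⁻ t in Ioi 0, ENNReal.ofReal (N * κ * levelRadius N H U t ^ (N - 1)) *
            ENNReal.ofReal (g t) := by
        rw [hγd, intervalIntegral.integral_of_le hαβ.le, ofReal_integral_eq_lintegral_ofReal
          ((hgc.intervalIntegrable α β).1) (Eventually.of_forall hg0), ← lintegral_const_mul _
          (by fun_prop)]
        refine (lintegral_mono_set (fun t ht => lt_of_le_of_lt hα ht.1 : Ioc α β ⊆ Ioi 0)).trans
          (setLIntegral_mono_ae' measurableSet_Ioi (Eventually.of_forall fun t ht => ?_))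
        rcases le_or_gt β t with hβt | htβ
        · simp [hgβ t hβt]
        · gcongr
          exact hP.antitoneOn_levelRadius hH (mem_Ici.2 (mem_Ioi.1 ht).le) (hα.trans hαβ.le) htβ.le
      have h3 := h2.trans h1
      rw [← ENNReal.ofReal_mul (by positivity)] at h3
      refine (ENNReal.ofReal_le_ofReal_iff (integral_nonneg fun x => ?_)).1 h3
      exact mul_nonneg (hH.nonneg _) (hg0 _)
    have hsub : {x | α < U x} ⊆ Ω := hP.superlevel_subset hα
    have hm : MeasurableSet {x | α < U x} := (hP.isOpen_superlevel α).measurableSet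
    have hmβ : MeasurableSet {x | β < U x} := (hP.isOpen_superlevel β).measurableSet
    have hY : ∫ x in Ω, H (gradient U x) ^ N * g (U x) ≤ N * κ * (A * k) ^ (N - 1) * γ := by
      rw [hP.integral_energy_comp hH hreg hN hU.weak hgc hαη hgα]
      have hgi := fun a b => hgc.intervalIntegrable (μ := volume) a b
      have hG : ∀ y, ∫ s in (0:ℝ)..y, g s ≤ γ := by
        intro y
        have hmono : Monotone fun y => ∫ s in (0:ℝ)..y, g s := monotone_primitive hgc hg0
        have e0 : ∫ s in (0:ℝ)..α, g s = 0 := primitive_eq_zero hα (fun t ht =>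
          hgα t (by linarith)) le_rfl
        have e1 : ∫ s in (0:ℝ)..(max y β), g s = γ := by
          rw [← intervalIntegral.integral_add_adjacent_intervals (hgi 0 α) (hgi _ _), e0, zero_add,
            ← intervalIntegral.integral_add_adjacent_intervals (hgi α β) (hgi _ _),
            intervalIntegral.integral_congr (a := β) (g := fun _ => (0:ℝ)),
            intervalIntegral.integral_zero, add_zero]
          intro s hs
          rw [uIcc_of_le (le_max_right _ _)] at hs
          exact hgβ s hs.1
        rw [← e1]; exact hmono (le_max_left _ _)
      have hle := hM.mass_le α hα
      rw [← hV, ← hM.flux A hA.le] at hle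
      calc ∫ x in Ω, U x ^ p * ∫ s in (0:ℝ)..U x, g s
          = ∫ x in {x | α < U x}, U x ^ p * ∫ s in (0:ℝ)..U x, g s := by
            refine setIntegral_eq_of_subset_of_forall_sdiff_eq_zero
              (hH.isOpen_ball R).measurableSet hsub fun x hx => ?_
            have hx2 : U x ≤ α := not_lt.1 hx.2
            rw [primitive_eq_zero hα (fun t ht => hgα t (by linarith)) hx2, mul_zero]
        _ ≤ ∫ x in {x | α < U x}, U x ^ p * γ := by
            have hr := (hP.integrableOn_rpow hH hp).mono_set hsub
            refine integral_mono_of_nonneg (Eventually.of_forall fun x => mul_nonneg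
              (Real.rpow_nonneg (hP.nonneg x) _) ?_) (hr.mul_const γ)
              (Eventually.of_forall fun x => ?_)
            · exact intervalIntegral.integral_nonneg (hP.nonneg x) fun s _ => hg0 s
            · exact mul_le_mul_of_nonneg_left (hG _) (Real.rpow_nonneg (hP.nonneg x) _)
        _ = (∫ x in {x | α < U x}, U x ^ p) * γ := integral_mul_const _ _
        _ ≤ _ := mul_le_mul_of_nonneg_right hle hγ0
    have hZ : ∫ x in Ω, g (U x) ≤ κ * (A ^ N - B ^ N) := by
      have hfin := hP.volume_superlevel_ne_top hH hα
      have hsd : {x | β < U x} ⊆ {x | α < U x} := fun x (hx : β < U x) => hαβ.trans hx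
      calc ∫ x in Ω, g (U x) = ∫ x in {x | α < U x} \ {x | β < U x}, g (U x) := by
            refine setIntegral_eq_of_subset_of_forall_sdiff_eq_zero
              (hH.isOpen_ball R).measurableSet (sdiff_subset.trans hsub) fun x hx => ?_
            by_cases h : α < U x
            · have : β < U x := by
                by_contra h'
                exact hx.2 ⟨h, h'⟩
              exact hgβ _ this.le
            · exact hgα _ (by linarith [not_lt.1 h])
        _ ≤ ∫ x in {x | α < U x} \ {x | β < U x}, (1:ℝ) := by
            refine integral_mono_of_nonneg (Eventually.of_forall fun x => hg0 _)
              (integrableOn_const (measure_ne_top_of_subset sdiff_subset hfin))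
              (Eventually.of_forall fun x => hg1 _)
        _ = volume.real ({x | α < U x} \ {x | β < U x}) := by simp
        _ = κ * A ^ N - κ * B ^ N := by
            rw [hV, hVβ, measureReal_sdiff hsd hmβ hfin]
        _ = _ := hmul
    have hYoung : N * (∫ x in Ω, H (gradient U x) * g (U x)) * k ^ (N - 1) ≤
        (∫ x in Ω, H (gradient U x) ^ N * g (U x)) + (N - 1) * k ^ N * ∫ x in Ω, g (U x) := by
      rw [mul_right_comm, ← integral_const_mul, ← integral_const_mul,
        ← integral_add iY (iZ.const_mul _)]
      refine integral_mono (iX.const_mul _) (iY.add (iZ.const_mul _)) fun x => ?_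
      have := mul_le_mul_of_nonneg_right (young_pow (hH.nonneg (gradient U x)) hk0.le
        (by omega : 1 ≤ N)) (hg0 (U x))
      simp only
      linarith
    have hkN : k ^ N = k * k ^ (N - 1) := by
      rw [← pow_succ']; congr 1; omega
    have hfinal : N * (N * κ * B ^ (N - 1) * γ) * k ^ (N - 1) ≤
        N * κ * (A * k) ^ (N - 1) * γ + (N - 1) * k ^ N * (κ * (A ^ N - B ^ N)) := by
      have h1 := mul_le_mul_of_nonneg_right (mul_le_mul_of_nonneg_left hX (by positivity : (0:ℝ) ≤ N))
        (pow_nonneg hk0.le (N - 1))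
      have h2 := mul_le_mul_of_nonneg_left hZ (mul_nonneg (sub_nonneg.2 hN1) (pow_nonneg hk0.le N))
      linarith
    rw [hkN, mul_pow] at hfinal
    have hpos : 0 < κ * k ^ (N - 1) := by positivity
    have h5 : γ * (N * B ^ (N - 1) - A ^ (N - 1)) * N ≤ (N - 1) * k * (A ^ N - B ^ N) := by
      refine le_of_mul_le_mul_right ?_ hpos
      linarith
    refine le_trans ?_ h5
    gcongr
  rcases le_or_gt 0 (N * B ^ (N - 1) - A ^ (N - 1)) with hc | hc
  · have ht : Tendsto (fun η : ℝ => (β - α - 3 * η) * (N * B ^ (N - 1) - A ^ (N - 1)) * N)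
        (𝓝[>] 0) (𝓝 ((β - α - 3 * 0) * (N * B ^ (N - 1) - A ^ (N - 1)) * N)) :=
      (Continuous.tendsto (by fun_prop) 0).mono_left nhdsWithin_le_nhds
    rw [mul_zero, sub_zero] at ht
    refine le_of_tendsto ht ?_
    have : Ioo (0:ℝ) ((β - α) / 3) ∈ 𝓝[>] (0:ℝ) := Ioo_mem_nhdsGT (by linarith)
    filter_upwards [this] with η hη
    exact key η hη.1 (by linarith [hη.2]) hc
  · have h1 : (β - α) * (N * B ^ (N - 1) - A ^ (N - 1)) * N ≤ 0 :=
      mul_nonpos_of_nonpos_of_nonneg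
        (mul_nonpos_of_nonneg_of_nonpos (by linarith) hc.le) (by linarith)
    refine h1.trans (mul_nonneg (mul_nonneg (by linarith) hk0.le) (by linarith))

end

section

variable {N : ℕ} {H : Euc N → ℝ} {R p : ℝ} {U : Euc N → ℝ} {F ω : ℝ → ℝ}

theorem setOf_lt_eq_iUnion {X : Type*} (f : X → ℝ) (t : ℝ) :
    {x | t < f x} = ⋃ n : ℕ, {x | t + 1 / ((n:ℝ) + 1) < f x} := by
  ext x
  simp only [Set.mem_ofPred_eq, mem_iUnion]
  constructor
  · intro h
    obtain ⟨n, hn⟩ := exists_nat_one_div_lt (sub_pos.2 h)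
    exact ⟨n, by linarith⟩
  · rintro ⟨n, hn⟩
    have : (0:ℝ) < 1 / ((n:ℝ) + 1) := by positivity
    linarith

theorem monotone_setOf_lt {X : Type*} (f : X → ℝ) (t : ℝ) :
    Monotone fun n : ℕ => {x | t + 1 / ((n:ℝ) + 1) < f x} := fun m n hmn x hx => by
  have h1 : t + 1 / ((m:ℝ) + 1) < f x := hx
  have h2 : 1 / ((n:ℝ) + 1) ≤ 1 / ((m:ℝ) + 1) :=
    one_div_le_one_div_of_le (by positivity) (by gcongr)
  show t + 1 / ((n:ℝ) + 1) < f x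
  linarith

theorem WulffProfile.tendsto_levelRadius (hU : WulffProfile N H R U) (hH : IsFinslerNorm N H)
    {α : ℝ} (hα : 0 ≤ α) :
    Tendsto (levelRadius N H U) (𝓝[>] α) (𝓝 (levelRadius N H U α)) := by
  have hseq : Tendsto (fun n : ℕ => levelRadius N H U (α + 1 / ((n:ℝ) + 1))) atTop
      (𝓝 (levelRadius N H U α)) := by
    have h1 := tendsto_measure_iUnion_atTop (μ := volume) (monotone_setOf_lt U α)
    rw [← setOf_lt_eq_iUnion] at h1
    have h2 := (ENNReal.tendsto_toReal (hU.volume_superlevel_ne_top hH hα)).comp h1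
    exact (h2.div_const _).rpow_const (Or.inr (by positivity))
  have hanti := hU.antitoneOn_levelRadius hH
  refine tendsto_order.2 ⟨fun c hc => ?_, fun c hc => ?_⟩
  · obtain ⟨n, hn⟩ := ((tendsto_order.1 hseq).1 c hc).exists
    have hpos : (0:ℝ) < 1 / ((n:ℝ) + 1) := by positivity
    have : Ioo α (α + 1 / ((n:ℝ) + 1)) ∈ 𝓝[>] α := Ioo_mem_nhdsGT (by linarith)
    filter_upwards [this] with β hβ
    exact hn.trans_le (hanti (hα.trans hβ.1.le) (mem_Ici.2 (by linarith)) hβ.2.le)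
  · filter_upwards [self_mem_nhdsWithin] with β hβ
    exact (hanti hα (hα.trans (le_of_lt hβ)) (le_of_lt hβ)).trans_lt hc

namespace RadialMajorant

theorem antitone_potential (hM : RadialMajorant N H R p U F ω) :
    Antitone fun r => ∫ s in r..R, ω s := antitone_integral_left hM.cont hM.slope_nonneg R

theorem strictAntiOn_potential (hM : RadialMajorant N H R p U F ω) :
    StrictAntiOn (fun r => ∫ s in r..R, ω s) (Ici 0) := fun r hr s _ hrs => by
  have h := integral_left_sub hM.cont R r s
  have : 0 < ∫ x in r..s, ω x := intervalIntegral.intervalIntegral_pos_of_pos_on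
    (hM.cont.intervalIntegrable _ _) (fun x hx => hM.slope_pos x
      (lt_of_le_of_lt (mem_Ici.1 hr) hx.1).ne') hrs
  simp only
  linarith

theorem eventually_le_potential_sub (hM : RadialMajorant N H R p U F ω)
    (hU : LaneEmdenProfile N H R p U) (hH : IsFinslerNorm N H) (hreg : FinslerRegular N H)
    (hN : 2 ≤ N) (hp : 0 < p) {α c : ℝ} (hα : 0 ≤ α) (hA : 0 < levelRadius N H U α)
    (hc0 : 0 < c) (hc : c < 1) :
    ∀ᶠ β in 𝓝[>] α, c ^ 2 * (β - α) ≤ (∫ s in levelRadius N H U β..R, ω s) -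
      ∫ s in levelRadius N H U α..R, ω s := by
  have hN2 : (2:ℝ) ≤ N := by exact_mod_cast hN
  have hlim := hU.toWulffProfile.tendsto_levelRadius hH hα
  have hanti := hU.toWulffProfile.antitoneOn_levelRadius hH
  have hk0 : 0 < ω (levelRadius N H U α) := hM.slope_pos _ hA.ne'
  have hωev : ∀ᶠ r in 𝓝 (levelRadius N H U α), c * ω (levelRadius N H U α) < ω r :=
    (tendsto_order.1 (hM.cont.tendsto _)).1 _ (by nlinarith)
  obtain ⟨δ, hδ, hωδ⟩ := Metric.eventually_nhds_iff.1 hωev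
  have h1 : ∀ᶠ β in 𝓝[>] α, levelRadius N H U α - δ < levelRadius N H U β :=
    (tendsto_order.1 hlim).1 _ (by linarith)
  have h2 : ∀ᶠ β in 𝓝[>] α, c * ((N:ℝ) - 1) * levelRadius N H U α ^ (N - 1) <
      N * levelRadius N H U β ^ (N - 1) - levelRadius N H U α ^ (N - 1) := by
    refine (tendsto_order.1 (((hlim.pow (N - 1)).const_mul (N:ℝ)).sub_const _)).1 _ ?_
    have : 0 < levelRadius N H U α ^ (N - 1) := by positivity
    have h3 : 0 < (1 - c) * ((N:ℝ) - 1) * levelRadius N H U α ^ (N - 1) :=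
      mul_pos (mul_pos (by linarith) (by linarith)) this
    linarith
  filter_upwards [h1, h2, self_mem_nhdsWithin] with β h1 h2 hβ
  have hβ' : α < β := hβ
  have hle := hM.sub_mul_le hU hH hreg hN hp hα hβ' hA
  have hBA := hanti hα (mem_Ici.2 (hα.trans hβ'.le)) hβ'.le
  have hB0 := WulffProfile.levelRadius_nonneg (N := N) (H := H) U β
  set A := levelRadius N H U α
  set B := levelRadius N H U β
  have hpow : A ^ N - B ^ N ≤ N * A ^ (N - 1) * (A - B) := by
    have hb := one_add_mul_le_pow (a := B / A - 1) (by
      have : 0 ≤ B / A := by positivity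
      linarith) N
    rw [add_sub_cancel, div_pow, le_div_iff₀ (by positivity)] at hb
    have hAN : A ^ N = A * A ^ (N - 1) := by
      rw [← pow_succ']; congr 1; omega
    have : (1 + (N:ℝ) * (B / A - 1)) * A ^ N = A ^ N + N * A ^ (N - 1) * (B - A) := by
      rw [hAN]; field_simp
    linarith
  have hAn : 0 < A ^ (N - 1) := by positivity
  have h5 : c * (β - α) ≤ ω A * (A - B) := by
    have e1 := mul_le_mul_of_nonneg_left h2.le (mul_nonneg (sub_nonneg.2 hβ'.le)
      (by linarith : (0:ℝ) ≤ N))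
    have e2 := mul_le_mul_of_nonneg_left hpow
      (mul_nonneg (by linarith : (0:ℝ) ≤ (N:ℝ) - 1) hk0.le)
    have hpos : 0 < N * ((N:ℝ) - 1) * A ^ (N - 1) := by
      have : (0:ℝ) < (N:ℝ) - 1 := by linarith
      positivity
    refine le_of_mul_le_mul_left ?_ hpos
    linarith
  rw [integral_left_sub hM.cont]
  have h6 : ∫ _ in B..A, c * ω A ≤ ∫ s in B..A, ω s := by
    refine intervalIntegral.integral_mono_on hBA (by simp) (hM.cont.intervalIntegrable _ _)
      fun r hr => (hωδ ?_).le
    rw [Real.dist_eq, abs_lt]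
    exact ⟨by linarith [hr.1], by linarith [hr.2]⟩
  rw [intervalIntegral.integral_const, smul_eq_mul] at h6
  nlinarith

theorem le_potential_levelRadius (hM : RadialMajorant N H R p U F ω)
    (hU : LaneEmdenProfile N H R p U) (hH : IsFinslerNorm N H) (hreg : FinslerRegular N H)
    (hN : 2 ≤ N) (hp : 0 < p) (hR : 0 < R) {τ : ℝ} (hτ : 0 ≤ τ)
    (hτr : 0 < levelRadius N H U τ) :
    τ ≤ ∫ s in levelRadius N H U τ..R, ω s := by
  have hanti := hU.toWulffProfile.antitoneOn_levelRadius hH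
  have key : ∀ c : ℝ, 0 < c → c < 1 → c ^ 2 * τ ≤ ∫ s in levelRadius N H U τ..R, ω s := by
    intro c hc0 hc
    set S : Set ℝ := {t | t ∈ Icc 0 τ ∧ c ^ 2 * t ≤ ∫ s in levelRadius N H U t..R, ω s} with hS
    have h0 : (0:ℝ) ∈ S := by
      refine ⟨⟨le_rfl, hτ⟩, ?_⟩
      rw [mul_zero]
      exact hM.potential_nonneg (hU.toWulffProfile.levelRadius_le hH (by omega) hR le_rfl)
    have hbdd : BddAbove S := ⟨τ, fun t ht => ht.1.2⟩
    set σ := sSup S with hσ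
    have hσ0 : 0 ≤ σ := le_csSup hbdd h0
    have hσS : σ ∈ S := by
      refine ⟨⟨hσ0, csSup_le ⟨0, h0⟩ fun t ht => ht.1.2⟩, ?_⟩
      rw [← le_div_iff₀' (by positivity)]
      refine csSup_le ⟨0, h0⟩ fun t ht => ?_
      rw [le_div_iff₀' (by positivity)]
      exact ht.2.trans (hM.antitone_potential (hanti ht.1.1 hσ0 (le_csSup hbdd ht)))
    rcases hσS.1.2.eq_or_lt with h | h
    · rw [← h]; exact hσS.2
    · exfalso
      have hev := hM.eventually_le_potential_sub hU hH hreg hN hp hσ0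
        (hτr.trans_le (hanti hσ0 hτ h.le)) hc0 hc
      obtain ⟨β, hβ1, hβ2⟩ := (hev.and (Ioo_mem_nhdsGT h)).exists
      have : β ∈ S := ⟨⟨hσ0.trans hβ2.1.le, hβ2.2.le⟩, by
        have := hσS.2
        linarith⟩
      exact absurd (le_csSup hbdd this) (not_le.2 hβ2.1)
  have ht : Tendsto (fun c : ℝ => c ^ 2 * τ) (𝓝[<] 1) (𝓝 (1 ^ 2 * τ)) :=
    (Continuous.tendsto (by fun_prop) 1).mono_left nhdsWithin_le_nhds
  rw [one_pow, one_mul] at ht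
  refine le_of_tendsto ht ?_
  filter_upwards [Ioo_mem_nhdsLT (zero_lt_one (α := ℝ))] with c hc
  exact key c hc.1 hc.2

end RadialMajorant

end

section

theorem measure_superlevel_eq_of_lintegral_rpow_le {X : Type*} [MeasurableSpace X] (μ : Measure X)
    {f g : X → ℝ} (hf : AEMeasurable f μ) (hg : AEMeasurable g μ) (hf0 : 0 ≤ᵐ[μ] f)
    (hg0 : 0 ≤ᵐ[μ] g) {q : ℝ} (hq : 0 < q)
    (hfin : ∫⁻ x, ENNReal.ofReal (f x ^ q) ∂μ ≠ ⊤)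
    (hle : ∫⁻ x, ENNReal.ofReal (g x ^ q) ∂μ ≤ ∫⁻ x, ENNReal.ofReal (f x ^ q) ∂μ)
    (hfg : ∀ t, 0 ≤ t → μ {x | t < f x} ≤ μ {x | t < g x}) {t : ℝ} (ht : 0 ≤ t) :
    μ {x | t < f x} = μ {x | t < g x} := by
  have hq' : ENNReal.ofReal q ≠ 0 := by simpa using hq
  have hmf : Antitone fun t => μ {x | t < f x} := fun s t hst =>
    measure_mono fun x (hx : t < f x) => hst.trans_lt hx
  have hmg : Antitone fun t => μ {x | t < g x} := fun s t hst =>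
    measure_mono fun x (hx : t < g x) => hst.trans_lt hx
  rw [lintegral_rpow_eq_lintegral_meas_lt_mul μ hf0 hf hq] at hfin hle
  rw [lintegral_rpow_eq_lintegral_meas_lt_mul μ hg0 hg hq] at hle
  have hle' := (ENNReal.mul_le_mul_iff_right hq' ENNReal.ofReal_ne_top).1 hle
  have hfin' : ∫⁻ t in Ioi 0, μ {x | t < f x} * ENNReal.ofReal (t ^ (q - 1)) ≠ ⊤ := fun h =>
    hfin (by rw [h, ENNReal.mul_top hq'])
  have hae := ae_eq_of_ae_le_of_lintegral_le (μ := volume.restrict (Ioi (0:ℝ)))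
    (f := fun t => μ {x | t < f x} * ENNReal.ofReal (t ^ (q - 1)))
    (g := fun t => μ {x | t < g x} * ENNReal.ofReal (t ^ (q - 1)))
    ((ae_restrict_iff' measurableSet_Ioi).2 (Eventually.of_forall fun t (ht : 0 < t) =>
      mul_le_mul' (hfg t ht.le) le_rfl)) hfin'
    (hmg.measurable.mul (by fun_prop)).aemeasurable hle'
  rw [EventuallyEq, ae_restrict_iff' measurableSet_Ioi] at hae
  refine le_antisymm (hfg t ht) ?_
  rw [setOf_lt_eq_iUnion g t, (monotone_setOf_lt g t).directed_le.measure_iUnion]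
  refine iSup_le fun n => ?_
  have hpos : (0:ℝ) < 1 / ((n:ℝ) + 1) := by positivity
  obtain ⟨s, hs, hsm⟩ : ∃ s, s ∈ Ioo t (t + 1 / ((n:ℝ) + 1)) ∧
      (s ∈ Ioi 0 → μ {x | s < f x} * ENNReal.ofReal (s ^ (q - 1)) =
        μ {x | s < g x} * ENNReal.ofReal (s ^ (q - 1))) := by
    have hnull : volume (Ioo t (t + 1 / ((n:ℝ) + 1))) ≠ 0 := by
      simp only [Real.volume_Ioo, ne_eq, ENNReal.ofReal_eq_zero, not_le]
      linarith
    have hfreq : ∃ᵐ s, s ∈ Ioo t (t + 1 / ((n:ℝ) + 1)) := frequently_ae_mem_iff.2 hnull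
    exact (hfreq.and_eventually hae).exists
  have hs0 : 0 < s := ht.trans_lt hs.1
  have hsp : ENNReal.ofReal (s ^ (q - 1)) ≠ 0 := by
    simpa using Real.rpow_pos_of_pos hs0 _
  have := (ENNReal.mul_left_inj hsp ENNReal.ofReal_ne_top).1 (hsm hs0)
  exact (hmg hs.2.le).trans (this.symm.le.trans (hmf hs.1.le))

theorem map_eq_of_measure_superlevel_eq {X : Type*} [MeasurableSpace X] (μ : Measure X)
    [IsFiniteMeasure μ] {f g : X → ℝ} (hf : AEMeasurable f μ) (hg : AEMeasurable g μ)
    (hf0 : ∀ᵐ x ∂μ, 0 ≤ f x) (hg0 : ∀ᵐ x ∂μ, 0 ≤ g x)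
    (hfg : ∀ t, 0 ≤ t → μ {x | t < f x} = μ {x | t < g x}) :
    μ.map f = μ.map g := by
  refine Measure.ext_of_Iic _ _ fun a => ?_
  rw [Measure.map_apply_of_aemeasurable hf measurableSet_Iic,
    Measure.map_apply_of_aemeasurable hg measurableSet_Iic]
  rcases lt_or_ge a 0 with ha | ha
  · have h : ∀ h : X → ℝ, (∀ᵐ x ∂μ, 0 ≤ h x) → μ (h ⁻¹' Iic a) = 0 := fun h h0 => by
      rw [measure_eq_zero_iff_ae_notMem]
      filter_upwards [h0] with x hx
      simpa using ha.trans_le hx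
    rw [h f hf0, h g hg0]
  · have h : ∀ h : X → ℝ, AEMeasurable h μ → μ (h ⁻¹' Iic a) = μ univ - μ {x | a < h x} := by
      intro h hm
      have e : h ⁻¹' Iic a = {x | a < h x}ᶜ := by
        ext x; simp
      have hn : NullMeasurableSet {x | a < h x} μ := hm.nullMeasurable measurableSet_Ioi
      rw [e, measure_compl₀ hn (measure_ne_top _ _)]
    rw [h f hf, h g hg, hfg a ha]

variable {N : ℕ} {H : Euc N → ℝ} {R p : ℝ} {U : Euc N → ℝ} {F ω : ℝ → ℝ}

namespace RadialMajorant

theorem continuous_radial (hM : RadialMajorant N H R p U F ω) (hH : IsFinslerNorm N H) :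
    Continuous fun x => ∫ s in dualNorm H x..R, ω s :=
  (continuous_integral_left hM.cont R).comp hH.continuous_dualNorm

theorem volume_superlevel_le (hM : RadialMajorant N H R p U F ω)
    (hU : LaneEmdenProfile N H R p U) (hH : IsFinslerNorm N H) (hreg : FinslerRegular N H)
    (hN : 2 ≤ N) (hp : 0 < p) (hR : 0 < R) {τ : ℝ} (hτ : 0 ≤ τ) :
    volume {x | τ < U x} ≤ volume {x | τ < ∫ s in dualNorm H x..R, ω s} := by
  have hN0 : N ≠ 0 := by omega
  have hr0 := WulffProfile.levelRadius_nonneg (N := N) (H := H) U τ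
  rw [hU.toWulffProfile.volume_superlevel hH hN0 hτ]
  rcases hr0.eq_or_lt with h | h
  · rw [← h]; simp [hN0]
  · rw [← hH.volume_ball h]
    refine measure_mono fun x (hx : dualNorm H x < levelRadius N H U τ) => ?_
    exact (hM.le_potential_levelRadius hU hH hreg hN hp hR hτ h).trans_lt
      (hM.strictAntiOn_potential (hH.dualNorm_nonneg x) hr0 hx)

theorem restrict_superlevel_eq (hM : RadialMajorant N H R p U F ω)
    (hU : LaneEmdenProfile N H R p U) (hH : IsFinslerNorm N H) (hreg : FinslerRegular N H)
    (hN : 2 ≤ N) (hp : 1 < p) (hR : 0 < R) {τ : ℝ} (hτ : 0 ≤ τ) :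
    volume.restrict {x | dualNorm H x < R} {x | τ < U x} =
      volume.restrict {x | dualNorm H x < R} {x | τ < ∫ s in dualNorm H x..R, ω s} := by
  have hp0 : 0 < p := by linarith
  have hq : 0 < p + 1 := by linarith
  have hP := hU.toWulffProfile
  have hΩm : MeasurableSet {x | dualNorm H x < R} := (hH.isOpen_ball R).measurableSet
  have hwc := hM.continuous_radial hH
  have hw0 : ∀ᵐ x ∂(volume.restrict {x | dualNorm H x < R}),
      0 ≤ ∫ s in dualNorm H x..R, ω s :=
    (ae_restrict_iff' hΩm).2 (Eventually.of_forall fun x (hx : dualNorm H x < R) =>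
      hM.potential_nonneg hx.le)
  have iU := hP.integrableOn_rpow hH hq
  have iw : IntegrableOn (fun x => (∫ s in dualNorm H x..R, ω s) ^ (p + 1))
      {x | dualNorm H x < R} :=
    hH.integrableOn_comp (Θ := fun r => (∫ s in r..R, ω s) ^ (p + 1))
      ((continuous_integral_left hM.cont R).rpow_const fun _ => Or.inr hq.le)
  have hab := hM.norm_le hU hH hreg hN hp hR
  refine measure_superlevel_eq_of_lintegral_rpow_le _ hP.cont.aemeasurable hwc.aemeasurable
    (Eventually.of_forall hP.nonneg) hw0 hq ?_ ?_ ?_ hτ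
  · rw [← ofReal_integral_eq_lintegral_ofReal iU
      (Eventually.of_forall fun x => Real.rpow_nonneg (hP.nonneg x) _)]
    exact ENNReal.ofReal_ne_top
  · rw [← ofReal_integral_eq_lintegral_ofReal iU
      (Eventually.of_forall fun x => Real.rpow_nonneg (hP.nonneg x) _),
      ← ofReal_integral_eq_lintegral_ofReal iw (hw0.mono fun x hx => Real.rpow_nonneg hx _)]
    exact ENNReal.ofReal_le_ofReal hab
  · intro t ht
    have h1 : {x | t < U x} ⊆ {x | dualNorm H x < R} := hP.superlevel_subset ht
    have h2 : {x | t < ∫ s in dualNorm H x..R, ω s} ⊆ {x | dualNorm H x < R} := by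
      intro x (hx : t < ∫ s in dualNorm H x..R, ω s)
      show dualNorm H x < R
      by_contra! h
      have := hM.antitone_potential h
      simp only [intervalIntegral.integral_same] at this
      linarith
    rw [Measure.restrict_eq_self _ h1, Measure.restrict_eq_self _ h2]
    exact hM.volume_superlevel_le hU hH hreg hN hp0 hR ht

theorem integral_comp_eq (hM : RadialMajorant N H R p U F ω)
    (hU : LaneEmdenProfile N H R p U) (hH : IsFinslerNorm N H) (hreg : FinslerRegular N H)
    (hN : 2 ≤ N) (hp : 1 < p) (hR : 0 < R) {Θ : ℝ → ℝ} (hΘ : Continuous Θ) :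
    ∫ x in {x | dualNorm H x < R}, Θ (U x) =
      ∫ x in {x | dualNorm H x < R}, Θ (∫ s in dualNorm H x..R, ω s) := by
  have hP := hU.toWulffProfile
  have hwc := hM.continuous_radial hH
  have : IsFiniteMeasure (volume.restrict {x | dualNorm H x < R}) :=
    isFiniteMeasure_restrict.2 (hH.volume_ball_ne_top R)
  have hw0 : ∀ᵐ x ∂(volume.restrict {x | dualNorm H x < R}),
      0 ≤ ∫ s in dualNorm H x..R, ω s :=
    (ae_restrict_iff' (hH.isOpen_ball R).measurableSet).2
      (Eventually.of_forall fun x (hx : dualNorm H x < R) => hM.potential_nonneg hx.le)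
  have h := map_eq_of_measure_superlevel_eq (volume.restrict {x | dualNorm H x < R})
    hP.cont.aemeasurable hwc.aemeasurable (Eventually.of_forall hP.nonneg) hw0
    fun t ht => hM.restrict_superlevel_eq hU hH hreg hN hp hR ht
  rw [← integral_map (f := Θ) hP.cont.aemeasurable hΘ.aestronglyMeasurable, h,
    integral_map hwc.aemeasurable hΘ.aestronglyMeasurable]

theorem levelRadius_potential (hM : RadialMajorant N H R p U F ω)
    (hU : LaneEmdenProfile N H R p U) (hH : IsFinslerNorm N H) (hreg : FinslerRegular N H)
    (hN : 2 ≤ N) (hp : 1 < p) {r : ℝ} (hr : 0 < r) (hrR : r ≤ R) :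
    levelRadius N H U (∫ s in r..R, ω s) = r := by
  have hR : 0 < R := hr.trans_le hrR
  have hP := hU.toWulffProfile
  have hκ := hH.wulffVol_pos
  have hτ := hM.potential_nonneg hrR
  have h := hM.restrict_superlevel_eq hU hH hreg hN hp hR hτ
  have h2 : {x | ∫ s in r..R, ω s < ∫ s in dualNorm H x..R, ω s} = {x | dualNorm H x < r} := by
    ext x
    exact hM.strictAntiOn_potential.lt_iff_gt hr.le (hH.dualNorm_nonneg x)
  have h3 : {x | dualNorm H x < r} ⊆ {x | dualNorm H x < R} :=
    fun x (hx : dualNorm H x < r) => hx.trans_le hrR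
  rw [h2, Measure.restrict_eq_self _ (hP.superlevel_subset hτ), Measure.restrict_eq_self _ h3,
    hP.volume_superlevel hH (by omega) hτ, hH.volume_ball hr,
    ENNReal.ofReal_eq_ofReal_iff (mul_nonneg hκ.le
      (pow_nonneg (WulffProfile.levelRadius_nonneg U _) _)) (by positivity)] at h
  exact (pow_left_inj₀ (WulffProfile.levelRadius_nonneg U _) hr.le (by omega)).1
    (mul_left_cancel₀ (ne_of_gt hκ) h)

/-- The maximum of `U` equals the maximum of its symmetrization. -/
theorem le_potential_zero (hM : RadialMajorant N H R p U F ω)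
    (hU : LaneEmdenProfile N H R p U) (hH : IsFinslerNorm N H) (hreg : FinslerRegular N H)
    (hN : 2 ≤ N) (hp : 1 < p) (hR : 0 < R) (x : Euc N) : U x ≤ ∫ s in (0:ℝ)..R, ω s := by
  have hP := hU.toWulffProfile
  by_contra! hx
  have h0 := hM.potential_nonneg hR.le
  have h := hM.restrict_superlevel_eq hU hH hreg hN hp hR h0
  have h2 : {x | ∫ s in (0:ℝ)..R, ω s < ∫ s in dualNorm H x..R, ω s} = ∅ := by
    ext x
    simp only [Set.mem_ofPred_eq, mem_empty_iff_false, iff_false, not_lt]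
    exact hM.antitone_potential (hH.dualNorm_nonneg x)
  rw [h2, measure_empty, Measure.restrict_eq_self _ (hP.superlevel_subset h0)] at h
  exact (IsOpen.measure_pos volume (hP.isOpen_superlevel _) ⟨x, hx⟩).ne' h

end RadialMajorant

end

section

variable {N : ℕ} {H : Euc N → ℝ} {R p : ℝ} {U : Euc N → ℝ} {F ω : ℝ → ℝ}

namespace RadialMajorant

/-- A continuous inverse of the potential on `[0, R]`. -/
theorem exists_inverse (hM : RadialMajorant N H R p U F ω) :
    ∃ V : ℝ → ℝ, Continuous V ∧ (∀ t, 0 ≤ V t) ∧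
      ∀ r ∈ Icc 0 R, V (∫ s in r..R, ω s) = r := by
  have hc : Continuous fun r : Icc (0:ℝ) R => ∫ s in (r:ℝ)..R, ω s :=
    (continuous_integral_left hM.cont R).comp continuous_subtype_val
  have hinj : Function.Injective fun r : Icc (0:ℝ) R => ∫ s in (r:ℝ)..R, ω s := fun r s hrs =>
    Subtype.ext (hM.strictAntiOn_potential.injOn r.2.1 s.2.1 hrs)
  obtain ⟨V, hV0, hV⟩ := ContinuousMap.exists_extension_forall_mem_of_isClosedEmbedding
    (⟨fun r => (r:ℝ), continuous_subtype_val⟩ : C(Icc (0:ℝ) R, ℝ)) (t := Ici (0:ℝ))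
    (fun r => r.2.1) ⟨0, mem_Ici.2 le_rfl⟩ (hc.isClosedEmbedding hinj)
  exact ⟨V, V.continuous, hV0, fun r hr => congrFun hV ⟨r, hr⟩⟩

/-- The gradient of the solution at a level `W r` has the size of the radial slope `ω r`. -/
theorem gradient_eq (hM : RadialMajorant N H R p U F ω)
    (hU : LaneEmdenProfile N H R p U) (hH : IsFinslerNorm N H) (hreg : FinslerRegular N H)
    (hN : 2 ≤ N) (hp : 1 < p) (hR : 0 < R) {x : Euc N} (hx : dualNorm H x < R) {r : ℝ}
    (hr : r ∈ Icc 0 R) (hxr : U x = ∫ s in r..R, ω s) : H (gradient U x) = ω r := by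
  have hp0 : 0 < p := by linarith
  have hq : 0 < p + 1 := by linarith
  have hP := hU.toWulffProfile
  have hN1 : (1:ℝ) ≤ N := by exact_mod_cast (by omega : 1 ≤ N)
  have hκ := hH.wulffVol_pos
  obtain ⟨V, hVc, hV0, hVW⟩ := hM.exists_inverse
  set Ω : Set (Euc N) := {x | dualNorm H x < R} with hΩ
  have hΩm : MeasurableSet Ω := (hH.isOpen_ball R).measurableSet
  set T := ∫ s in (0:ℝ)..R, ω s with hT
  have hWc := continuous_integral_left hM.cont R
  set k : ℝ → ℝ := fun t => ω (V t) with hk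
  have hkc : Continuous k := hM.cont.comp hVc
  have hk0 : ∀ t, 0 ≤ k t := fun t => hM.slope_nonneg _
  set Ψ : ℝ → ℝ := fun t => N * wulffVol N H * V t ^ (N - 1) * k t ^ (N - 1) with hΨ
  have hΨc : Continuous Ψ := (continuous_const.mul (hVc.pow _)).mul (hkc.pow _)
  have hΨ0 : ∀ t, 0 ≤ Ψ t := fun t =>
    mul_nonneg (mul_nonneg (by positivity) (pow_nonneg (hV0 t) _)) (pow_nonneg (hk0 t) _)
  set a := ∫ x in Ω, U x ^ (p + 1) with ha
  set e := ∫ x in Ω, ω (dualNorm H x) ^ N with he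
  have hba : ∫ x in Ω, (∫ s in dualNorm H x..R, ω s) ^ (p + 1) = a :=
    (hM.integral_comp_eq hU hH hreg hN hp hR (Θ := fun t => t ^ (p + 1))
      (Real.continuous_rpow_const hq.le)).symm
  have hae : a ≤ e := by
    have h1 := energyInf_mul_le_of_radial (R := R) hH hreg hN hp hM.cont hM.slope_nonneg
    rw [hba] at h1
    exact hU.energy_le.trans h1
  have hea : e ≤ a := by
    have h1 := hM.energy_le hP hH hN hp0 hR one_pos
    rw [hba, Real.one_rpow] at h1
    refine h1.trans (le_of_eq ?_)
    rw [← hΩ, ← ha]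
    field_simp
  have heΨ : e = ∫ t in (0:ℝ)..T, Ψ t := by
    have h1 := integral_slope_mul_comp (R := R) hM.cont hΨc 0 R
    rw [intervalIntegral.integral_same] at h1
    rw [← h1, he, hH.integral_radial (by omega) hR (Θ := fun r => ω r ^ N) (hM.cont.pow N)]
    refine intervalIntegral.integral_congr fun s hs => ?_
    rw [uIcc_of_le hR.le] at hs
    simp only [hΨ, hk, hVW s hs]
    obtain ⟨n, rfl⟩ : ∃ n, N = n + 1 := ⟨N - 1, by omega⟩
    simp only [Nat.add_sub_cancel, pow_succ]
    ring
  have hZk : ∫ x in Ω, k (U x) ^ N = e := by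
    rw [hM.integral_comp_eq hU hH hreg hN hp hR (Θ := fun t => k t ^ N) (hkc.pow N)]
    refine setIntegral_congr_fun hΩm fun y (hy : dualNorm H y < R) => ?_
    simp only [hk]
    rw [hVW _ ⟨hH.dualNorm_nonneg y, hy.le⟩]
  set B : Euc N → ℝ := fun x => H (gradient U x) ^ N + ((N:ℝ) - 1) * k (U x) ^ N -
    N * (H (gradient U x) * k (U x) ^ (N - 1)) with hB
  have hB0 : ∀ x, 0 ≤ B x := fun x =>
    sub_nonneg.2 (young_pow (hH.nonneg _) (hk0 _) (by omega))
  have hBg : ∀ ε, 0 < ε → ∀ g : ℝ → ℝ, Continuous g → (∀ t, 0 ≤ g t) → (∀ t, g t ≤ 1) →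
      (∀ t ≤ ε, g t = 0) → IntegrableOn (fun x => B x * g (U x)) Ω ∧
      ((∀ t, ε + ε ≤ t → g t = 1) → ε + ε ≤ T →
        ∫ x in Ω, B x * g (U x) ≤ N * ∫ t in (0:ℝ)..(ε + ε), Ψ t) := by
    intro ε hε g hgc hg0 hg1 hgz
    have hg'c : Continuous fun t => k t ^ (N - 1) * g t := (hkc.pow _).mul hgc
    have hg'0 : ∀ t, 0 ≤ k t ^ (N - 1) * g t := fun t => mul_nonneg (pow_nonneg (hk0 t) _) (hg0 t)
    have hg'z : ∀ t ≤ ε, k t ^ (N - 1) * g t = 0 := fun t ht => by rw [hgz t ht, mul_zero]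
    have iY : IntegrableOn (fun x => H (gradient U x) ^ N * g (U x)) Ω :=
      hP.integrableOn_energy_comp hH (Φ := fun y => y ^ N) (continuous_pow N) hgc hε hgz
    have iX : IntegrableOn (fun x => H (gradient U x) * (k (U x) ^ (N - 1) * g (U x))) Ω :=
      hP.integrableOn_energy_comp hH (Φ := fun y => y) continuous_id hg'c hε hg'z
    have ik : IntegrableOn (fun x => k (U x) ^ N) Ω :=
      hP.integrableOn_comp hH (Θ := fun t => k t ^ N) (hkc.pow N).continuousOn
    have iZ : IntegrableOn (fun x => k (U x) ^ N * g (U x)) Ω :=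
      hP.integrableOn_comp hH (Θ := fun t => k t ^ N * g t) ((hkc.pow N).mul hgc).continuousOn
    have hsplit : (fun x => B x * g (U x)) = fun x => (H (gradient U x) ^ N * g (U x) +
        ((N:ℝ) - 1) * (k (U x) ^ N * g (U x))) -
        N * (H (gradient U x) * (k (U x) ^ (N - 1) * g (U x))) := by
      ext x; simp only [hB]; ring
    refine ⟨?_, fun hgo hεT => ?_⟩
    · rw [hsplit]
      exact (iY.add (iZ.const_mul _)).sub (iX.const_mul _)
    have hY : ∫ x in Ω, H (gradient U x) ^ N * g (U x) ≤ a := by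
      rw [hP.integral_energy_comp hH hreg hN hU.weak hgc hε hgz]
      refine integral_mono_of_nonneg (Eventually.of_forall fun x => mul_nonneg
        (Real.rpow_nonneg (hP.nonneg x) _)
        (intervalIntegral.integral_nonneg (hP.nonneg x) fun s _ => hg0 s))
        (hP.integrableOn_rpow hH hq) (Eventually.of_forall fun x => ?_)
      simp only
      rw [Real.rpow_add' (hP.nonneg x) hq.ne', Real.rpow_one]
      refine mul_le_mul_of_nonneg_left ?_ (Real.rpow_nonneg (hP.nonneg x) _)
      calc ∫ s in (0:ℝ)..U x, g s ≤ ∫ _ in (0:ℝ)..U x, (1:ℝ) :=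
            intervalIntegral.integral_mono_on (hP.nonneg x) (hgc.intervalIntegrable _ _)
              (by simp) fun s _ => hg1 s
        _ = U x := by simp
    have hZ : ∫ x in Ω, k (U x) ^ N * g (U x) ≤ a := by
      refine le_trans (integral_mono iZ ik fun x => ?_) (hZk.le.trans hea)
      exact mul_le_of_le_one_right (pow_nonneg (hk0 _) _) (hg1 _)
    have hX : (∫ t in (0:ℝ)..T, Ψ t) - ∫ t in (0:ℝ)..(ε + ε), Ψ t ≤
        ∫ x in Ω, H (gradient U x) * (k (U x) ^ (N - 1) * g (U x)) := by
      have h1 := hP.isoperimetric hH hN hg'c hg'0 hε hg'z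
      rw [← ofReal_integral_eq_lintegral_ofReal iX
        (Eventually.of_forall fun x => mul_nonneg (hH.nonneg _) (hg'0 _))] at h1
      have hii := fun a b => hΨc.intervalIntegrable (μ := volume) a b
      rw [intervalIntegral.integral_interval_sub_left (hii _ _) (hii _ _),
        intervalIntegral.integral_of_le hεT, integral_Ioc_eq_integral_Ioo]
      refine (ENNReal.ofReal_le_ofReal_iff (integral_nonneg fun x =>
        mul_nonneg (hH.nonneg _) (hg'0 _))).1 (le_trans ?_ h1)
      rw [ofReal_integral_eq_lintegral_ofReal ((hii (ε + ε) T).1.mono_set Ioo_subset_Ioc_self)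
        (Eventually.of_forall hΨ0)]
      refine (setLIntegral_mono_ae' measurableSet_Ioo (Eventually.of_forall fun t ht => ?_)).trans
        (lintegral_mono_set (fun t ht => mem_Ioi.2 (by linarith [ht.1]) : Ioo (ε + ε) T ⊆ Ioi 0))
      obtain ⟨s, hs, hst⟩ := intermediate_value_Ioo' hR.le hWc.continuousOn
        (show t ∈ Ioo (∫ s in R..R, ω s) (∫ s in (0:ℝ)..R, ω s) by
          rw [intervalIntegral.integral_same]; exact ⟨by linarith [ht.1], ht.2⟩)
      have hlr := hM.levelRadius_potential hU hH hreg hN hp hs.1 hs.2.le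
      have hVt := hVW s ⟨hs.1.le, hs.2.le⟩
      simp only at hst
      rw [hst] at hlr hVt
      have hs0 := hs.1
      rw [hlr, ← ENNReal.ofReal_mul (by positivity), hgo t ht.1.le, mul_one]
      simp only [hΨ, hVt]
      exact le_rfl
    have hi : IntegrableOn (fun x => H (gradient U x) ^ N * g (U x) +
        ((N:ℝ) - 1) * (k (U x) ^ N * g (U x))) Ω := iY.add (iZ.const_mul _)
    rw [hsplit, integral_sub hi (iX.const_mul _),
      integral_add iY (iZ.const_mul _), integral_const_mul, integral_const_mul]
    have h1 := mul_le_mul_of_nonneg_left hZ (sub_nonneg.2 hN1)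
    have h2 := mul_le_mul_of_nonneg_left hX (by linarith : (0:ℝ) ≤ N)
    have h3 := mul_le_mul_of_nonneg_left (hae.trans heΨ.le) (by linarith : (0:ℝ) ≤ N)
    linarith
  have hUx : 0 < U x := hP.pos x hx
  have hUT : U x ≤ T := hM.le_potential_zero hU hH hreg hN hp hR x
  obtain ⟨g, hgc, hg0, hg1, hgz, hgo⟩ := exists_cutoff (a := U x / 2) (half_pos hUx)
  have hint := (hBg (U x / 2) (half_pos hUx) g hgc hg0 hg1 hgz).1
  have hle0 : ∫ x in Ω, B x * g (U x) ≤ 0 := by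
    have hprim : Tendsto (fun ε : ℝ => N * ∫ t in (0:ℝ)..(ε + ε), Ψ t) (𝓝[>] 0)
        (𝓝 (N * ∫ t in (0:ℝ)..(0 + 0), Ψ t)) := by
      have hc : Continuous fun y => ∫ t in (0:ℝ)..y, Ψ t :=
        continuous_iff_continuousAt.2 fun y => (hasDerivAt_primitive hΨc y).continuousAt
      exact (Continuous.tendsto (continuous_const.mul (hc.comp (continuous_id.add continuous_id)))
        0).mono_left nhdsWithin_le_nhds
    rw [add_zero, intervalIntegral.integral_same, mul_zero] at hprim
    refine ge_of_tendsto hprim ?_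
    filter_upwards [Ioo_mem_nhdsGT (by linarith : (0:ℝ) < U x / 4)] with ε hε
    obtain ⟨g', hgc', hg0', hg1', hgz', hgo'⟩ := exists_cutoff (a := ε) hε.1
    obtain ⟨hi, hle⟩ := hBg ε hε.1 g' hgc' hg0' hg1' hgz'
    refine le_trans (integral_mono hint hi fun y => ?_) (hle hgo' (by linarith [hε.2]))
    refine mul_le_mul_of_nonneg_left ?_ (hB0 y)
    rcases le_total (U y) (U x / 2) with h | h
    · rw [hgz _ h]; exact hg0' _
    · rw [hgo' _ (by linarith [hε.2])]; exact hg1 _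
  have hnn : 0 ≤ᵐ[volume.restrict Ω] fun x => B x * g (U x) :=
    Eventually.of_forall fun x => mul_nonneg (hB0 x) (hg0 _)
  have hz := (integral_eq_zero_iff_of_nonneg_ae hnn hint).1
    (le_antisymm hle0 (integral_nonneg fun x => mul_nonneg (hB0 x) (hg0 _)))
  have hgrad : ContinuousOn (fun x => H (gradient U x)) Ω :=
    hH.continuous.comp_continuousOn (hP.continuousOn_gradient hH)
  have hkU : Continuous fun x => k (U x) := hkc.comp hP.cont
  have hcont : ContinuousOn (fun x => B x * g (U x)) Ω :=
    (((hgrad.pow N).add (continuous_const.mul (hkU.pow N)).continuousOn).sub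
      (continuousOn_const.mul (hgrad.mul (hkU.pow (N - 1)).continuousOn))).mul
      (hgc.comp hP.cont).continuousOn
  have heq := Measure.eqOn_open_of_ae_eq hz (hH.isOpen_ball R) hcont continuousOn_const hx
  simp only [Pi.zero_apply] at heq
  rw [hgo (U x) (by linarith), mul_one] at heq
  have h := eq_of_young_pow_le (hH.nonneg (gradient U x)) (hk0 (U x)) hN (by
    have : B x ≤ 0 := heq.le
    simp only [hB] at this
    linarith)
  rw [h, hxr]
  simp only [hk]
  rw [hVW r hr]

end RadialMajorant

end

section

variable {N : ℕ} {H : Euc N → ℝ} {R p : ℝ} {U : Euc N → ℝ} {F ω : ℝ → ℝ}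

namespace RadialMajorant

/-- Comparison of the solution with its symmetrization along rays. -/
theorem le_potential (hM : RadialMajorant N H R p U F ω)
    (hU : LaneEmdenProfile N H R p U) (hH : IsFinslerNorm N H) (hreg : FinslerRegular N H)
    (hN : 2 ≤ N) (hp : 1 < p) {x : Euc N} (hx : dualNorm H x < R) (hx0 : x ≠ 0) :
    U x ≤ ∫ s in dualNorm H x..R, ω s := by
  have hP := hU.toWulffProfile
  have hr : 0 < dualNorm H x := hH.dualNorm_pos hx0
  have hR : 0 < R := hr.trans hx
  set r := dualNorm H x with hrd
  set y : Euc N := r⁻¹ • x with hy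
  have hKy : dualNorm H y = 1 := by
    rw [hy, hH.dualNorm_smul, abs_of_pos (inv_pos.2 hr), ← hrd, inv_mul_cancel₀ hr.ne']
  have hKs : ∀ s, 0 ≤ R - s → dualNorm H ((R - s) • y) = R - s := fun s hs => by
    rw [hH.dualNorm_smul, abs_of_nonneg hs, hKy, mul_one]
  have hWc := continuous_integral_left hM.cont R
  have hfc : Continuous fun s : ℝ => U ((R - s) • y) :=
    hP.cont.comp ((continuous_const.sub continuous_id).smul continuous_const)
  have hf0 : U ((R - 0) • y) = 0 := hP.eq_zero _ (by
    show ¬ dualNorm H _ < R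
    rw [hKs 0 (by linarith)]; simp)
  have key : ∀ ε, 0 < ε → (1 + ε) * (R - r) + ε < R →
      U x ≤ ∫ s in (R - (1 + ε) * (R - r) - ε)..R, ω s := by
    intro ε hε hεr
    set B : ℝ → ℝ := fun s => ∫ t in (R - (1 + ε) * s - ε)..R, ω t with hB
    have hBd : ∀ s, HasDerivAt B ((1 + ε) * ω (R - (1 + ε) * s - ε)) s := by
      intro s
      have h1 : HasDerivAt (fun s : ℝ => R - (1 + ε) * s - ε) (-(1 + ε)) s := by
        simpa using (((hasDerivAt_id s).const_mul (1 + ε)).const_sub R).sub_const ε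
      refine ((hasDerivAt_integral_left hM.cont R _).comp s h1).congr_deriv ?_
      ring
    have hB0 : U ((R - 0) • y) < B 0 := by
      rw [hf0]
      have h := hM.strictAntiOn_potential (R := R) (mem_Ici.2 (by nlinarith : 0 ≤ R - ε))
        (mem_Ici.2 hR.le) (by linarith)
      simpa [hB] using h
    have hBc : Continuous B := continuous_iff_continuousAt.2 fun s => (hBd s).continuousAt
    have hev : ∀ᶠ s in 𝓝[>] (0:ℝ), U ((R - s) • y) < B s :=
      ((hfc.tendsto 0).eventually_lt (hBc.tendsto 0) hB0).filter_mono nhdsWithin_le_nhds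
    obtain ⟨s₀, hs₀, hs₀r⟩ := (hev.and (Ioo_mem_nhdsGT (sub_pos.2 hx))).exists
    have hmain := image_le_of_deriv_right_lt_deriv_boundary (a := s₀) (b := R - r)
      (f := fun s => U ((R - s) • y)) (f' := fun s => ⟪gradient U ((R - s) • y), -y⟫)
      hfc.continuousOn (fun s hs => ?_) hs₀.le hBd (fun s hs hseq => ?_)
    · have := hmain (right_mem_Icc.2 hs₀r.2.le)
      have e : (R - (R - r)) • y = x := by
        rw [hy, sub_sub_cancel, smul_smul, mul_inv_cancel₀ hr.ne', one_smul]
      simp only [hB] at this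
      rwa [e] at this
    · have hs' : s < R := by linarith [hs.2]
      have hin : dualNorm H ((R - s) • y) < R := by
        rw [hKs s (by linarith)]; linarith [hs.1, hs₀r.1]
      have hd := (hP.differentiableAt hH hin).hasGradientAt
      have hl : HasDerivAt (fun s : ℝ => (R - s) • y) (-y) s := by
        simpa using ((hasDerivAt_id s).const_sub R).smul_const y
      have := hd.hasFDerivAt.comp_hasDerivAt s hl
      refine HasDerivAt.hasDerivWithinAt ?_
      simpa using! this
    · have hs' : s < R := by linarith [hs.2]
      have hin : dualNorm H ((R - s) • y) < R := by
        rw [hKs s (by linarith)]; linarith [hs.1, hs₀r.1]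
      have harg : 0 < R - (1 + ε) * s - ε := by
        have := mul_lt_mul_of_pos_left hs.2 (by linarith : 0 < 1 + ε)
        linarith
      have hs0 : 0 < s := hs₀r.1.trans_le hs.1
      have hg := hM.gradient_eq hU hH hreg hN hp hR hin (r := R - (1 + ε) * s - ε)
        ⟨harg.le, by nlinarith⟩ hseq
      have hω := hM.slope_pos _ harg.ne'
      calc ⟪gradient U ((R - s) • y), -y⟫ = ⟪-y, gradient U ((R - s) • y)⟫ := real_inner_comm _ _
        _ ≤ dualNorm H (-y) * H (gradient U ((R - s) • y)) := hH.inner_le _ _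
        _ = ω (R - (1 + ε) * s - ε) := by rw [hH.dualNorm_neg, hKy, one_mul, hg]
        _ < (1 + ε) * ω (R - (1 + ε) * s - ε) := by nlinarith
  have hlim : Tendsto (fun ε : ℝ => ∫ s in (R - (1 + ε) * (R - r) - ε)..R, ω s) (𝓝[>] 0)
      (𝓝 (∫ s in (R - (1 + 0) * (R - r) - 0)..R, ω s)) :=
    (Continuous.tendsto (hWc.comp (by fun_prop :
      Continuous fun ε : ℝ => R - (1 + ε) * (R - r) - ε)) 0).mono_left nhdsWithin_le_nhds
  rw [show R - (1 + 0) * (R - r) - 0 = r by ring] at hlim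
  refine ge_of_tendsto hlim ?_
  have hpos : 0 < r / (R - r + 1) := div_pos hr (by linarith)
  filter_upwards [Ioo_mem_nhdsGT hpos] with ε hε
  have := hε.2
  rw [lt_div_iff₀ (by linarith)] at this
  exact key ε hε.1 (by linarith)

theorem slope_le (hM : RadialMajorant N H R p U F ω) (hH : IsFinslerNorm N H) (hN : 2 ≤ N)
    {r : ℝ} (hr : 0 < r) :
    ω r ≤ ((∫ x in {x | dualNorm H x < R}, U x ^ p) / (N * wulffVol N H)) ^
      (1 / ((N:ℝ) - 1)) * r⁻¹ := by
  have hκ := hH.wulffVol_pos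
  have hN1 : (0:ℝ) < (N:ℝ) - 1 := by
    have : (2:ℝ) ≤ N := by exact_mod_cast hN
    linarith
  have hN0 : (0:ℝ) < N := by linarith
  have h1 := hM.flux r hr.le
  have h2 := hM.le_mass (wulffVol N H * r ^ N) (by positivity)
  rw [← h1] at h2
  have hω := hM.slope_nonneg r
  have hrω : 0 ≤ r * ω r := mul_nonneg hr.le hω
  rw [← div_eq_mul_inv, le_div_iff₀ hr, mul_comm (ω r)]
  have e : r * ω r = ((r * ω r) ^ (N - 1)) ^ (1 / ((N:ℝ) - 1)) := by
    rw [← Real.rpow_natCast, ← Real.rpow_mul hrω, Nat.cast_sub (by omega), Nat.cast_one,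
      mul_one_div_cancel hN1.ne', Real.rpow_one]
  rw [e]
  refine Real.rpow_le_rpow (by positivity) ?_ (by positivity)
  rw [le_div_iff₀ (by positivity)]
  linarith

theorem potential_le (hM : RadialMajorant N H R p U F ω) (hH : IsFinslerNorm N H) (hN : 2 ≤ N)
    {r : ℝ} (hr : 0 < r) (hrR : r ≤ R) :
    ∫ s in r..R, ω s ≤ ((∫ x in {x | dualNorm H x < R}, U x ^ p) / (N * wulffVol N H)) ^
      (1 / ((N:ℝ) - 1)) * log (R / r) := by
  have hR : 0 < R := hr.trans_le hrR
  rw [← integral_inv_of_pos hr hR, ← intervalIntegral.integral_const_mul]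
  have h0 : (0:ℝ) ∉ uIcc r R := by
    rw [uIcc_of_le hrR]
    exact fun h => absurd h.1 (not_le.2 hr)
  refine intervalIntegral.integral_mono_on hrR (hM.cont.intervalIntegrable _ _)
    ((intervalIntegral.intervalIntegrable_inv (fun x hx h => h0 (h ▸ hx))
      continuousOn_id).const_mul _) fun s hs => hM.slope_le hH hN (hr.trans_le hs.1)

end RadialMajorant

/-- The logarithmic upper bound for least energy solutions in the Wulff ball. -/
theorem LaneEmdenProfile.le_log (hU : LaneEmdenProfile N H R p U) (hH : IsFinslerNorm N H)
    (hreg : FinslerRegular N H) (hN : 2 ≤ N) (hp : 1 < p) {x : Euc N} (hx : dualNorm H x < R)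
    (hx0 : x ≠ 0) :
    U x ≤ ((∫ x in {x | dualNorm H x < R}, U x ^ p) / (N * wulffVol N H)) ^
      (1 / ((N:ℝ) - 1)) * log (R / dualNorm H x) := by
  have hp0 : 0 < p := by linarith
  have hr := hH.dualNorm_pos hx0
  have hR : 0 < R := hr.trans hx
  have hP := hU.toWulffProfile
  obtain ⟨S, hS⟩ : ∃ S, ∀ x, U x ^ p ≤ S := by
    have hc := hP.continuous_rpow hp0
    obtain ⟨S, hS⟩ := (hH.isCompact_closedBall R).bddAbove_image hc.continuousOn
    refine ⟨max S 0, fun x => ?_⟩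
    by_cases hx : dualNorm H x < R
    · exact le_max_of_le_left (hS ⟨x, hx.le, rfl⟩)
    · rw [hP.eq_zero x hx, Real.zero_rpow hp0.ne']; exact le_max_right _ _
  have hM := hP.radialMajorant hH hN hp0 hR hS
  exact (hM.le_potential hU hH hreg hN hp hx hx0).trans (hM.potential_le hH hN hr hx.le)

end

section

variable {N : ℕ} {H : Euc N → ℝ} {R p : ℝ} {U : Euc N → ℝ}

theorem energyInf_nonneg (hH : IsFinslerNorm N H) (Ω : Set (Euc N)) (p : ℝ) :
    0 ≤ energyInf N H Ω p := by
  refine Real.sInf_nonneg ?_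
  rintro _ ⟨u, -, -, -, -, rfl⟩
  exact integral_nonneg fun x => pow_nonneg (hH.nonneg _) N

/-- Testing the least energy with truncated logarithms. -/
theorem energyInf_mul_log_le (hH : IsFinslerNorm N H) (hreg : FinslerRegular N H)
    (hN : 2 ≤ N) (hp : 1 < p) {ε : ℝ} (hε : 0 < ε) (hεR : ε < R) :
    energyInf N H {x | dualNorm H x < R} p * (wulffVol N H * ε ^ N) ^ ((N : ℝ) / (p + 1)) *
        (∫ s in ε..R, (|s| + ε)⁻¹) ^ N ≤
      N * wulffVol N H * ((∫ s in ε..R, (|s| + ε)⁻¹) + 1) := by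
  have hR : 0 < R := hε.trans hεR
  have hκ := hH.wulffVol_pos
  have hq : 0 < p + 1 := by linarith
  set ω : ℝ → ℝ := fun s => (|s| + ε)⁻¹ with hω
  have hden : ∀ s : ℝ, 0 < |s| + ε := fun s => by positivity
  have hωc : Continuous ω := (continuous_abs.add continuous_const).inv₀ fun s => (hden s).ne'
  have hω0 : ∀ s, 0 ≤ ω s := fun s => (inv_pos.2 (hden s)).le
  set B := ∫ s in ε..R, ω s with hB
  have hB0 : 0 ≤ B := intervalIntegral.integral_nonneg hεR.le fun s _ => hω0 s
  have key := energyInf_mul_le_of_radial hH hreg hN hp hωc hω0 (R := R)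
  have hWc := continuous_integral_left hωc R
  have hlow : wulffVol N H * ε ^ N * B ^ (p + 1) ≤
      ∫ x in {x | dualNorm H x < R}, (∫ s in dualNorm H x..R, ω s) ^ (p + 1) := by
    have hsub : {x | dualNorm H x < ε} ⊆ {x | dualNorm H x < R} :=
      fun x (hx : dualNorm H x < ε) => hx.trans hεR
    have hi : IntegrableOn (fun x => (∫ s in dualNorm H x..R, ω s) ^ (p + 1))
        {x | dualNorm H x < R} :=
      hH.integrableOn_comp (Θ := fun r => (∫ s in r..R, ω s) ^ (p + 1))
        (hWc.rpow_const fun _ => Or.inr hq.le)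
    have hnn : 0 ≤ᵐ[volume.restrict {x | dualNorm H x < R}]
        fun x => (∫ s in dualNorm H x..R, ω s) ^ (p + 1) := by
      filter_upwards [ae_restrict_mem (hH.isOpen_ball R).measurableSet] with x hx
      exact Real.rpow_nonneg (intervalIntegral.integral_nonneg (le_of_lt hx) fun s _ => hω0 s) _
    refine le_trans ?_ (setIntegral_mono_set hi hnn (Eventually.of_forall hsub))
    have hv : volume.real {x | dualNorm H x < ε} = wulffVol N H * ε ^ N := by
      rw [Measure.real, hH.volume_ball hε, ENNReal.toReal_ofReal (by positivity)]
    rw [← hv, ← smul_eq_mul, ← setIntegral_const]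
    refine setIntegral_mono_on (integrableOn_const (hH.volume_ball_ne_top ε)) (hi.mono_set hsub)
      (hH.isOpen_ball ε).measurableSet fun x hx => ?_
    exact Real.rpow_le_rpow hB0 (antitone_integral_left hωc hω0 R (le_of_lt hx)) hq.le
  have hup : ∫ x in {x | dualNorm H x < R}, ω (dualNorm H x) ^ N ≤
      N * wulffVol N H * (B + 1) := by
    rw [hH.integral_radial (by omega) hR (Θ := fun r => ω r ^ N) (hωc.pow N)]
    have h1 : ∫ r in (0:ℝ)..R, N * wulffVol N H * r ^ (N - 1) * ω r ^ N ≤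
        ∫ r in (0:ℝ)..R, N * wulffVol N H * ω r := by
      refine intervalIntegral.integral_mono_on hR.le
        (Continuous.intervalIntegrable (by fun_prop) _ _)
        (Continuous.intervalIntegrable (by fun_prop) _ _) fun r hr => ?_
      have e : ω r ^ N = ω r ^ (N - 1) * ω r := by
        rw [← pow_succ, Nat.sub_add_cancel (by omega)]
      have h2 : r ^ (N - 1) * ω r ^ (N - 1) ≤ 1 := by
        rw [← mul_pow]
        refine pow_le_one₀ (mul_nonneg hr.1 (hω0 r)) ?_
        rw [hω]
        simp only
        rw [← div_eq_mul_inv, div_le_one (hden r), abs_of_nonneg hr.1]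
        linarith
      calc N * wulffVol N H * r ^ (N - 1) * ω r ^ N
          = N * wulffVol N H * ω r * (r ^ (N - 1) * ω r ^ (N - 1)) := by rw [e]; ring
        _ ≤ N * wulffVol N H * ω r * 1 := by
            have := hω0 r
            gcongr
        _ = _ := mul_one _
    refine h1.trans ?_
    rw [intervalIntegral.integral_const_mul]
    refine mul_le_mul_of_nonneg_left ?_ (by positivity)
    have h3 := integral_left_sub hωc R 0 ε
    have h4 : ∫ s in (0:ℝ)..ε, ω s ≤ ∫ s in (0:ℝ)..ε, ε⁻¹ := by
      refine intervalIntegral.integral_mono_on hε.le (hωc.intervalIntegrable _ _)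
        (by simp) fun s hs => ?_
      exact inv_anti₀ hε (by have := abs_nonneg s; linarith)
    rw [intervalIntegral.integral_const, sub_zero, smul_eq_mul, mul_inv_cancel₀ hε.ne'] at h4
    linarith
  refine le_trans ?_ (key.trans hup)
  rw [mul_assoc]
  refine mul_le_mul_of_nonneg_left ?_ (energyInf_nonneg hH _ p)
  have e : B ^ N = (B ^ (p + 1)) ^ ((N : ℝ) / (p + 1)) := by
    rw [← Real.rpow_mul hB0, mul_div_cancel₀ _ hq.ne', Real.rpow_natCast]
  rw [e, ← Real.mul_rpow (by positivity) (by positivity)]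
  exact Real.rpow_le_rpow (by positivity) hlow (by positivity)

/-- The least energy level tends to zero as the exponent tends to infinity. -/
theorem tendsto_energyInf (hH : IsFinslerNorm N H) (hreg : FinslerRegular N H) (hN : 2 ≤ N)
    (hR : 0 < R) : Tendsto (energyInf N H {x | dualNorm H x < R}) atTop (𝓝 0) := by
  have hκ := hH.wulffVol_pos
  have hN0 : (0:ℝ) < N := by exact_mod_cast (by omega : 0 < N)
  refine Metric.tendsto_atTop'.2 fun δ hδ => ?_
  set A : ℝ := N * wulffVol N H with hA
  have hA0 : 0 < A := by positivity
  set L : ℝ := 1 + 4 * A / δ + 1 with hL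
  have hL2 : 2 ≤ L := by have : 0 < 4 * A / δ := by positivity
                         linarith
  obtain ⟨ε, hε, hεR, hBL⟩ : ∃ ε, 0 < ε ∧ ε < R ∧ L ≤ ∫ s in ε..R, (|s| + ε)⁻¹ := by
    have hε : 0 < R * exp (-(2 * L)) := by positivity
    have hεR : R * exp (-(2 * L)) < R := by
      have : exp (-(2 * L)) < 1 := by
        rw [← Real.exp_zero]
        exact Real.exp_lt_exp.2 (by linarith)
      nlinarith
    refine ⟨_, hε, hεR, ?_⟩
    set ε := R * exp (-(2 * L)) with hεd
    have h0 : (0:ℝ) ∉ uIcc ε R := by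
      rw [uIcc_of_le hεR.le]
      exact fun h => absurd h.1 (not_le.2 hε)
    have h1 : L = ∫ s in ε..R, 2⁻¹ * s⁻¹ := by
      rw [intervalIntegral.integral_const_mul, integral_inv_of_pos hε hR, hεd,
        Real.log_div hR.ne' hε.ne', Real.log_mul hR.ne' (exp_pos _).ne', Real.log_exp]
      ring
    rw [h1]
    have hc : Continuous fun s : ℝ => (|s| + ε)⁻¹ :=
      (continuous_abs.add continuous_const).inv₀ fun s =>
        (add_pos_of_nonneg_of_pos (abs_nonneg s) hε).ne'
    refine intervalIntegral.integral_mono_on hεR.le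
      ((intervalIntegral.intervalIntegrable_inv (fun x hx h => h0 (h ▸ hx))
        continuousOn_id).const_mul _) (hc.intervalIntegrable _ _) fun s hs => ?_
    have hs0 : 0 < s := hε.trans_le hs.1
    rw [← mul_inv, abs_of_pos hs0]
    exact inv_anti₀ (by linarith) (by linarith [hs.1])
  set B := ∫ s in ε..R, (|s| + ε)⁻¹ with hB
  have hB2 : 2 ≤ B := hL2.trans hBL
  have hlim : Tendsto (fun p : ℝ => (wulffVol N H * ε ^ N) ^ ((N : ℝ) / (p + 1))) atTop (𝓝 1) := by
    have h1 : Tendsto (fun p : ℝ => (N : ℝ) / (p + 1)) atTop (𝓝 0) :=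
      tendsto_const_nhds.div_atTop (tendsto_atTop_add_const_right _ _ tendsto_id)
    have h2 : 0 < wulffVol N H * ε ^ N := by positivity
    have := (Real.continuous_const_rpow h2.ne').tendsto 0 |>.comp h1
    simpa using! this
  obtain ⟨p₀, hp₀⟩ := eventually_atTop.1 ((hlim.eventually_const_lt
    (by norm_num : (2:ℝ)⁻¹ < 1)).and (eventually_gt_atTop 1))
  refine ⟨p₀, fun p hp => ?_⟩
  obtain ⟨hV, hp1⟩ := hp₀ p hp.le
  have hC := energyInf_nonneg hH {x | dualNorm H x < R} p
  rw [Real.dist_eq, sub_zero, abs_of_nonneg hC]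
  have key := energyInf_mul_log_le hH hreg hN hp1 hε hεR
  rw [← hB, ← hA] at key
  set C := energyInf N H {x | dualNorm H x < R} p
  have hBN : B ^ 2 ≤ B ^ N := pow_le_pow_right₀ (by linarith) hN
  have h1 : C * 2⁻¹ * B ^ 2 ≤ A * (B + 1) :=
    le_trans (by gcongr) key
  have h2 : C * B ^ 2 ≤ 4 * A * B := by nlinarith
  have h3 : C * B ≤ 4 * A := by
    have hB0 : 0 < B := by linarith
    refine le_of_mul_le_mul_right ?_ hB0
    calc C * B * B = C * B ^ 2 := by ring
      _ ≤ _ := h2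
  have h4 : 4 * A < δ * B := by
    have : 4 * A / δ < B := by linarith
    rwa [div_lt_iff₀ hδ, mul_comm B] at this
  nlinarith

theorem LaneEmdenProfile.mass_le (hU : LaneEmdenProfile N H R p U) (hH : IsFinslerNorm N H)
    (hp : 1 < p) (hR : 0 < R) (hpN : (N:ℝ) < p + 1)
    (hC : energyInf N H {x | dualNorm H x < R} p ≤ 1) :
    ∫ x in {x | dualNorm H x < R}, U x ^ p ≤
      (1 / 2 : ℝ) ^ p * volume.real {x | dualNorm H x < R} +
        2 * energyInf N H {x | dualNorm H x < R} p := by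
  have hP := hU.toWulffProfile
  have hp0 : 0 < p := by linarith
  have hi := hP.integrableOn_rpow hH (by linarith : 0 < p + 1)
  have h1 : ∫ x in {x | dualNorm H x < R}, U x ^ p ≤
      ∫ x in {x | dualNorm H x < R}, ((1 / 2 : ℝ) ^ p + 2 * U x ^ (p + 1)) := by
    refine setIntegral_mono_on (hP.integrableOn_rpow hH hp0)
      ((integrableOn_const (hH.volume_ball_ne_top R)).add (hi.const_mul 2))
      (hH.isOpen_ball R).measurableSet fun x hx => ?_
    have hpos := hP.pos x hx
    rcases le_total (U x) (1 / 2) with h | h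
    · have := Real.rpow_le_rpow hpos.le h hp0.le
      have : 0 ≤ U x ^ (p + 1) := by positivity
      linarith
    · rw [Real.rpow_add_one hpos.ne']
      have : 0 ≤ U x ^ p := by positivity
      have : 0 ≤ (1 / 2 : ℝ) ^ p := by positivity
      nlinarith
  have hc : IntegrableOn (fun _ : Euc N => (1 / 2 : ℝ) ^ p) {x | dualNorm H x < R} :=
    integrableOn_const (hH.volume_ball_ne_top R)
  rw [integral_add hc (hi.const_mul 2),
    setIntegral_const, smul_eq_mul, integral_const_mul, mul_comm] at h1
  refine h1.trans ?_
  have hE := hU.energy_le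
  have hapos := hP.integral_rpow_pos hH (by linarith : 0 < p + 1) hR
  set a := ∫ x in {x | dualNorm H x < R}, U x ^ (p + 1) with ha
  set C := energyInf N H {x | dualNorm H x < R} p
  have hθ : (N:ℝ) / (p + 1) < 1 := (div_lt_one (by linarith)).2 hpN
  have hθ0 : (0:ℝ) ≤ (N:ℝ) / (p + 1) := by positivity
  have haC : a ^ (1 - (N:ℝ) / (p + 1)) ≤ C := by
    rw [Real.rpow_sub hapos, Real.rpow_one]
    exact (div_le_iff₀ (by positivity)).2 hE
  have ha1 : a ≤ 1 := by
    by_contra h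
    have := Real.one_lt_rpow (not_le.1 h) (sub_pos.2 hθ)
    linarith
  have haC' : a ≤ C := by
    refine le_trans ?_ haC
    calc a = a ^ (1:ℝ) := (Real.rpow_one a).symm
      _ ≤ _ := Real.rpow_le_rpow_of_exponent_ge hapos ha1 (by linarith)
  linarith

theorem tendsto_mass {U : ℝ → Euc N → ℝ} (hU : ∀ p > 1, LaneEmdenProfile N H R p (U p))
    (hH : IsFinslerNorm N H) (hreg : FinslerRegular N H) (hN : 2 ≤ N) (hR : 0 < R) :
    Tendsto (fun p => ∫ x in {x | dualNorm H x < R}, U p x ^ p) atTop (𝓝 0) := by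
  have hC := tendsto_energyInf hH hreg hN hR
  have hlim : Tendsto (fun p : ℝ => (1 / 2 : ℝ) ^ p * volume.real {x : Euc N | dualNorm H x < R} +
      2 * energyInf N H {x | dualNorm H x < R} p) atTop (𝓝 0) := by
    have := ((tendsto_rpow_atTop_of_base_lt_one (1 / 2 : ℝ) (by norm_num) (by norm_num)).mul_const
      (volume.real {x : Euc N | dualNorm H x < R})).add (hC.const_mul 2)
    simpa using this
  refine squeeze_zero' ?_ ?_ hlim
  · filter_upwards [eventually_gt_atTop 1] with p hp
    exact ((hU p hp).toWulffProfile.integral_rpow_pos hH (by linarith) hR).le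
  · filter_upwards [eventually_gt_atTop 1, eventually_gt_atTop (N:ℝ),
      hC.eventually_le_const one_pos] with p hp hpN hC1
    exact (hU p hp).mass_le hH hp hR (by linarith) hC1

theorem tendsto_rpow_div_mass (hN : 2 ≤ N) {m : ℝ → ℝ} (hm : Tendsto m atTop (𝓝 0))
    (hm0 : ∀ᶠ p in atTop, 0 < m p) {c : ℝ} (hc : 0 < c) :
    Tendsto (fun p : ℝ => (c * m p ^ (1 / ((N:ℝ) - 1))) ^ p / m p) atTop (𝓝 0) := by
  have hN1 : (0:ℝ) < (N:ℝ) - 1 := by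
    have : (2:ℝ) ≤ N := by exact_mod_cast hN
    linarith
  have hM : Tendsto (fun p => c * m p ^ (1 / ((N:ℝ) - 1))) atTop (𝓝 0) := by
    have h := hm.rpow_const (p := 1 / ((N:ℝ) - 1)) (Or.inr (by positivity))
    rw [Real.zero_rpow (by positivity)] at h
    simpa using h.const_mul c
  have hb : Tendsto (fun p : ℝ => c ^ ((N:ℝ) - 1) * (1 / 2 : ℝ) ^ (p - ((N:ℝ) - 1))) atTop
      (𝓝 0) := by
    have := ((tendsto_rpow_atTop_of_base_lt_one (1 / 2 : ℝ) (by norm_num) (by norm_num)).comp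
      (tendsto_atTop_add_const_right atTop (-((N:ℝ) - 1)) tendsto_id)).const_mul (c ^ ((N:ℝ) - 1))
    simpa [sub_eq_add_neg] using! this
  refine squeeze_zero' ?_ ?_ hb
  · filter_upwards [hm0] with p hp
    positivity
  · filter_upwards [hm0, hM.eventually_le_const (by norm_num : (0:ℝ) < 1 / 2),
      eventually_ge_atTop ((N:ℝ) - 1)] with p hp hMp hpN
    set M := m p ^ (1 / ((N:ℝ) - 1)) with hMd
    have hM0 : 0 < M := by positivity
    have e : m p = M ^ ((N:ℝ) - 1) := by
      rw [hMd, ← Real.rpow_mul hp.le, one_div_mul_cancel hN1.ne', Real.rpow_one]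
    have e2 : (c * M) ^ p / m p = c ^ ((N:ℝ) - 1) * (c * M) ^ (p - ((N:ℝ) - 1)) := by
      have h1 : c ^ ((N:ℝ) - 1) ≠ 0 := by positivity
      have h2 : M ^ ((N:ℝ) - 1) ≠ 0 := by positivity
      rw [Real.rpow_sub (by positivity) p ((N:ℝ) - 1), e,
        Real.mul_rpow (z := (N:ℝ) - 1) hc.le hM0.le, mul_div_assoc', mul_div_mul_left _ _ h1]
    rw [e2]
    gcongr

end

section

variable {N : ℕ} {H : Euc N → ℝ} {R p : ℝ}

theorem LaneEmdenProfile.le_of_le_dualNorm {U : Euc N → ℝ} (hU : LaneEmdenProfile N H R p U)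
    (hH : IsFinslerNorm N H) (hreg : FinslerRegular N H) (hN : 2 ≤ N) (hp : 1 < p) {r : ℝ}
    (hr : 0 < r) {x : Euc N} (hrx : r ≤ dualNorm H x) (hx : dualNorm H x < R) :
    U x ≤ (1 / (N * wulffVol N H)) ^ (1 / ((N:ℝ) - 1)) * log (R / r) *
      (∫ x in {x | dualNorm H x < R}, U x ^ p) ^ (1 / ((N:ℝ) - 1)) := by
  have hκ := hH.wulffVol_pos
  have hR : 0 < R := (hr.trans_le hrx).trans hx
  have hx0 : x ≠ 0 := by
    rintro rfl
    rw [hH.dualNorm_zero] at hrx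
    linarith
  have hm := hU.toWulffProfile.integral_rpow_pos hH (by linarith : 0 < p) hR
  refine (hU.le_log hH hreg hN hp hx hx0).trans ?_
  rw [div_eq_mul_one_div, Real.mul_rpow hm.le (by positivity), mul_comm _ (_ ^ _), mul_assoc,
    mul_assoc, mul_comm (log _)]
  have : log (R / dualNorm H x) ≤ log (R / r) :=
    Real.log_le_log (div_pos hR (hr.trans_le hrx)) (by gcongr)
  gcongr

/-- A family of continuous probability densities on the Wulff ball which tends to zero uniformly
away from the origin converges to the Dirac mass at the origin. -/
theorem IsFinslerNorm.tendsto_integral_of_concentrates (hH : IsFinslerNorm N H) (hR : 0 < R)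
    {f : ℝ → Euc N → ℝ} (hf0 : ∀ᶠ p in atTop, ∀ x, dualNorm H x < R → 0 ≤ f p x)
    (hfi : ∀ᶠ p in atTop, IntegrableOn (f p) {x | dualNorm H x < R})
    (hf1 : ∀ᶠ p in atTop, ∫ x in {x | dualNorm H x < R}, f p x = 1)
    (hfr : ∀ r, 0 < r → r < R → ∀ δ, 0 < δ → ∀ᶠ p in atTop, ∀ x, r ≤ dualNorm H x →
      dualNorm H x < R → f p x ≤ δ)
    {φ : Euc N → ℝ} (hφ : Continuous φ) (hφc : HasCompactSupport φ) :
    Tendsto (fun p => ∫ x in {x | dualNorm H x < R}, f p x * φ x) atTop (𝓝 (φ 0)) := by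
  obtain ⟨S, hS⟩ := hφc.exists_bound_of_continuous hφ
  have hS0 : 0 ≤ S := (norm_nonneg _).trans (hS 0)
  obtain ⟨C, hC, hCK⟩ := hH.exists_norm_le_dualNorm
  refine Metric.tendsto_nhds.2 fun η hη => ?_
  set V := volume.real {x : Euc N | dualNorm H x < R} with hV
  have hV0 : 0 ≤ V := measureReal_nonneg
  obtain ⟨ρ, hρ, hρφ⟩ := Metric.continuous_iff.1 hφ 0 (η / 3) (by positivity)
  set r := min (ρ / C) (R / 2) with hr
  have hr0 : 0 < r := lt_min (by positivity) (by positivity)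
  have hrR : r < R := (min_le_right _ _).trans_lt (by linarith)
  set δ := η / (3 * (2 * S + 1) * (V + 1)) with hδ
  have hδ0 : 0 < δ := by positivity
  filter_upwards [hf0, hfi, hf1, hfr r hr0 hrR δ hδ0] with p h0 hi h1 hd
  have hφm : AEStronglyMeasurable φ (volume.restrict {x | dualNorm H x < R}) :=
    hφ.aestronglyMeasurable
  have hfφ : IntegrableOn (fun x => f p x * φ x) {x | dualNorm H x < R} :=
    hi.mul_bdd hφm (Eventually.of_forall hS)
  have hc : IntegrableOn (fun _ : Euc N => δ * (2 * S)) {x | dualNorm H x < R} :=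
    integrableOn_const (hH.volume_ball_ne_top R)
  have e : (∫ x in {x | dualNorm H x < R}, f p x * φ x) - φ 0 =
      ∫ x in {x | dualNorm H x < R}, (f p x * φ x - f p x * φ 0) := by
    rw [integral_sub hfφ (hi.mul_const _), integral_mul_const, h1, one_mul]
  rw [Real.dist_eq, e]
  have hb : |∫ x in {x | dualNorm H x < R}, (f p x * φ x - f p x * φ 0)| ≤
      ∫ x in {x | dualNorm H x < R}, (f p x * (η / 3) + δ * (2 * S)) := by
    rw [← Real.norm_eq_abs]
    refine norm_integral_le_of_norm_le ((hi.mul_const _).add hc) ?_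
    filter_upwards [ae_restrict_mem (hH.isOpen_ball R).measurableSet] with x hx
    have hfx := h0 x hx
    rw [← mul_sub, Real.norm_eq_abs, abs_mul, abs_of_nonneg hfx]
    rcases lt_or_ge (dualNorm H x) r with h | h
    · have : ‖x‖ < ρ := by
        refine (hCK x).trans_lt ?_
        have := h.trans_le (min_le_left _ _)
        rwa [lt_div_iff₀ hC, mul_comm] at this
      have h2 := hρφ x (by simpa using this)
      rw [Real.dist_eq] at h2
      have := mul_le_mul_of_nonneg_left h2.le hfx
      have : 0 ≤ δ * (2 * S) := by positivity
      linarith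
    · have h2 : |φ x - φ 0| ≤ 2 * S := by
        have ha := hS x
        have hb := hS 0
        rw [Real.norm_eq_abs] at ha hb
        have := abs_sub (φ x) (φ 0)
        linarith
      have h3 := mul_le_mul (hd x h hx) h2 (abs_nonneg _) hδ0.le
      have : 0 ≤ f p x * (η / 3) := by positivity
      linarith
  refine hb.trans_lt ?_
  rw [integral_add (hi.mul_const _) hc, integral_mul_const, h1, one_mul, setIntegral_const,
    smul_eq_mul, ← hV]
  have h2 : V * (δ * (2 * S)) ≤ η / 3 := by
    have : V * (2 * S) ≤ (2 * S + 1) * (V + 1) := by nlinarith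
    calc V * (δ * (2 * S)) = δ * (V * (2 * S)) := by ring
      _ ≤ δ * ((2 * S + 1) * (V + 1)) := by gcongr
      _ = η / 3 := by rw [hδ]; field_simp
  linarith

theorem WulffProfile.exists_isMax {U : Euc N → ℝ} (hU : WulffProfile N H R U)
    (hH : IsFinslerNorm N H) (hR : 0 < R) : ∃ x, dualNorm H x < R ∧ ∀ y, U y ≤ U x := by
  have h0 : dualNorm H 0 < R := by rwa [hH.dualNorm_zero]
  obtain ⟨x, -, hx⟩ := (hH.isCompact_closedBall R).exists_isMaxOn ⟨0, h0.le⟩ hU.cont.continuousOn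
  have hmax : ∀ y, U y ≤ U x := fun y => by
    by_cases hy : dualNorm H y < R
    · exact hx hy.le
    · rw [hU.eq_zero y hy]
      exact (hU.pos 0 h0).le.trans (hx h0.le)
  refine ⟨x, ?_, hmax⟩
  by_contra h
  have := hmax 0
  rw [hU.eq_zero x h] at this
  exact absurd (hU.pos 0 h0) (not_lt.2 this)

/-- The maximum of the normalized solutions diverges. -/
theorem eventually_lt_of_forall_le {U : ℝ → Euc N → ℝ}
    (hU : ∀ p > 1, LaneEmdenProfile N H R p (U p)) (hH : IsFinslerNorm N H)
    (hreg : FinslerRegular N H) (hN : 2 ≤ N) (hR : 0 < R) {T : ℝ} (hT : 0 < T) :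
    ∀ᶠ p in atTop, ∀ x, (∀ y, U p y ≤ U p x) →
      T * (∫ x in {x | dualNorm H x < R}, U p x ^ p) ^ (1 / ((N:ℝ) - 1)) < U p x := by
  set m : ℝ → ℝ := fun p => ∫ x in {x | dualNorm H x < R}, U p x ^ p with hm
  have hm0 : ∀ᶠ p in atTop, 0 < m p := by
    filter_upwards [eventually_gt_atTop 1] with p hp
    exact (hU p hp).toWulffProfile.integral_rpow_pos hH (by linarith) hR
  have hlim := (tendsto_rpow_div_mass hN (tendsto_mass hU hH hreg hN hR) hm0 hT).const_mul
    (volume.real {x : Euc N | dualNorm H x < R})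
  rw [mul_zero] at hlim
  filter_upwards [hm0, eventually_gt_atTop 1, hlim.eventually_lt_const one_pos] with p hmp hp hlt
    x hx
  by_contra! hle
  have hP := (hU p hp).toWulffProfile
  have h1 : m p ≤ ∫ _ in {x : Euc N | dualNorm H x < R},
      (T * m p ^ (1 / ((N:ℝ) - 1))) ^ p :=
    setIntegral_mono_on (hP.integrableOn_rpow hH (by linarith))
      (integrableOn_const (hH.volume_ball_ne_top R)) (hH.isOpen_ball R).measurableSet fun y hy =>
        Real.rpow_le_rpow (hP.pos y hy).le ((hx y).trans hle) (by linarith)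
  rw [setIntegral_const, smul_eq_mul] at h1
  rw [← mul_div_assoc, div_lt_one hmp] at hlt
  linarith

theorem blowUpSetFam_inter_eq {U : ℝ → Euc N → ℝ}
    (hU : ∀ p > 1, LaneEmdenProfile N H R p (U p)) (hH : IsFinslerNorm N H)
    (hreg : FinslerRegular N H) (hN : 2 ≤ N) (hR : 0 < R) {v : ℝ → Euc N → ℝ}
    (hv : ∀ p > 1, ∀ x, dualNorm H x < R →
      v p x = U p x / (∫ x in {x | dualNorm H x < R}, U p x ^ p) ^ (1 / ((N:ℝ) - 1))) :
    BlowUpSetFam {x | dualNorm H x < R} v ∩ {x | dualNorm H x < R} = {0} := by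
  have hm0 : ∀ p > 1, 0 < (∫ x in {x | dualNorm H x < R}, U p x ^ p) ^ (1 / ((N:ℝ) - 1)) :=
    fun p hp => Real.rpow_pos_of_pos
      ((hU p hp).toWulffProfile.integral_rpow_pos hH (by linarith) hR) _
  have hvb : ∀ r, 0 < r → ∀ p > 1, ∀ x, r ≤ dualNorm H x → dualNorm H x < R →
      v p x ≤ (1 / (N * wulffVol N H)) ^ (1 / ((N:ℝ) - 1)) * log (R / r) :=
    fun r hr p hp x hrx hx => by
      rw [hv p hp x hx, div_le_iff₀ (hm0 p hp)]
      exact (hU p hp).le_of_le_dualNorm hH hreg hN hp hr hrx hx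
  have h0 : dualNorm H (0 : Euc N) < R := by rwa [hH.dualNorm_zero]
  ext x
  rw [mem_singleton_iff]
  constructor
  · rintro ⟨⟨-, pn, hpn, xs, hxs, hxl, hvl⟩, -⟩
    by_contra hx0
    have hr := hH.dualNorm_pos hx0
    have hK := (hH.continuous_dualNorm.tendsto x).comp hxl
    obtain ⟨n, hn1, hn2, hn3⟩ := ((hpn.eventually_gt_atTop 1).and
      ((hK.eventually_const_le (half_lt_self hr)).and (hvl.eventually_gt_atTop
        ((1 / (N * wulffVol N H)) ^ (1 / ((N:ℝ) - 1)) * log (R / (dualNorm H x / 2)))))).exists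
    exact absurd (hvb _ (half_pos hr) _ hn1 _ hn2 (hxs n)) (not_le.2 hn3)
  · rintro rfl
    have hp1 : ∀ n : ℕ, (1:ℝ) < n + 2 := fun n => by
      have : (0:ℝ) ≤ n := n.cast_nonneg
      linarith
    have hpl : Tendsto (fun n : ℕ => (n:ℝ) + 2) atTop atTop :=
      tendsto_atTop_add_const_right _ _ tendsto_natCast_atTop_atTop
    choose xs hxs hmax using fun n : ℕ =>
      (hU _ (hp1 n)).toWulffProfile.exists_isMax hH hR
    have hvl : Tendsto (fun n : ℕ => v (n + 2) (xs n)) atTop atTop := by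
      refine tendsto_atTop.2 fun b => ?_
      have hT : 0 < max b 1 := lt_max_of_lt_right one_pos
      filter_upwards [hpl.eventually (eventually_lt_of_forall_le hU hH hreg hN hR hT)] with n hn
      rw [hv _ (hp1 n) _ (hxs n)]
      exact (le_max_left b 1).trans ((le_div_iff₀ (hm0 _ (hp1 n))).2 (hn _ (hmax n)).le)
    refine ⟨⟨subset_closure h0, fun n => n + 2, hpl, xs, hxs, ?_, hvl⟩, h0⟩
    obtain ⟨C, hC, hCK⟩ := hH.exists_norm_le_dualNorm
    refine Metric.tendsto_nhds.2 fun η hη => ?_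
    have hr : 0 < η / C := div_pos hη hC
    filter_upwards [hvl.eventually_gt_atTop
      ((1 / (N * wulffVol N H)) ^ (1 / ((N:ℝ) - 1)) * log (R / (η / C)))] with n hn
    rw [dist_zero_right]
    refine (hCK _).trans_lt ?_
    by_contra! h
    refine absurd (hvb _ hr _ (hp1 n) (xs n) ?_ (hxs n)) (not_le.2 hn)
    rwa [div_le_iff₀ hC, mul_comm]

theorem tendsto_integral_density {U : ℝ → Euc N → ℝ}
    (hU : ∀ p > 1, LaneEmdenProfile N H R p (U p)) (hH : IsFinslerNorm N H)
    (hreg : FinslerRegular N H) (hN : 2 ≤ N) (hR : 0 < R) {φ : Euc N → ℝ} (hφ : Continuous φ)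
    (hφc : HasCompactSupport φ) :
    Tendsto (fun p => ∫ x in {x | dualNorm H x < R},
      (U p x ^ p / ∫ y in {x | dualNorm H x < R}, U p y ^ p) * φ x) atTop (𝓝 (φ 0)) := by
  have hm0 : ∀ p > 1, 0 < ∫ x in {x | dualNorm H x < R}, U p x ^ p :=
    fun p hp => (hU p hp).toWulffProfile.integral_rpow_pos hH (by linarith) hR
  have hκ := hH.wulffVol_pos
  have hN0 : (0:ℝ) < N := by exact_mod_cast (by omega : 0 < N)
  refine hH.tendsto_integral_of_concentrates hR ?_ ?_ ?_ (fun r hr hrR δ hδ => ?_) hφ hφc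
  · filter_upwards [eventually_gt_atTop 1] with p hp x hx
    exact div_nonneg (Real.rpow_nonneg ((hU p hp).pos x hx).le _) (hm0 p hp).le
  · filter_upwards [eventually_gt_atTop 1] with p hp
    exact ((hU p hp).toWulffProfile.integrableOn_rpow hH (by linarith)).div_const _
  · filter_upwards [eventually_gt_atTop 1] with p hp
    rw [integral_div, div_self (hm0 p hp).ne']
  · have hlog : 0 < log (R / r) := Real.log_pos ((one_lt_div hr).2 hrR)
    have hc : 0 < (1 / (N * wulffVol N H)) ^ (1 / ((N:ℝ) - 1)) * log (R / r) := by positivity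
    filter_upwards [eventually_gt_atTop 1, (tendsto_rpow_div_mass hN
      (tendsto_mass hU hH hreg hN hR) ((eventually_gt_atTop 1).mono hm0) hc).eventually_le_const
        hδ] with p hp hle x hrx hx
    refine le_trans ?_ hle
    have := hm0 p hp
    have := (hU p hp).pos x hx
    gcongr
    exact (hU p hp).le_of_le_dualNorm hH hreg hN hp hr hrx hx

end

/-- On the Wulff ball, the blow-up set is exactly the origin and the normalized densities
concentrate at the origin (Corollary 7.1). -/
theorem wulff_ball_concentration (N : ℕ) (hN : 2 ≤ N) (H : Euc N → ℝ)
    (hnorm : IsFinslerNorm N H) (hreg : FinslerRegular N H)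
    (R : ℝ) (hR : 0 < R)
    (u : ℝ → Euc N → ℝ)
    (hu : ∀ p > 1, IsLeastEnergySolution N H {x : Euc N | dualNorm H x < R} p (u p))
    (v : ℝ → Euc N → ℝ)
    (hv : ∀ p x, v p x = u p x
      / (∫ y in {x : Euc N | dualNorm H x < R}, u p y ^ p) ^ (1 / ((N : ℝ) - 1))) :
    (BlowUpSetFam {x : Euc N | dualNorm H x < R} v ∩ {x : Euc N | dualNorm H x < R}
        = {(0 : Euc N)}) ∧
    ∀ φ : Euc N → ℝ, Continuous φ → HasCompactSupport φ →
      tsupport φ ⊆ {x : Euc N | dualNorm H x < R} →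
      Tendsto (fun p : ℝ => ∫ x in {x : Euc N | dualNorm H x < R},
          (u p x ^ p / ∫ y in {x : Euc N | dualNorm H x < R}, u p y ^ p) * φ x)
        atTop (𝓝 (φ 0)) := by
  set U : ℝ → Euc N → ℝ := fun p => {x : Euc N | dualNorm H x < R}.indicator (u p) with hUd
  have hU : ∀ p > 1, LaneEmdenProfile N H R p (U p) := fun p hp =>
    (hu p hp).laneEmdenProfile hnorm hreg hN hp
  have hUu : ∀ p x, dualNorm H x < R → U p x = u p x := fun p x hx =>
    indicator_of_mem (s := {x : Euc N | dualNorm H x < R}) hx _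
  have hmeas := (hnorm.isOpen_ball R).measurableSet
  have hm : ∀ p, ∫ y in {x : Euc N | dualNorm H x < R}, u p y ^ p =
      ∫ y in {x : Euc N | dualNorm H x < R}, U p y ^ p := fun p =>
    setIntegral_congr_fun hmeas fun x hx => by simp only [hUu p x hx]
  refine ⟨blowUpSetFam_inter_eq hU hnorm hreg hN hR fun p _ x hx => ?_, fun φ hφ hφc _ => ?_⟩
  · rw [hv, hm, hUu p x hx]
  · refine (tendsto_integral_density hU hnorm hreg hN hR hφ hφc).congr fun p => ?_
    refine setIntegral_congr_fun hmeas fun x hx => ?_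
    simp only [hm, hUu p x hx]
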